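/- For all t > 0, there exists c = c(t) such that every graph in F_t with treewidth more than c and with no star cutset contains a subdivision of the t-by-t wall W_{t×t} as an induced subgraph. -/

import Mathlib

open SimpleGraph Set List

namespace Paper

variable {V : Type} {W : Type}

/-- The closed neighborhood `N[v]` of a vertex. -/
def closedNbhd (G : SimpleGraph V) (v : V) : Set V := insert v (G.neighborSet v)

/-- The degree of a vertex (as the number of its neighbors). -/
noncomputable def deg (G : SimpleGraph V) (v : V) : ℕ := (G.neighborSet v).ncard

/-- `G` contains `H` as an induced subgraph, i.e. some induced subgraph of `G` is
isomorphic to `H`. -/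
def ContainsInduced (G : SimpleGraph V) (H : SimpleGraph W) : Prop :=
  ∃ s : Set V, Nonempty (H ≃g G.induce s)

/-- `(A, C, B)` is a separation of `G`. -/
def IsSeparation (G : SimpleGraph V) (A C B : Set V) : Prop :=
  A ∪ C ∪ B = Set.univ ∧ Disjoint A C ∧ Disjoint A B ∧ Disjoint C B ∧
    ∀ a ∈ A, ∀ b ∈ B, ¬G.Adj a b

/-- `G` admits a star cutset. -/
def HasStarCutset (G : SimpleGraph V) : Prop :=
  ∃ A C B : Set V, IsSeparation G A C B ∧ A.Nonempty ∧ B.Nonempty ∧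
    ∃ v ∈ C, C ⊆ closedNbhd G v

/-- `G` admits a clique cutset. -/
def HasCliqueCutset (G : SimpleGraph V) : Prop :=
  ∃ A C B : Set V, IsSeparation G A C B ∧ A.Nonempty ∧ B.Nonempty ∧ G.IsClique C

/-- `D` is a connected component of `G \ X`: a maximal connected subset of `Xᶜ`. -/
def IsComponentOf (G : SimpleGraph V) (X : Set V) (D : Set V) : Prop :=
  D.Nonempty ∧ D ⊆ Xᶜ ∧ (G.induce D).Connected ∧
    ∀ D' : Set V, D ⊆ D' → D' ⊆ Xᶜ → (G.induce D').Connected → D' = D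

/-- An induced path in `G` ("path" in the paper always means induced path). -/
def IsIPath (G : SimpleGraph V) {u v : V} (P : G.Walk u v) : Prop :=
  P.IsPath ∧ P.toSubgraph.IsInduced

/-- A hole: an induced cycle of length at least four. -/
def IsHole (G : SimpleGraph V) {v : V} (c : G.Walk v v) : Prop :=
  c.IsCycle ∧ 4 ≤ c.length ∧ c.toSubgraph.IsInduced

/-- `G` is sparse: for every hole and every vertex not in it, there is an edge `ab` of the
hole containing all neighbors of the vertex in the hole. -/
def Sparse (G : SimpleGraph V) : Prop :=
  ∀ (v : V) (c : G.Walk v v), IsHole G c → ∀ x, x ∉ c.support →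
    ∃ a b, c.toSubgraph.Adj a b ∧ ∀ y ∈ c.support, G.Adj x y → y = a ∨ y = b

/-- `G` contains a pyramid (necessarily as an induced subgraph). -/
def ContainsPyramid (G : SimpleGraph V) : Prop :=
  ∃ (a b₁ b₂ b₃ : V) (P₁ : G.Walk a b₁) (P₂ : G.Walk a b₂) (P₃ : G.Walk a b₃),
    G.Adj b₁ b₂ ∧ G.Adj b₂ b₃ ∧ G.Adj b₁ b₃ ∧
    IsIPath G P₁ ∧ IsIPath G P₂ ∧ IsIPath G P₃ ∧
    1 ≤ P₁.length ∧ 1 ≤ P₂.length ∧ 1 ≤ P₃.length ∧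
    ¬(P₁.length = 1 ∧ P₂.length = 1) ∧ ¬(P₁.length = 1 ∧ P₃.length = 1) ∧
    ¬(P₂.length = 1 ∧ P₃.length = 1) ∧
    (∀ p ∈ P₁.support, p ≠ a → ∀ q ∈ P₂.support, q ≠ a →
      p ≠ q ∧ (G.Adj p q → p = b₁ ∧ q = b₂)) ∧
    (∀ p ∈ P₁.support, p ≠ a → ∀ q ∈ P₃.support, q ≠ a →
      p ≠ q ∧ (G.Adj p q → p = b₁ ∧ q = b₃)) ∧
    (∀ p ∈ P₂.support, p ≠ a → ∀ q ∈ P₃.support, q ≠ a →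
      p ≠ q ∧ (G.Adj p q → p = b₂ ∧ q = b₃))

/-- `G` contains a prism (necessarily as an induced subgraph). -/
def ContainsPrism (G : SimpleGraph V) : Prop :=
  ∃ (a₁ a₂ a₃ b₁ b₂ b₃ : V) (P₁ : G.Walk a₁ b₁) (P₂ : G.Walk a₂ b₂) (P₃ : G.Walk a₃ b₃),
    G.Adj a₁ a₂ ∧ G.Adj a₂ a₃ ∧ G.Adj a₁ a₃ ∧
    G.Adj b₁ b₂ ∧ G.Adj b₂ b₃ ∧ G.Adj b₁ b₃ ∧
    IsIPath G P₁ ∧ IsIPath G P₂ ∧ IsIPath G P₃ ∧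
    1 ≤ P₁.length ∧ 1 ≤ P₂.length ∧ 1 ≤ P₃.length ∧
    (∀ p ∈ P₁.support, ∀ q ∈ P₂.support,
      p ≠ q ∧ (G.Adj p q → (p = a₁ ∧ q = a₂) ∨ (p = b₁ ∧ q = b₂))) ∧
    (∀ p ∈ P₁.support, ∀ q ∈ P₃.support,
      p ≠ q ∧ (G.Adj p q → (p = a₁ ∧ q = a₃) ∨ (p = b₁ ∧ q = b₃))) ∧
    (∀ p ∈ P₂.support, ∀ q ∈ P₃.support,
      p ≠ q ∧ (G.Adj p q → (p = a₂ ∧ q = a₃) ∨ (p = b₂ ∧ q = b₃)))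

/-- `G` is very sparse: sparse, pyramid-free and prism-free. -/
def VerySparse (G : SimpleGraph V) : Prop :=
  Sparse G ∧ ¬ContainsPyramid G ∧ ¬ContainsPrism G

/-- `G ∈ 𝓕_t`: `G` is very sparse with no clique of size at least `t+1`. -/
def MemF (t : ℕ) (G : SimpleGraph V) : Prop :=
  VerySparse G ∧ ∀ s : Set V, G.IsClique s → s.ncard ≤ t

/-- `G` has a tree decomposition of width at most `k`. -/
def HasTreewidthAtMost (G : SimpleGraph V) (k : ℕ) : Prop :=
  ∃ (ι : Type) (T : SimpleGraph ι) (χ : ι → Finset V),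
    T.IsTree ∧
    (∀ v : V, ∃ t, v ∈ χ t) ∧
    (∀ u v : V, G.Adj u v → ∃ t, u ∈ χ t ∧ v ∈ χ t) ∧
    (∀ v : V, (T.induce {t | v ∈ χ t}).Connected) ∧
    ∀ t, (χ t).card ≤ k + 1

/-- The `n`-by-`n` wall, as a brick wall graph: `n` rows of `2n` vertices each,
with horizontal path edges in each row, and vertical edges between consecutive
rows placed alternately. -/
def Wall (n : ℕ) : SimpleGraph (Fin n × Fin (2 * n)) :=
  SimpleGraph.fromRel (fun a b =>
    (a.1 = b.1 ∧ a.2.val + 1 = b.2.val) ∨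
    (a.2 = b.2 ∧ a.1.val + 1 = b.1.val ∧ (a.1.val + a.2.val) % 2 = 0))

/-- The graph obtained from `G` by subdividing the edge `uv` once (the new vertex
is `none`). -/
def subdivideEdge (G : SimpleGraph V) (u v : V) : SimpleGraph (Option V) :=
  SimpleGraph.fromRel (fun a b =>
    (∃ x y : V, a = some x ∧ b = some y ∧ G.Adj x y ∧ ¬(x = u ∧ y = v) ∧ ¬(x = v ∧ y = u)) ∨
    (a = none ∧ (b = some u ∨ b = some v)))

/-- `IsSubdivision G H`: `G` is (isomorphic to) a graph obtained from `H` by repeatedly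
subdividing edges. -/
inductive IsSubdivision : {α : Type} → SimpleGraph α → {β : Type} → SimpleGraph β → Prop where
  | base {α β : Type} {G : SimpleGraph α} {H : SimpleGraph β} :
      Nonempty (G ≃g H) → IsSubdivision G H
  | step {α β : Type} {G : SimpleGraph α} {H : SimpleGraph β} (u v : β) :
      H.Adj u v → IsSubdivision G (subdivideEdge H u v) → IsSubdivision G H

/-- `G` contains a subdivision of the `t`-by-`t` wall as an induced subgraph. -/
def ContainsWallSubdiv (G : SimpleGraph V) (t : ℕ) : Prop :=
  ∃ (α : Type) (S : SimpleGraph α), IsSubdivision S (Wall t) ∧ ContainsInduced G S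

/-- `G` contains the line graph of a subdivision of the `t`-by-`t` wall as an induced
subgraph. -/
def ContainsLineWallSubdiv (G : SimpleGraph V) (t : ℕ) : Prop :=
  ∃ (α : Type) (S : SimpleGraph α), IsSubdivision S (Wall t) ∧
    ContainsInduced G S.lineGraph

/-- `G` is `𝓣₁`-free: no vertex has two or more neighbors in a hole not containing it. -/
def T1Free (G : SimpleGraph V) : Prop :=
  ∀ (v : V) (c : G.Walk v v), IsHole G c → ∀ x, x ∉ c.support →
    ∀ y z, y ∈ c.support → z ∈ c.support → G.Adj x y → G.Adj x z → y = z

/-- `G` is `𝓣₂`-free: no vertex has two non-adjacent neighbors in a hole not containing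
it, and `G` is pyramid-free and prism-free. -/
def T2Free (G : SimpleGraph V) : Prop :=
  (∀ (v : V) (c : G.Walk v v), IsHole G c → ∀ x, x ∉ c.support →
    ∀ y z, y ∈ c.support → z ∈ c.support → G.Adj x y → G.Adj x z → y ≠ z → G.Adj y z) ∧
  ¬ContainsPyramid G ∧ ¬ContainsPrism G

/-- The weight `w(X)` of a set of vertices. -/
noncomputable def setW (w : V → ℝ) (X : Set V) : ℝ := ∑ᶠ x ∈ X, w x

/-- `w` is a weight function on `G`: values in `[0,1]` with total weight `1`. -/
def IsWeightFn (w : V → ℝ) : Prop :=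
  (∀ v, 0 ≤ w v ∧ w v ≤ 1) ∧ setW w Set.univ = 1

/-- `X` is a `(w, c)`-balanced separator. -/
def IsBalSep (G : SimpleGraph V) (w : V → ℝ) (c : ℝ) (X : Set V) : Prop :=
  ∀ D, IsComponentOf G X D → setW w D ≤ c

/-- `(G, w)` is `d`-unbalanced: `w` is a weight function and there is no
`(w, 1/2)`-balanced separator of size at most `d`. -/
def Unbalanced (G : SimpleGraph V) (w : V → ℝ) (d : ℕ) : Prop :=
  IsWeightFn w ∧ ∀ X : Set V, X.ncard ≤ d → ¬IsBalSep G w (1 / 2 : ℝ) X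

/-- `B = B(K₁,K₂)` is the (unique) component of `G ∖ (K₁ ∪ K₂)` of weight more
than `1/2`.  Then `A(K₁,K₂) = (B ∪ K₁ ∪ K₂)ᶜ` and `S(K₁,K₂) = (A, K₁ ∪ K₂, B)` is the
canonical two-clique-separation for `{K₁, K₂}`. -/
def IsCanonicalB (G : SimpleGraph V) (w : V → ℝ) (K₁ K₂ B : Set V) : Prop :=
  IsComponentOf G (K₁ ∪ K₂) B ∧ (1 / 2 : ℝ) < setW w B

/-- The open neighborhood `N(D)` of a set of vertices. -/
def nbhdOfSet (G : SimpleGraph V) (D : Set V) : Set V :=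
  {v | v ∉ D ∧ ∃ d ∈ D, G.Adj v d}

/-- The canonical two-clique-separation `S(K₁,K₂)` (with big side `B`) is proper. -/
def ProperPair (G : SimpleGraph V) (w : V → ℝ) (K₁ K₂ B : Set V) : Prop :=
  IsCanonicalB G w K₁ K₂ B ∧
  (∃ D, IsComponentOf G (K₁ ∪ K₂) D ∧ D ⊆ (B ∪ K₁ ∪ K₂)ᶜ ∧
    K₁ ∪ K₂ ⊆ nbhdOfSet G D) ∧
  (K₁.ncard = 1 → K₂.ncard = 1 →
    ¬∃ (x y : V) (P : G.Walk x y), K₁ = {x} ∧ K₂ = {y} ∧ IsIPath G P ∧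
      {v | v ∈ P.support} = (B ∪ K₁ ∪ K₂)ᶜ ∪ K₁ ∪ K₂)

/-- The canonical two-clique-separation `S(K₁,K₂)` (with big side `B`) is active,
where `K` bounds the size of the cliques considered. -/
def ActivePair (G : SimpleGraph V) (w : V → ℝ) (K : ℕ) (K₁ K₂ B : Set V) : Prop :=
  ProperPair G w K₁ K₂ B ∧
  ∀ K₁' K₂' B' : Set V, G.IsClique K₁' → G.IsClique K₂' →
    K₁'.ncard ≤ K → K₂'.ncard ≤ K → ProperPair G w K₁' K₂' B' →
    K₁ ∪ K₂ ≠ K₁' ∪ K₂' →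
      ¬(B' ∪ K₁' ∪ K₂' ⊂ B ∪ K₁ ∪ K₂) ∧
      (B' ∪ K₁' ∪ K₂' = B ∪ K₁ ∪ K₂ → B' ⊂ B)

/-- The interiors of two paths from `a` to `b` are disjoint and anticomplete. -/
def IntDisjAnti (G : SimpleGraph V) {a b : V} (P Q : G.Walk a b) : Prop :=
  ∀ x ∈ P.support, x ≠ a → x ≠ b → ∀ y ∈ Q.support, y ≠ a → y ≠ b → x ≠ y ∧ ¬G.Adj x y

/-- `Q₁, Q₂, Q₃` form a theta (as an induced subgraph of `G`) with ends `a, b`. -/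
def ThetaCfg (G : SimpleGraph V) {a b : V} (Q₁ Q₂ Q₃ : G.Walk a b) : Prop :=
  ¬G.Adj a b ∧
  IsIPath G Q₁ ∧ IsIPath G Q₂ ∧ IsIPath G Q₃ ∧
  2 ≤ Q₁.length ∧ 2 ≤ Q₂.length ∧ 2 ≤ Q₃.length ∧
  IntDisjAnti G Q₁ Q₂ ∧ IntDisjAnti G Q₁ Q₃ ∧ IntDisjAnti G Q₂ Q₃

/-- There is a theta through the seagull `a-v-u` in `G`: a theta one of whose ends is
`a` or `u` and which contains the seagull. -/
def ThetaThroughSeagull (G : SimpleGraph V) (a v u : V) : Prop :=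
  (∃ (b : V) (Q₁ Q₂ Q₃ : G.Walk a b), ThetaCfg G Q₁ Q₂ Q₃ ∧ [a, v, u] <+: Q₁.support) ∨
  (∃ (b : V) (Q₁ Q₂ Q₃ : G.Walk u b), ThetaCfg G Q₁ Q₂ Q₃ ∧ [u, v, a] <+: Q₁.support)

/-- `a-v-u` is a heavy seagull in `G`: an induced three-vertex path whose ends both
have degree at least three. -/
def HeavySeagull (G : SimpleGraph V) (a v u : V) : Prop :=
  a ≠ u ∧ G.Adj a v ∧ G.Adj v u ∧ ¬G.Adj a u ∧ 3 ≤ deg G a ∧ 3 ≤ deg G u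

end Paper

namespace Paper
variable {V : Type} {G G' : SimpleGraph V} {A B C D P : Set V} {x y z : V}

def RR (G : SimpleGraph V) (D : Set V) (a b : V) : Prop := G.Adj a b ∧ a ∈ D ∧ b ∈ D
def Rch (G : SimpleGraph V) (D : Set V) : V → V → Prop := Relation.ReflTransGen (RR G D)
def Cn (G : SimpleGraph V) (B : Set V) : Prop := B.Nonempty ∧ ∀ x ∈ B, ∀ y ∈ B, Rch G B x y
def cmp (G : SimpleGraph V) (D : Set V) (x : V) : Set V := {y | Rch G D x y}

lemma Rch.symm (h : Rch G D x y) : Rch G D y x := by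
  induction h with
  | refl => exact .refl
  | tail _ h ih => exact Relation.ReflTransGen.head ⟨h.1.symm, h.2.2, h.2.1⟩ ih
lemma Rch.trans (h : Rch G D x y) (h' : Rch G D y z) : Rch G D x z := Relation.ReflTransGen.trans h h'
lemma Rch.mono' (h : Rch G C x y) (hg : ∀ a ∈ C, ∀ b ∈ C, G.Adj a b → G'.Adj a b) (hd : C ⊆ D) :
    Rch G' D x y :=
  Relation.ReflTransGen.mono (fun a b (h : RR G C a b) => (⟨hg a h.2.1 b h.2.2 h.1, hd h.2.1, hd h.2.2⟩ : RR G' D a b)) _ _ h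
lemma Rch.mono (h : Rch G C x y) (hd : C ⊆ D) : Rch G D x y := h.mono' (fun _ _ _ _ h => h) hd
lemma Rch.adj (h : G.Adj x y) (hx : x ∈ D) (hy : y ∈ D) : Rch G D x y := .single ⟨h, hx, hy⟩
lemma Rch.ind (h : Rch G D x y) (hx : x ∈ P)
    (hc : ∀ a ∈ P, a ∈ D → ∀ b ∈ D, G.Adj a b → b ∈ P) : y ∈ P := by
  induction h with
  | refl => exact hx
  | tail _ h ih => exact hc _ ih h.2.1 _ h.2.2 h.1
lemma Rch.mem (h : Rch G D x y) (hx : x ∈ D) : y ∈ D := h.ind hx (fun _ _ _ _ h _ => h)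
lemma mem_cmp : x ∈ cmp G D x := Relation.ReflTransGen.refl
lemma cmp_sub (hx : x ∈ D) : cmp G D x ⊆ D := fun _ h => Rch.mem h hx
lemma cmp_step (hx : x ∈ D) (h : y ∈ cmp G D x) (hz : z ∈ D) (ha : G.Adj y z) : z ∈ cmp G D x :=
  Rch.trans h (Rch.adj ha (cmp_sub hx h) hz)
lemma Rch_cmp (hx : x ∈ D) (h : Rch G D x y) : Rch G (cmp G D x) x y := by
  induction h with
  | refl => exact .refl
  | tail h1 h ih => exact Relation.ReflTransGen.tail ih ⟨h.1, h1, cmp_step hx h1 h.2.2 h.1⟩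
lemma Cn_of (hx : x ∈ B) (h : ∀ y ∈ B, Rch G B x y) : Cn G B :=
  ⟨⟨x, hx⟩, fun a ha b hb => (h a ha).symm.trans (h b hb)⟩
lemma Cn_cmp (hx : x ∈ D) : Cn G (cmp G D x) := Cn_of mem_cmp (fun _ hy => Rch_cmp hx hy)
lemma Cn.sub_cmp (h : Cn G B) (hd : B ⊆ D) (hx : x ∈ B) : B ⊆ cmp G D x :=
  fun y hy => (h.2 x hx y hy).mono hd
lemma Cn.sub_cmp' (h : Cn G B) (hd : B ⊆ D) (hy : y ∈ B) (hyc : y ∈ cmp G D x) :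
    B ⊆ cmp G D x := fun z hz => Rch.trans hyc (h.sub_cmp hd hy hz)
lemma Cn_single : Cn G {x} := Cn_of (mem_singleton x) (by rintro y rfl; exact .refl)
lemma Cn.mono_g (h : Cn G B) (hg : ∀ a ∈ B, ∀ b ∈ B, G.Adj a b → G'.Adj a b) : Cn G' B :=
  ⟨h.1, fun x hx y hy => (h.2 x hx y hy).mono' hg subset_rfl⟩
lemma Cn.cut (h : Cn G B) (hx : x ∈ B) (hxP : x ∈ P) (hy : y ∈ B) (hyP : y ∉ P) :
    ∃ a ∈ B, ∃ b ∈ B, a ∈ P ∧ b ∉ P ∧ G.Adj a b := by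
  by_contra hc
  push Not at hc
  exact hyP ((h.2 x hx y hy).ind hxP (fun a ha haB b hb hab => by
    by_contra hbP; exact hc a haB b hb ha hbP hab))
lemma Cn_of_cut (hx : x ∈ B)
    (h : ∀ P ⊆ B, x ∈ P → (∀ a ∈ P, ∀ b ∈ B, G.Adj a b → b ∈ P) → B ⊆ P) : Cn G B :=
  Cn_of hx (fun _ hy => h (cmp G B x) (cmp_sub hx) mem_cmp
    (fun _ ha _ hb hab => cmp_step hx ha hb hab) hy)
def Tch (G : SimpleGraph V) (A B : Set V) : Prop := ∃ x ∈ A, ∃ y ∈ B, x = y ∨ G.Adj x y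
lemma Tch.symm (h : Tch G A B) : Tch G B A := by
  obtain ⟨x, hx, y, hy, h⟩ := h
  exact ⟨y, hy, x, hx, h.imp Eq.symm fun h => h.symm⟩
lemma Cn.union (hA : Cn G A) (hB : Cn G B) (h : Tch G A B) : Cn G (A ∪ B) := by
  obtain ⟨x, hx, y, hy, h⟩ := h
  have hxy : Rch G (A ∪ B) x y := by
    rcases h with rfl | h
    · exact .refl
    · exact Rch.adj h (Or.inl hx) (Or.inr hy)
  refine Cn_of (x := x) (Or.inl hx) ?_
  rintro z (hz | hz)
  · exact (hA.2 x hx z hz).mono subset_union_left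
  · exact hxy.trans ((hB.2 y hy z hz).mono subset_union_right)
lemma Cn.insert (hA : Cn G A) (hy : y ∈ A) (h : G.Adj x y) : Cn G (insert x A) := by
  have := Cn.union (Cn_single (x := x)) hA ⟨x, rfl, y, hy, Or.inr h⟩
  rwa [singleton_union] at this
lemma Cn_iUnion {ι : Type*} {B : ι → Set V} (hA : Cn G A) (hB : ∀ i, Cn G (B i))
    (h : ∀ i, Tch G A (B i)) : Cn G (A ∪ ⋃ i, B i) := by
  obtain ⟨x, hx⟩ := hA.1
  refine Cn_of (x := x) (Or.inl hx) ?_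
  rintro z (hz | hz)
  · exact (hA.2 x hx z hz).mono subset_union_left
  · obtain ⟨i, hi⟩ := mem_iUnion.1 hz
    exact ((hA.union (hB i) (h i)).2 x (Or.inl hx) z (Or.inr hi)).mono
      (union_subset_union_right _ (subset_iUnion B i))

lemma Cn.trim (hE : Cn G D) (hx : x ∈ D) (hxA : x ∈ A) (hy : y ∈ D) (hyB : y ∈ B)
    (hd : Disjoint A B) : ∃ E ⊆ D \ B, Cn G E ∧ x ∈ E ∧ ∃ a ∈ E, ∃ b ∈ D ∩ B, G.Adj a b := by
  have hxB : x ∉ B := fun h => Set.disjoint_left.1 hd hxA h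
  have hxD : x ∈ D \ B := ⟨hx, hxB⟩
  refine ⟨cmp G (D \ B) x, cmp_sub hxD, Cn_cmp hxD, mem_cmp, ?_⟩
  obtain ⟨a, ha, b, hb, haP, hbP, hab⟩ := hE.cut (P := cmp G (D \ B) x) hx mem_cmp hy
    (fun h => (cmp_sub hxD h).2 hyB)
  refine ⟨a, haP, b, ⟨hb, ?_⟩, hab⟩
  by_contra hbB
  exact hbP (cmp_step hxD haP ⟨hb, hbB⟩ hab)

end Paper

namespace Paper
variable {V : Type} {G G' : SimpleGraph V} {A B C D P S X Z : Set V} {x y z : V}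

def Lk (G : SimpleGraph V) (A B : Set V) (n : ℕ) : Prop :=
  ∃ L : Fin n → Set V, (∀ i, Cn G (L i) ∧ (L i ∩ A).Nonempty ∧ (L i ∩ B).Nonempty) ∧
    ∀ i j, i ≠ j → Disjoint (L i) (L j)
def Sep (G : SimpleGraph V) (A B S : Set V) : Prop :=
  ∀ a ∈ A, a ∉ S → ∀ b ∈ B, b ∉ S → ¬ Rch G Sᶜ a b

lemma exists_fin [Finite V] {n : ℕ} (h : n ≤ Z.ncard) :
    ∃ f : Fin n → V, Function.Injective f ∧ ∀ i, f i ∈ Z := by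
  classical
  have := Fintype.ofFinite Z
  have h1 : Fintype.card (Fin n) ≤ Fintype.card Z := by
    rw [Fintype.card_fin, ← Nat.card_eq_fintype_card]; exact h
  obtain ⟨f⟩ := Function.Embedding.nonempty_of_card_le h1
  exact ⟨fun i => f i, fun i j h => f.injective (Subtype.ext h), fun i => (f i).2⟩

lemma exists_fin_rng {n : ℕ} (f : Fin n → V) (hf : Function.Injective f) :
    (range f).ncard = n := by
  rw [← image_univ, ncard_image_of_injective _ hf, ncard_univ, Nat.card_fin]

lemma Sep.symm (h : Sep G A B S) : Sep G B A S :=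
  fun a ha haS b hb hbS h' => h b hb hbS a ha haS h'.symm

lemma sep_lift (hS : Sep G' A B S) (hG : ∀ u v, G.Adj u v → G'.Adj u v ∨ (u = x ∧ v = y) ∨ (u = y ∧ v = x))
    (hy : ∀ a ∈ A, a ∉ S → ¬ Rch G' Sᶜ a y)
    (hX : Sep G' A (insert x S) X) : Sep G A B X := by
  intro a ha haX b hb hbX hr
  by_cases haS : a ∈ insert x S
  · exact hX a ha haX a haS haX .refl
  have haD : a ∈ (X ∪ insert x S)ᶜ := by simp [haX]; simpa using haS
  have hbP : b ∈ cmp G' (X ∪ insert x S)ᶜ a := by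
    refine hr.ind mem_cmp ?_
    intro z hz hzX w hw hzw
    have hzD := cmp_sub haD hz
    by_cases hwS : w ∈ insert x S
    · rcases hG z w hzw with h | h | h
      · exact absurd ((Rch.mono hz (by intro t ht; simp at ht ⊢; tauto)).trans
          (Rch.adj h hzX hw)) (hX a ha haX w hwS hw)
      · simp [h.1] at hzD
      · exact absurd (h.1 ▸ (Rch.mono hz (by intro t ht; simp at ht ⊢; exact ht.2.2)))
          (hy a ha (fun h => haS (Or.inr h)))
    · refine cmp_step haD hz (by simp at hw hwS ⊢; tauto) ?_
      rcases hG z w hzw with h | h | h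
      · exact h
      · simp [h.1] at hzD
      · simp [h.2] at hwS
  have hbD := cmp_sub haD hbP
  exact hS a ha (fun h => haS (Or.inr h)) b hb (by simp at hbD; tauto)
    (Rch.mono hbP (by intro t ht; simp at ht ⊢; exact ht.2.2))

lemma Lk.toZ [Finite V] (h : Lk G A Z Z.ncard) : ∃ L : V → Set V,
    (∀ z ∈ Z, Cn G (L z) ∧ (L z ∩ A).Nonempty ∧ L z ∩ Z = {z} ∧
      ∀ S ⊆ Z, ∀ w ∈ L z, w ∉ S → ∃ a ∈ A, a ∉ S ∧ Rch G Sᶜ a w) ∧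
    ∀ z ∈ Z, ∀ z' ∈ Z, z ≠ z' → Disjoint (L z) (L z') := by
  classical
  obtain ⟨L, h1, h2⟩ := h
  have key : ∀ i, ∃ z M, M ⊆ L i ∧ Cn G M ∧ (M ∩ A).Nonempty ∧ M ∩ Z = {z} ∧
      ∀ S ⊆ Z, ∀ w ∈ M, w ∉ S → ∃ a ∈ A, a ∉ S ∧ Rch G Sᶜ a w := by
    intro i
    obtain ⟨hc, ⟨a, haL, haA⟩, ⟨b, hbL, hbZ⟩⟩ := h1 i
    by_cases haZ : a ∈ Z
    · refine ⟨a, {a}, by simpa using haL, Cn_single, ⟨a, rfl, haA⟩, ?_, ?_⟩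
      · ext t; simp; rintro rfl; exact haZ
      · rintro S _ w rfl hw; exact ⟨w, haA, hw, .refl⟩
    · obtain ⟨E, hE, hEc, haE, c, hc', d, hd, hcd⟩ := hc.trim (A := {a}) haL rfl hbL hbZ
        (by simpa using haZ)
      have hins := hEc.insert hc' hcd.symm
      have hEZ : ∀ t ∈ E, t ∉ Z := fun t ht => (hE ht).2
      refine ⟨d, insert d E, insert_subset hd.1 (hE.trans sdiff_subset), hins,
        ⟨a, Or.inr haE, haA⟩, ?_, ?_⟩
      · ext t
        simp only [mem_inter_iff, mem_insert_iff, mem_singleton_iff]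
        constructor
        · rintro ⟨h | h, h'⟩
          · exact h
          · exact absurd h' (hEZ t h)
        · rintro rfl; exact ⟨Or.inl rfl, hd.2⟩
      · intro S hS w hw hwS
        have haS : a ∉ S := fun h => haZ (hS h)
        refine ⟨a, haA, haS, ?_⟩
        have hES : E ⊆ Sᶜ := fun t ht h => hEZ t ht (hS h)
        rcases hw with rfl | hw
        · exact (hins.2 a (Or.inr haE) w (Or.inl rfl)).mono (insert_subset hwS hES)
        · exact (hEc.2 a haE w hw).mono hES
  choose f M hM using key
  have hfZ : ∀ i, f i ∈ M i ∧ f i ∈ Z := fun i => by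
    have : f i ∈ M i ∩ Z := by rw [(hM i).2.2.2.1]; rfl
    exact this
  have hinj : Function.Injective f := by
    intro i j hij
    by_contra hne
    exact Set.disjoint_left.1 (h2 i j hne) ((hM i).1 (hfZ i).1) (hij ▸ (hM j).1 (hfZ j).1)
  have hr : range f = Z := eq_of_subset_of_ncard_le (by rintro _ ⟨i, rfl⟩; exact (hfZ i).2)
    (by rw [exists_fin_rng f hinj])
  have hg : ∀ z : V, ∃ N : Set V, z ∈ Z → ∃ i, f i = z ∧ N = M i := by
    intro z
    by_cases hz : z ∈ Z
    · obtain ⟨i, hi⟩ : z ∈ range f := by rw [hr]; exact hz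
      exact ⟨M i, fun _ => ⟨i, hi, rfl⟩⟩
    · exact ⟨∅, fun h => absurd h hz⟩
  choose N hN using hg
  refine ⟨N, ?_, ?_⟩
  · intro z hz
    obtain ⟨i, rfl, h⟩ := hN z hz
    rw [h]; exact (hM i).2
  · intro z hz z' hz' hne
    obtain ⟨i, rfl, h⟩ := hN z hz
    obtain ⟨j, rfl, h'⟩ := hN z' hz'
    rw [h, h']
    exact (h2 i j (fun h => hne (by rw [h]))).mono (hM _).1 (hM _).1

theorem menger_aux [Finite V] : ∀ (m : ℕ) (G : SimpleGraph V), G.edgeSet.ncard = m →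
    ∀ (A B : Set V) (n : ℕ), (∀ S, Sep G A B S → n ≤ S.ncard) → Lk G A B n := by
  intro m
  induction m with
  | zero =>
    intro G hm A B n h
    have hG : ∀ u v, ¬ G.Adj u v := by
      intro u v huv
      rw [Set.ncard_eq_zero (Set.toFinite _)] at hm
      have : s(u,v) ∈ G.edgeSet := huv
      simp [hm] at this
    have h1 := h (A ∩ B) (by
      intro a ha haS b hb hbS hr
      have : b ∈ ({a} : Set V) := hr.ind rfl (fun u _ _ v _ huv => absurd huv (hG u v))
      cases this
      exact haS ⟨ha, hb⟩)
    obtain ⟨f, hf, hfm⟩ := exists_fin h1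
    exact ⟨fun i => {f i}, fun i => ⟨Cn_single, ⟨f i, rfl, (hfm i).1⟩, ⟨f i, rfl, (hfm i).2⟩⟩,
      fun i j hij => by simpa using fun h => hij (hf h)⟩
  | succ m ih =>
    intro G hm A B n h
    have hne : G.edgeSet.Nonempty := by
      rw [← Set.ncard_pos (Set.toFinite _)]; omega
    obtain ⟨e, he⟩ := hne
    have hcard : (G.deleteEdges {e}).edgeSet.ncard = m := by
      rw [edgeSet_deleteEdges, Set.ncard_sdiff_singleton_of_mem he, hm]; rfl
    set G' := G.deleteEdges {e} with hG'
    by_cases hc : ∀ S, Sep G' A B S → n ≤ S.ncard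
    · obtain ⟨L, h1, h2⟩ := ih G' hcard A B n hc
      exact ⟨L, fun i => ⟨(h1 i).1.mono_g (fun a _ b _ h => by
        rw [hG', deleteEdges_adj] at h; exact h.1), (h1 i).2⟩, h2⟩
    push Not at hc
    obtain ⟨S, hS, hSn⟩ := hc
    have hnS : ¬ Sep G A B S := fun hh => by have := h S hh; omega
    unfold Sep at hnS
    push Not at hnS
    obtain ⟨a, ha, haS, b, hb, hbS, hr⟩ := hnS
    set R : Set V := {w | ∃ a ∈ A, a ∉ S ∧ Rch G' Sᶜ a w} with hR
    have hRB : b ∉ R := by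
      rintro ⟨a', ha', haS', hr'⟩; exact hS a' ha' haS' b hb hbS hr'
    have hcr : ∃ x y, x ∈ R ∧ x ∉ S ∧ y ∉ S ∧ y ∉ R ∧ G.Adj x y := by
      by_contra hcc
      push Not at hcc
      refine hRB (hr.ind ⟨a, ha, haS, .refl⟩ ?_)
      intro u hu huS v hv huv
      by_contra hvR
      exact hcc u v hu huS hv hvR huv
    obtain ⟨x, y, hxR, hxS, hyS, hyR, hxy⟩ := hcr
    have hexy : e = s(x,y) := by
      by_contra hne
      obtain ⟨a', ha', haS', hr'⟩ := hxR
      exact hyR ⟨a', ha', haS', hr'.trans (Rch.adj (by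
        rw [hG', deleteEdges_adj]; exact ⟨hxy, by simpa using fun h => hne h.symm⟩) hxS hyS)⟩
    have hGG : ∀ u v, G.Adj u v → G'.Adj u v ∨ (u = x ∧ v = y) ∨ (u = y ∧ v = x) := by
      intro u v huv
      by_cases he' : s(u,v) = e
      · right; rw [hexy] at he'; simpa using he'
      · left; rw [hG', deleteEdges_adj]; exact ⟨huv, by simpa using he'⟩
    have hG'le : ∀ u v, G'.Adj u v → G.Adj u v := fun u v h => by
      rw [hG', deleteEdges_adj] at h; exact h.1
    have hSx : (insert x S).ncard = S.ncard + 1 := ncard_insert_of_notMem hxS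
    have hSy : (insert y S).ncard = S.ncard + 1 := ncard_insert_of_notMem hyS
    have h1 : Lk G' A (insert x S) (insert x S).ncard := by
      refine ih G' hcard _ _ _ (fun X hX => ?_)
      have := h X (sep_lift hS hGG (fun a ha haS hr => hyR ⟨a, ha, haS, hr⟩) hX)
      omega
    have h2 : Lk G' B (insert y S) (insert y S).ncard := by
      refine ih G' hcard _ _ _ (fun X hX => ?_)
      have := h X (sep_lift (G' := G') hS.symm (x := y) (y := x) (fun u v huv => by
        have := hGG u v huv; tauto) (fun b hb hbS hr => by
          obtain ⟨a', ha', haS', hr'⟩ := hxR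
          exact hS a' ha' haS' b hb hbS (hr'.trans hr.symm)) hX).symm
      omega
    obtain ⟨L, hL, hLd⟩ := h1.toZ
    obtain ⟨M, hM, hMd⟩ := h2.toZ
    have hLM : ∀ z ∈ insert x S, ∀ z' ∈ insert y S, ∀ w, w ∈ L z → w ∈ M z' → w = z ∧ w = z' ∧ w ∈ S := by
      intro z hz z' hz' w hw hw'
      by_cases hwS : w ∈ S
      · have a1 : w ∈ L z ∩ insert x S := ⟨hw, Or.inr hwS⟩
        have a2 : w ∈ M z' ∩ insert y S := ⟨hw', Or.inr hwS⟩
        rw [(hL z hz).2.2.1] at a1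
        rw [(hM z' hz').2.2.1] at a2
        exact ⟨a1, a2, hwS⟩
      · obtain ⟨a', b1, b2, b3⟩ := (hL z hz).2.2.2 S (subset_insert _ _) w hw hwS
        obtain ⟨a2, c1, c2, c3⟩ := (hM z' hz').2.2.2 S (subset_insert _ _) w hw' hwS
        exact absurd (b3.trans c3.symm) (hS a' b1 b2 a2 c1 c2)
    have hxx : x ∈ insert x S := Or.inl rfl
    have hyy : y ∈ insert y S := Or.inl rfl
    obtain ⟨f, hf, hfm⟩ := exists_fin (n := n) (Z := insert x S) (by
      have := h (insert x S) ?_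
      · exact this
      · refine sep_lift hS hGG (fun a ha haS hr => hyR ⟨a, ha, haS, hr⟩) ?_
        intro a ha haS b hb hbS; exact absurd hb hbS)
    classical
    let φ : V → V := fun z => if z = x then y else z
    have hφ : ∀ z ∈ insert x S, φ z ∈ insert y S := by
      intro z hz
      by_cases h : z = x
      · simp [φ, h]
      · simp only [φ, h, if_false]; right; exact hz.resolve_left h
    have hφi : ∀ z ∈ insert x S, ∀ z' ∈ insert x S, φ z = φ z' → z = z' := by
      intro z hz z' hz' hh
      simp only [φ] at hh
      split_ifs at hh with h1 h2 h2
      · rw [h1, h2]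
      · exact absurd (hz'.resolve_left h2) (hh ▸ hyS)
      · exact absurd (hz.resolve_left h1) (hh ▸ hyS)
      · exact hh
    have hmem : ∀ z ∈ insert x S, z ∈ L z := fun z hz => by
      have : z ∈ L z ∩ insert x S := by rw [(hL z hz).2.2.1]; rfl
      exact this.1
    have hmem' : ∀ z ∈ insert y S, z ∈ M z := fun z hz => by
      have : z ∈ M z ∩ insert y S := by rw [(hM z hz).2.2.1]; rfl
      exact this.1
    refine ⟨fun i => L (f i) ∪ M (φ (f i)), fun i => ⟨?_, ?_, ?_⟩, fun i j hij => ?_⟩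
    · have hc : Cn G' (L (f i)) := (hL _ (hfm i)).1
      have hc' : Cn G' (M (φ (f i))) := (hM _ (hφ _ (hfm i))).1
      refine (hc.mono_g fun _ _ _ _ h => hG'le _ _ h).union (hc'.mono_g fun _ _ _ _ h => hG'le _ _ h)
        ⟨f i, hmem _ (hfm i), φ (f i), hmem' _ (hφ _ (hfm i)), ?_⟩
      by_cases h : f i = x
      · right; simpa [φ, h] using hxy
      · left; simp [φ, h]
    · exact (hL _ (hfm i)).2.1.mono (inter_subset_inter_left _ subset_union_left)
    · exact (hM _ (hφ _ (hfm i))).2.1.mono (inter_subset_inter_left _ subset_union_right)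
    · have hne : f i ≠ f j := fun h => hij (hf h)
      have hne' : φ (f i) ≠ φ (f j) := fun h => hne (hφi _ (hfm i) _ (hfm j) h)
      have key : ∀ i j, i ≠ j → Disjoint (L (f i)) (M (φ (f j))) := by
        intro i j hij
        rw [Set.disjoint_left]
        intro w hw hw'
        obtain ⟨e1, e2, e3⟩ := hLM _ (hfm i) _ (hφ _ (hfm j)) w hw hw'
        apply hij; apply hf
        rw [← e1]
        by_cases hjx : f j = x
        · simp only [φ, hjx, if_true] at e2
          exact absurd e3 (e2 ▸ hyS)
        · simpa [φ, hjx] using e2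
      rw [Set.disjoint_union_left, Set.disjoint_union_right, Set.disjoint_union_right]
      exact ⟨⟨hLd _ (hfm i) _ (hfm j) hne, key i j hij⟩,
        ⟨(key j i (Ne.symm hij)).symm, hMd _ (hφ _ (hfm i)) _ (hφ _ (hfm j)) hne'⟩⟩

theorem menger [Finite V] {n : ℕ} (h : ∀ S, Sep G A B S → n ≤ S.ncard) : Lk G A B n :=
  menger_aux _ G rfl A B n h
end Paper

namespace Paper
variable {V : Type} {G G' : SimpleGraph V} {A B C D P S X Z : Set V} {x y z : V}

lemma ball_card {K : ℕ} (Γ : SimpleGraph (Fin K)) (hc : Γ.Connected) (j : Fin K) (d : ℕ)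
    (hd : ∀ v, (Γ.neighborSet v).ncard < d) (k : ℕ) : {v | Γ.dist j v ≤ k}.ncard ≤ (d+1)^k := by
  classical
  induction k with
  | zero =>
    have : {v | Γ.dist j v ≤ 0} = {j} := by
      ext v; simp only [mem_ofPred_eq, mem_singleton_iff, Nat.le_zero]
      rw [hc.dist_eq_zero_iff]; exact eq_comm
    rw [this]; simp
  | succ k ih =>
    have hsub : {v | Γ.dist j v ≤ k + 1} ⊆ ⋃ u ∈ ({v | Γ.dist j v ≤ k}.toFinset : Finset (Fin K)), insert u (Γ.neighborSet u) := by
      intro v hv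
      obtain ⟨p, hp⟩ := hc.exists_walk_length_eq_dist j v
      simp only [mem_ofPred_eq] at hv
      simp only [mem_iUnion, Set.mem_toFinset, mem_ofPred_eq, exists_prop]
      rcases Nat.lt_or_ge (Γ.dist j v) (k+1) with h | h
      · exact ⟨v, by omega, Or.inl rfl⟩
      · have hl : p.length = k + 1 := by omega
        refine ⟨p.getVert k, ?_, Or.inr ?_⟩
        · have := dist_le (p.take k)
          rw [Walk.take_length] at this; omega
        · have := p.adj_getVert_succ (i := k) (by omega)
          rw [← hl, p.getVert_length] at this; exact this
    calc _ ≤ _ := ncard_le_ncard hsub (Set.toFinite _)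
      _ ≤ ∑ u ∈ ({v | Γ.dist j v ≤ k}.toFinset : Finset (Fin K)), (insert u (Γ.neighborSet u)).ncard :=
        Finset.set_ncard_biUnion_le _ _
      _ ≤ ∑ u ∈ ({v | Γ.dist j v ≤ k}.toFinset : Finset (Fin K)), (d+1) :=
        Finset.sum_le_sum fun u _ => (ncard_insert_le _ _).trans (by have := hd u; omega)
      _ ≤ (d+1)^(k+1) := by
        rw [Finset.sum_const, smul_eq_mul, ← Set.ncard_eq_toFinset_card', pow_succ]
        exact Nat.mul_le_mul_right _ ih

lemma rung (T : ℕ) (hT : 0 < T) : ∃ K : ℕ, ∀ {V : Type} (G : SimpleGraph V) (S : Fin K → Set V) (R : Set V),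
    (∀ j, Cn G (S j)) → Cn G R → (∀ j, (R ∩ S j).Nonempty) → (∀ i j, i ≠ j → Disjoint (S i) (S j)) →
    ∃ s : Fin T → Fin K, Function.Injective s ∧ ∀ k (hk : k + 1 < T), ∃ E ⊆ R ∪ ⋃ j, S j, Cn G E ∧
      (E ∩ S (s ⟨k, by omega⟩)).Nonempty ∧ (E ∩ S (s ⟨k+1, hk⟩)).Nonempty ∧
      ∀ l : Fin T, l.1 ≠ k → l.1 ≠ k + 1 → Disjoint E (S (s l)) := by
  classical
  obtain ⟨K, hK⟩ : ∃ K, K = (T+1)^T + 1 := ⟨_, rfl⟩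
  have hK0 : 0 < K := by omega
  refine ⟨K, ?_⟩
  intro V G S R hS hR hRS hd
  let Γ : SimpleGraph (Fin K) := SimpleGraph.fromRel (fun a b => ∃ D ⊆ R, Cn G D ∧ (D ∩ S a).Nonempty ∧
    (D ∩ S b).Nonempty ∧ ∀ l, l ≠ a → l ≠ b → Disjoint D (S l))
  have hΓ : ∀ a b, Γ.Adj a b → ∃ D ⊆ R, Cn G D ∧ (D ∩ S a).Nonempty ∧
      (D ∩ S b).Nonempty ∧ ∀ l, l ≠ a → l ≠ b → Disjoint D (S l) := by
    intro a b h
    rw [SimpleGraph.fromRel_adj] at h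
    obtain ⟨_, h | ⟨D, h1, h2, h3, h4, h5⟩⟩ := h
    · exact h
    · exact ⟨D, h1, h2, h4, h3, fun l a b => h5 l b a⟩
  have hcon : Γ.Connected := by
    have : Nonempty (Fin K) := ⟨⟨0, hK0⟩⟩
    refine ⟨?_⟩
    intro u v
    by_contra hnr
    let SJ : Set V := ⋃ a : {a // Γ.Reachable u a}, S a
    let SK : Set V := ⋃ a : {a // ¬ Γ.Reachable u a}, S a
    have hdis : ∀ w ∈ SJ, w ∉ SK := by
      intro w h1 h2
      simp only [SJ, SK, mem_iUnion] at h1 h2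
      obtain ⟨a, ha⟩ := h1
      obtain ⟨b, hb⟩ := h2
      refine Set.disjoint_left.1 (hd a b ?_) ha hb
      intro h; exact b.2 (h ▸ a.2)
    obtain ⟨x, hxR, hxS⟩ := hRS u
    obtain ⟨y, hyR, hyS⟩ := hRS v
    have hxJ : x ∈ SJ := mem_iUnion.2 ⟨⟨u, Reachable.refl u⟩, hxS⟩
    have hyK : y ∈ SK := mem_iUnion.2 ⟨⟨v, hnr⟩, hyS⟩
    obtain ⟨E, hE, hEc, hxE, a, ha, b, hb, hab⟩ := hR.trim (A := SJ) hxR hxJ hyR hyK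
      (Set.disjoint_left.2 hdis)
    obtain ⟨E', hE', hEc', hbE', c, hc, d, hd', hcd⟩ := (hEc.insert ha hab.symm).trim (x := b) (A := SK)
      (B := SJ) (Or.inl rfl) hb.2 (Or.inr hxE) hxJ (Set.disjoint_left.2 fun w h h' => hdis w h' h)
    have hdE : d ∈ E := by
      rcases hd'.1 with h | h
      · exact absurd hb.2 (h ▸ hdis d hd'.2)
      · exact h
    obtain ⟨⟨p, hp⟩, hdp⟩ := mem_iUnion.1 hd'.2
    obtain ⟨⟨q, hq⟩, hbq⟩ := mem_iUnion.1 hb.2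
    have hpq : p ≠ q := fun h => hq (h ▸ hp)
    refine hq (hp.trans (Adj.reachable ?_))
    rw [SimpleGraph.fromRel_adj]
    refine ⟨hpq, Or.inl ⟨insert d E', ?_, hEc'.insert hc hcd.symm, ⟨d, Or.inl rfl, hdp⟩,
      ⟨b, Or.inr hbE', hbq⟩, ?_⟩⟩
    · refine insert_subset (hE hdE).1 fun w hw => ?_
      rcases (hE' hw).1 with h | h
      · exact h ▸ hb.1
      · exact (hE h).1
    · intro l hlp hlq
      rw [Set.disjoint_left]
      rintro w (rfl | hw) hwl
      · exact Set.disjoint_left.1 (hd l p hlp) hwl hdp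
      · rcases (hE' hw).1 with h | h
        · exact Set.disjoint_left.1 (hd l q hlq) hwl (h ▸ hbq)
        · by_cases hl : Γ.Reachable u l
          · exact (hE' hw).2 (mem_iUnion.2 ⟨⟨l, hl⟩, hwl⟩)
          · exact (hE h).2 (mem_iUnion.2 ⟨⟨l, hl⟩, hwl⟩)
  by_cases hdeg : ∃ c, T ≤ (Γ.neighborSet c).ncard
  · obtain ⟨c, hc⟩ := hdeg
    obtain ⟨s, hs, hsm⟩ := exists_fin hc
    refine ⟨s, hs, fun k hk => ?_⟩
    have hne : ∀ i, s i ≠ c := fun i h => SimpleGraph.Adj.ne (G := Γ) (hsm i) h.symm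
    obtain ⟨D1, a1, a2, ⟨p, hp, hp'⟩, ⟨p2, hp2, hp2'⟩, a5⟩ := hΓ _ _ (hsm ⟨k, by omega⟩)
    obtain ⟨D2, b1, b2, ⟨q, hq, hq'⟩, ⟨q2, hq2, hq2'⟩, b5⟩ := hΓ _ _ (hsm ⟨k+1, hk⟩)
    refine ⟨(D1 ∪ S c) ∪ D2, ?_, (a2.union (hS c) ⟨p, hp, p, hp', Or.inl rfl⟩).union b2
      ⟨q, Or.inr hq', q, hq, Or.inl rfl⟩, ⟨p2, Or.inl (Or.inl hp2), hp2'⟩, ⟨q2, Or.inr hq2, hq2'⟩, ?_⟩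
    · exact union_subset (union_subset (a1.trans subset_union_left)
        ((subset_iUnion S c).trans subset_union_right)) (b1.trans subset_union_left)
    · intro l hl1 hl2
      have e1 : s l ≠ s ⟨k, by omega⟩ := fun h => hl1 (congrArg Fin.val (hs h))
      have e2 : s l ≠ s ⟨k+1, hk⟩ := fun h => hl2 (congrArg Fin.val (hs h))
      rw [Set.disjoint_union_left, Set.disjoint_union_left]
      exact ⟨⟨a5 _ (hne l) e1, hd _ _ (hne l).symm⟩, b5 _ (hne l) e2⟩
  · push Not at hdeg
    have hj : ∃ v, T < Γ.dist ⟨0, hK0⟩ v := by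
      by_contra hcon'
      push Not at hcon'
      have h1 := ball_card Γ hcon ⟨0, hK0⟩ T hdeg T
      have h2 : {v | Γ.dist ⟨0, hK0⟩ v ≤ T} = Set.univ := eq_univ_of_forall hcon'
      rw [h2, ncard_univ, Nat.card_fin] at h1
      omega
    obtain ⟨v, hv⟩ := hj
    obtain ⟨p, hp, hpl⟩ := hcon.exists_path_of_dist ⟨0, hK0⟩ v
    refine ⟨fun i => p.getVert i, ?_, ?_⟩
    · intro i j hij
      exact Fin.ext (hp.getVert_injOn (by simp only [mem_ofPred_eq]; omega) (by simp only [mem_ofPred_eq]; omega) hij)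
    · intro k hk
      obtain ⟨D1, a1, a2, a3, a4, a5⟩ := hΓ _ _ (p.adj_getVert_succ (i := k) (by omega))
      refine ⟨D1, a1.trans subset_union_left, a2, a3, a4, fun l h1 h2 => a5 _ ?_ ?_⟩
      · intro h; exact h1 (hp.getVert_injOn (by simp only [mem_ofPred_eq]; omega) (by simp only [mem_ofPred_eq]; omega) h)
      · intro h; exact h2 (hp.getVert_injOn (by simp only [mem_ofPred_eq]; omega) (by simp only [mem_ofPred_eq]; omega) h)
end Paper

namespace Paper
variable {V : Type} {G G' : SimpleGraph V} {A B C D P S X Z : Set V} {x y z : V}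

def AdjS (G : SimpleGraph V) (A B : Set V) : Prop := ∃ x ∈ A, ∃ y ∈ B, G.Adj x y
lemma AdjS.symm (h : AdjS G A B) : AdjS G B A := by
  obtain ⟨x, hx, y, hy, h⟩ := h; exact ⟨y, hy, x, hx, h.symm⟩
lemma AdjS.mono (h : AdjS G A B) (h1 : A ⊆ C) (h2 : B ⊆ D) : AdjS G C D := by
  obtain ⟨x, hx, y, hy, h⟩ := h; exact ⟨x, h1 hx, y, h2 hy, h⟩
lemma AdjS.tch (h : AdjS G A B) : Tch G A B := by
  obtain ⟨x, hx, y, hy, h⟩ := h; exact ⟨x, hx, y, hy, Or.inr h⟩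
def Mdl {β : Type} (G : SimpleGraph V) (H : SimpleGraph β) (N : β → Set V) : Prop :=
  (∀ h, Cn G (N h)) ∧ (∀ h h', h ≠ h' → Disjoint (N h) (N h')) ∧
    ∀ h h', H.Adj h h' → AdjS G (N h) (N h')
def WM (G : SimpleGraph V) (T : ℕ) : Prop := ∃ N, Mdl G (Wall T) N

lemma Cn_range {F : ℕ → Set V} {a : ℕ} : ∀ b, a < b → (∀ m, a ≤ m → m < b → Cn G (F m)) →
    (∀ m, a ≤ m → m + 1 < b → AdjS G (F m) (F (m+1))) → Cn G (⋃ m ∈ Set.Ico a b, F m) := by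
  intro b hb
  induction b, hb using Nat.le_induction with
  | base =>
    intro h1 _
    have : Set.Ico a (a+1) = {a} := by ext; simp; omega
    rw [this]; simpa using h1 a le_rfl (by omega)
  | succ b hb ih =>
    intro h1 h2
    have : (⋃ m ∈ Set.Ico a (b+1), F m) = (⋃ m ∈ Set.Ico a b, F m) ∪ F b := by
      ext w; simp only [mem_iUnion, mem_union, Set.mem_Ico]
      constructor
      · rintro ⟨m, hm, hw⟩
        rcases Nat.lt_or_ge m b with h | h
        · exact Or.inl ⟨m, ⟨hm.1, h⟩, hw⟩
        · obtain rfl : m = b := by omega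
          exact Or.inr hw
      · rintro (⟨m, hm, hw⟩ | hw)
        · exact ⟨m, ⟨hm.1, by omega⟩, hw⟩
        · exact ⟨b, ⟨by omega, by omega⟩, hw⟩
    rw [this]
    refine (ih (fun m h h' => h1 m h (by omega)) (fun m h h' => h2 m h (by omega))).union
      (h1 b (by omega) (by omega)) ?_
    obtain ⟨c, rfl⟩ : ∃ c, b = c + 1 := ⟨b - 1, by omega⟩
    exact ((h2 c (by omega) (by omega)).mono
      (subset_biUnion_of_mem (u := F) (x := c) (by simp; omega)) subset_rfl).tch

lemma slab (T : ℕ) (hT : 0 < T) : ∃ K N : ℕ, 0 < K ∧ 0 < N ∧ ∀ {V : Type} (G : SimpleGraph V) (Sg : Fin K → ℕ → Set V)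
    (R : ℕ → Set V), (∀ j i, i < N → Cn G (Sg j i)) → (∀ i, i < N → Cn G (R i)) →
    (∀ j i, i < N → (R i ∩ Sg j i).Nonempty) →
    (∀ j j' i i', i < N → i' < N → (j ≠ j' ∨ i ≠ i') → Disjoint (Sg j i) (Sg j' i')) →
    (∀ i i', i < N → i' < N → i ≠ i' → Disjoint (R i) (R i')) →
    (∀ j i i', i < N → i' < N → i ≠ i' → Disjoint (R i) (Sg j i')) →
    (∀ j i, i + 1 < N → AdjS G (Sg j i) (Sg j (i+1))) → WM G T := by
  classical
  obtain ⟨K, hK⟩ := rung T hT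
  refine ⟨K + 1, Fintype.card (Fin T → Fin (K+1)) * (2*T*T+1), by omega, by positivity, ?_⟩
  intro V G Sg R h1 h2 h3 h4 h5 h6 h7
  set N := Fintype.card (Fin T → Fin (K+1)) * (2*T*T+1) with hN
  have hr : ∀ i : Fin N, ∃ s : Fin T → Fin (K+1), Function.Injective s ∧ ∀ k (hk : k + 1 < T),
      ∃ E ⊆ R i ∪ ⋃ j, Sg j i, Cn G E ∧
      (E ∩ Sg (s ⟨k, by omega⟩) i).Nonempty ∧ (E ∩ Sg (s ⟨k+1, hk⟩) i).Nonempty ∧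
      ∀ l : Fin T, l.1 ≠ k → l.1 ≠ k + 1 → Disjoint E (Sg (s l) i) := by
    intro i
    obtain ⟨s, hs, h⟩ := hK G (fun j : Fin K => Sg j.castSucc i) (R i) (fun j => h1 _ _ i.2) (h2 _ i.2)
      (fun j => h3 _ _ i.2) (fun a b hab => h4 _ _ _ _ i.2 i.2 (Or.inl (by simpa using hab)))
    refine ⟨fun k => (s k).castSucc, fun a b hab => hs (by simpa using hab), fun k hk => ?_⟩
    obtain ⟨E, hE, h⟩ := h k hk
    exact ⟨E, hE.trans (union_subset_union_right _ (iUnion_subset fun j =>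
      subset_iUnion (fun j => Sg j i) j.castSucc)), h⟩
  choose s hs hE using hr
  obtain ⟨s0, hs0⟩ := Fintype.exists_le_card_fiber_of_mul_le_card (f := s) (n := 2*T*T+1)
    (by rw [Fintype.card_fin])
  set F := Finset.univ.filter (fun i => s i = s0) with hF
  have hσ : ∃ σ : ℕ → ℕ, (∀ a b, a < b → b ≤ 2*T*T → σ a < σ b) ∧ ∀ a, a ≤ 2*T*T → ∃ h : σ a < N, s ⟨σ a, h⟩ = s0 := by
    let g := F.orderEmbOfCardLe hs0
    refine ⟨fun a => if h : a < 2*T*T+1 then (g ⟨a, h⟩).1 else 0, ?_, ?_⟩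
    · intro a b hab hb
      simp only [show a < 2*T*T+1 by omega, show b < 2*T*T+1 by omega, dif_pos]
      exact Fin.lt_def.1 (g.strictMono (by simpa [Fin.lt_def] using hab))
    · intro a ha
      simp only [show a < 2*T*T+1 by omega, dif_pos]
      have := F.orderEmbOfCardLe_mem hs0 ⟨a, by omega⟩
      simp only [hF, Finset.mem_filter] at this
      exact ⟨(g ⟨a, by omega⟩).2, this.2⟩
  obtain ⟨σ, hσm, hσs⟩ := hσ
  have hσlt : ∀ a, a ≤ 2*T*T → σ a < N := fun a ha => (hσs a ha).1
  have hσle : ∀ a b, a ≤ b → b ≤ 2*T*T → σ a ≤ σ b := fun a b hab hb => by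
    rcases Nat.lt_or_ge a b with h | h
    · exact (hσm a b h hb).le
    · rw [le_antisymm hab h]
  have hσrev : ∀ a b, a ≤ 2*T*T → b ≤ 2*T*T → σ a < σ b → a < b := fun a b ha hb h => by
    by_contra hc; have := hσle b a (by omega) ha; omega
  have hs0i : Function.Injective s0 := by
    obtain ⟨h, h'⟩ := hσs 0 (by omega); rw [← h']; exact hs _
  have hidx : ∀ i j, i < T → j < 2*T → j*T + i < 2*T*T := fun i j hi hj => by
    calc j*T+i < j*T+T := by omega
      _ = (j+1)*T := by ring
      _ ≤ 2*T*T := Nat.mul_le_mul_right _ hj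
  have hidx2 : ∀ j, j ≤ 2*T → j*T ≤ 2*T*T := fun j hj => Nat.mul_le_mul_right _ hj
  have hW : ∀ m m', m < N → m' < N → m ≠ m' → Disjoint (R m ∪ ⋃ j, Sg j m) (R m' ∪ ⋃ j, Sg j m') := by
    intro m m' hm hm' hne
    rw [Set.disjoint_union_left, Set.disjoint_union_right, Set.disjoint_union_right]
    refine ⟨⟨h5 _ _ hm hm' hne, ?_⟩, ?_, ?_⟩
    · exact Set.disjoint_iUnion_right.2 fun j => h6 j _ _ hm hm' hne
    · exact Set.disjoint_iUnion_left.2 fun j => (h6 j _ _ hm' hm hne.symm).symm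
    · exact Set.disjoint_iUnion_left.2 fun j => Set.disjoint_iUnion_right.2 fun j' =>
        h4 _ _ _ _ hm hm' (Or.inr hne)
  have hD : ∀ (i : Fin T) (m : ℕ), m ≤ 2*T*T → ∃ D ⊆ R (σ m) ∪ ⋃ j, Sg j (σ m), Cn G D ∧
      (D ∩ Sg (s0 i) (σ m)).Nonempty ∧ (∀ l, l ≠ i → Disjoint D (Sg (s0 l) (σ m))) ∧
      (∀ hi : i.1 + 1 < T, AdjS G D (Sg (s0 ⟨i.1+1, hi⟩) (σ m))) := by
    intro i m hm
    obtain ⟨hmN, hms⟩ := hσs m hm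
    by_cases hi : i.1 + 1 < T
    · obtain ⟨E, e1, e2, ⟨x, hx, hx'⟩, ⟨y, hy, hy'⟩, e5⟩ := hE ⟨σ m, hmN⟩ i.1 hi
      rw [hms] at hx' hy' e5
      obtain ⟨D, d1, d2, d3, a, ha, b, hb, hab⟩ := e2.trim hx hx' hy hy' (h4 _ _ _ _ hmN hmN
        (Or.inl fun h => by have := congrArg Fin.val (hs0i h); simp at this))
      refine ⟨D, d1.trans (sdiff_subset.trans e1), d2, ⟨x, d3, hx'⟩, fun l hl => ?_,
        fun _ => ⟨a, ha, b, hb.2, hab⟩⟩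
      by_cases hl2 : l.1 = i.1 + 1
      · obtain rfl : l = ⟨i.1+1, hi⟩ := Fin.ext hl2
        exact Set.disjoint_left.2 fun w hw => (d1 hw).2
      · exact (e5 l (fun h => hl (Fin.ext h)) hl2).mono_left (d1.trans sdiff_subset)
    · obtain ⟨x, hx⟩ := (h1 (s0 i) _ hmN).1
      refine ⟨{x}, ?_, Cn_single, ⟨x, rfl, hx⟩, fun l hl => ?_, fun h => absurd h hi⟩
      · rintro _ rfl; exact Or.inr (mem_iUnion.2 ⟨_, hx⟩)
      · rw [Set.disjoint_singleton_left]
        intro hx'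
        exact Set.disjoint_left.1 (h4 _ _ _ _ hmN hmN (Or.inl fun h => hl (hs0i h))) hx' hx
  choose! Dd d1 d2 d3 d4 d5 using hD
  let Rg : Fin T → ℕ → Set V := fun i j => ⋃ m ∈ Set.Ico (σ (j*T)) (σ ((j+1)*T)), Sg (s0 i) m
  have hSub : ∀ i j m, σ (j*T) ≤ m → m < σ ((j+1)*T) → Sg (s0 i) m ⊆ Rg i j := fun i j m h h' =>
    subset_biUnion_of_mem (u := fun m => Sg (s0 i) m) (show m ∈ Set.Ico _ _ from ⟨h, h'⟩)
  have hin : ∀ i j, i < T → j < 2*T → σ (j*T) ≤ σ (j*T+i) ∧ σ (j*T+i) < σ ((j+1)*T) := by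
    intro i j hi hj
    have := hidx i j hi hj
    have e : (j+1)*T = j*T + T := by ring
    refine ⟨hσle _ _ (by omega) (by omega), hσm _ _ (by omega) (hidx2 _ (by omega))⟩
  have hin2 : ∀ i j j', i < T → j < 2*T → j' < 2*T → σ (j'*T) ≤ σ (j*T+i) → σ (j*T+i) < σ ((j'+1)*T) → j = j' := by
    intro i j j' hi hj hj' ha hb
    have h1 := hσrev _ _ (hidx i j hi hj).le (hidx2 (j'+1) (by omega)) hb
    have h2 : j'*T ≤ j*T+i := by
      by_contra hc
      have := hσm _ _ (not_le.1 hc) (hidx2 j' hj'.le); omega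
    have e1 : j < j' + 1 := by
      by_contra hc
      have := Nat.mul_le_mul_right T (not_lt.1 hc); omega
    have e2 : j' < j + 1 := by
      by_contra hc
      have := Nat.mul_le_mul_right T (not_lt.1 hc)
      have : (j+1)*T = j*T+T := by ring
      omega
    omega
  refine ⟨fun h => Rg h.1 h.2 ∪ Dd h.1 (h.2*T+h.1), ?_, ?_, ?_⟩
  · rintro ⟨i, j⟩
    have hj := hidx i j i.2 j.2
    have hi2 := hin i j i.2 j.2
    refine Cn.union (Cn_range (a := σ (j.1*T)) (σ ((j.1+1)*T)) (lt_of_le_of_lt hi2.1 hi2.2) (fun m _ hm => h1 _ _ ?_) (fun m _ hm => h7 _ _ ?_)) (d2 i _ hj.le) ?_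
    · exact hm.trans (hσlt _ (hidx2 _ j.2))
    · exact hm.trans (hσlt _ (hidx2 _ j.2))
    · obtain ⟨x, hx, hx'⟩ := d3 i (j*T+i) hj.le
      exact ⟨x, hSub i j _ hi2.1 hi2.2 hx', x, hx, Or.inl rfl⟩
  · rintro ⟨i, j⟩ ⟨i', j'⟩ hne
    have hRR : Disjoint (Rg i j) (Rg i' j') := by
      simp only [Rg, Set.disjoint_iUnion_left, Set.disjoint_iUnion_right]
      intro m' hm' m hm
      refine h4 _ _ _ _ (hm.2.trans (hσlt _ (hidx2 _ j.2))) (hm'.2.trans (hσlt _ (hidx2 _ j'.2))) ?_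
      by_cases hii : i = i'
      · right
        rintro rfl
        have hjj : j.1 ≠ j'.1 := fun h => hne (by rw [hii, Fin.ext h])
        rcases Nat.lt_or_gt_of_ne hjj with h | h
        · have := hσle ((j.1+1)*T) (j'.1*T) (Nat.mul_le_mul_right _ h) (hidx2 _ j'.2.le)
          have := hm.2; have := hm'.1; omega
        · have := hσle ((j'.1+1)*T) (j.1*T) (Nat.mul_le_mul_right _ h) (hidx2 _ j.2.le)
          have := hm'.2; have := hm.1; omega
      · left; exact fun h => hii (hs0i h)
    have hDR : ∀ (i i' : Fin T) (j j' : Fin (2*T)), ((i, j) : Fin T × Fin (2*T)) ≠ (i', j') →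
        Disjoint (Dd i (j*T+i)) (Rg i' j') := by
      intro i i' j j' hne
      have hj := hidx i j i.2 j.2
      simp only [Rg, Set.disjoint_iUnion_right]
      intro m hm
      by_cases hmm : σ (j*T+i) = m
      · have := hin2 i j j' i.2 j.2 j'.2 (hmm ▸ hm.1) (hmm ▸ hm.2)
        rw [← hmm]
        exact d4 i _ hj.le _ (fun h => hne (by rw [h, Fin.ext this]))
      · exact (hW _ _ (hσlt _ hj.le) (hm.2.trans (hσlt _ (hidx2 _ j'.2))) hmm).mono (d1 i _ hj.le)
          ((subset_iUnion (fun j => Sg j m) (s0 i')).trans subset_union_right)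
    have hDD : Disjoint (Dd i (j*T+i)) (Dd i' (j'*T+i')) := by
      have hj := hidx i j i.2 j.2
      have hj' := hidx i' j' i'.2 j'.2
      refine (hW _ _ (hσlt _ hj.le) (hσlt _ hj'.le) ?_).mono (d1 i _ hj.le) (d1 i' _ hj'.le)
      intro h
      have a1 := hin i j i.2 j.2
      have := hin2 i' j' j i'.2 j'.2 j.2 (h ▸ a1.1) (h ▸ a1.2)
      have e : j = j' := Fin.ext this.symm
      subst e
      rcases Nat.lt_trichotomy (j*T+i) (j*T+i') with h' | h' | h'
      · have := hσm _ _ h' hj'.le; omega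
      · exact hne (by rw [Fin.ext (show i.1 = i'.1 by omega)])
      · have := hσm _ _ h' hj.le; omega
    rw [Set.disjoint_union_left, Set.disjoint_union_right, Set.disjoint_union_right]
    exact ⟨⟨hRR, (hDR i' i j' j hne.symm).symm⟩, hDR i i' j j' hne, hDD⟩
  · have key : ∀ h h' : Fin T × Fin (2*T), ((h.1 = h'.1 ∧ h.2.val + 1 = h'.2.val) ∨
        (h.2 = h'.2 ∧ h.1.val + 1 = h'.1.val ∧ (h.1.val + h.2.val) % 2 = 0)) →
        AdjS G (Rg h.1 h.2 ∪ Dd h.1 (h.2*T+h.1)) (Rg h'.1 h'.2 ∪ Dd h'.1 (h'.2*T+h'.1)) := by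
      rintro ⟨i, j⟩ ⟨i', j'⟩ h
      simp only at h
      rcases h with ⟨rfl, h⟩ | ⟨rfl, h, -⟩
      · have a1 := hin i j i.2 j.2
        have a2 := hin i j' i.2 j'.2
        have a3 := hσlt ((j.1+1)*T) (hidx2 _ j.2)
        rw [← h] at a2
        have := h7 (s0 i) (σ ((j.1+1)*T) - 1) (by omega)
        refine this.mono ((hSub i j _ (by omega) (by omega)).trans subset_union_left)
          ((?_ : _ ⊆ Rg i j').trans subset_union_left)
        rw [← h]
        exact hSub i (j.1+1) _ (by omega) (by omega)
      · have hj := hidx i j i.2 j.2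
        have a1 := hin i j i.2 j.2
        have := d5 i (j*T+i) hj.le (by have := i'.2; omega)
        refine this.mono subset_union_right (Subset.trans ?_ subset_union_left)
        have e : (⟨i.1+1, by have := i'.2; omega⟩ : Fin T) = i' := Fin.ext h
        rw [e]
        exact hSub i' j _ a1.1 a1.2
    intro h h' hh
    rw [Wall, SimpleGraph.fromRel_adj] at hh
    rcases hh.2 with hh | hh
    · exact key h h' hh
    · exact (key h' h hh).symm
end Paper

namespace Paper
variable {V : Type} {G G' : SimpleGraph V} {A B C D P S X Z : Set V} {x y z : V}

lemma Rch.walk (h : Rch G D x y) : ∃ w : G.Walk x y, ∀ z ∈ w.support, z = x ∨ z ∈ D := by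
  induction h using Relation.ReflTransGen.head_induction_on with
  | refl => exact ⟨.nil, by simp⟩
  | head h _ ih =>
    obtain ⟨w, hw⟩ := ih
    refine ⟨.cons h.1 w, fun z hz => ?_⟩
    rw [Walk.support_cons, List.mem_cons] at hz
    rcases hz with hz | hz
    · exact Or.inl hz
    · rcases hw z hz with rfl | hz
      · exact Or.inr h.2.2
      · exact Or.inr hz
lemma Rch.path (h : Rch G D x y) (hx : x ∈ D) : ∃ (f : ℕ → V) (n : ℕ), f 0 = x ∧ f n = y ∧
    (∀ i < n, G.Adj (f i) (f (i+1))) ∧ (∀ i ≤ n, f i ∈ D) ∧ ∀ i j, i ≤ n → j ≤ n → f i = f j → i = j := by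
  classical
  obtain ⟨w, hw⟩ := h.walk
  refine ⟨w.bypass.getVert, w.bypass.length, by simp, by simp, fun i hi => Walk.adj_getVert_succ _ hi, ?_, ?_⟩
  · intro i _
    rcases hw _ (w.support_bypass_subset_support (w.bypass.getVert_mem_support i)) with h | h
    · rw [h]; exact hx
    · exact h
  · intro i j hi hj hij
    exact (w.bypass_isPath).getVert_injOn hi hj hij
lemma Rch_seg {f : ℕ → V} {a b : ℕ} (hab : a ≤ b) (h1 : ∀ i, a ≤ i → i < b → G.Adj (f i) (f (i+1)))
    (h2 : ∀ i, a ≤ i → i ≤ b → f i ∈ D) : Rch G D (f a) (f b) := by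
  induction b, hab using Nat.le_induction with
  | base => exact .refl
  | succ b hb ih =>
    exact (ih (fun i h h' => h1 i h (by omega)) (fun i h h' => h2 i h (by omega))).trans
      (Rch.adj (h1 b hb (by omega)) (h2 b hb (by omega)) (h2 _ (by omega) le_rfl))
lemma Cn_seg {f : ℕ → V} {a b : ℕ} (hab : a ≤ b) (h1 : ∀ i, a ≤ i → i < b → G.Adj (f i) (f (i+1))) :
    Cn G (f '' Set.Icc a b) := by
  refine Cn_of (x := f a) ⟨a, ⟨le_rfl, hab⟩, rfl⟩ ?_
  rintro _ ⟨c, hc, rfl⟩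
  exact Rch_seg hc.1 (fun i h h' => h1 i h (by have := hc.2; omega))
    (fun i h h' => ⟨i, ⟨h, by have := hc.2; omega⟩, rfl⟩)

lemma cutlem [Finite V] {q : ℕ} {H : SimpleGraph V} {Q : Fin q → ℕ → V} {n : Fin q → ℕ}
    (hA : ∀ j, Q j 0 ∈ A) (hB : ∀ j, Q j (n j) ∈ B)
    (hQ : ∀ j i, i < n j → H.Adj (Q j i) (Q j (i+1)))
    (hinj : ∀ j i j' i', i ≤ n j → i' ≤ n j' → Q j i = Q j' i' → j = j' ∧ i = i')
    (j1 : Fin q) (c : ℕ) (hc : c < n j1)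
    (hm : ¬ Lk (H.deleteEdges {s(Q j1 c, Q j1 (c+1))}) A B q) :
    ∃ S : Set V, S.ncard < q ∧ ∃ cut : Fin q → ℕ, cut j1 = c ∧ ∀ R,
      Cn (H.deleteEdges {s(Q j1 c, Q j1 (c+1))}) R → Disjoint R S →
      ∀ j a j' a', a ≤ n j → a ≤ cut j → Q j a ∈ R → cut j' < a' → a' ≤ n j' → Q j' a' ∈ R → False := by
  classical
  obtain ⟨H', hH'⟩ : ∃ H', H' = H.deleteEdges {s(Q j1 c, Q j1 (c+1))} := ⟨_, rfl⟩
  rw [← hH'] at hm ⊢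
  have hS : ∃ S, Sep H' A B S ∧ S.ncard < q := by
    by_contra hcon; push Not at hcon; exact hm (menger hcon)
  obtain ⟨S, hS, hSq⟩ := hS
  have hQ' : ∀ j i, i < n j → (j ≠ j1 ∨ i ≠ c) → H'.Adj (Q j i) (Q j (i+1)) := by
    intro j i hi hne
    rw [hH', deleteEdges_adj]
    refine ⟨hQ j i hi, fun he => ?_⟩
    rw [Set.mem_singleton_iff, Sym2.eq_iff] at he
    rcases he with ⟨h1, _⟩ | ⟨h1, h2⟩
    · have := hinj _ _ _ _ hi.le hc.le h1
      rcases hne with h | h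
      · exact h this.1
      · exact h this.2
    · have e1 := hinj _ _ _ _ hi.le hc h1
      have e2 := hinj _ _ _ _ hi hc.le h2
      omega
  have hx : ∀ j, j ≠ j1 → ∃ x, x ≤ n j ∧ Q j x ∈ S := by
    intro j hj
    by_contra hcon
    push Not at hcon
    exact hS _ (hA j) (hcon 0 (by omega)) _ (hB j) (hcon _ le_rfl)
      (Rch_seg (Nat.zero_le _) (fun i _ hi => hQ' j i hi (Or.inl hj)) (fun i _ hi => hcon i hi))
  choose! xx hx1 hx2 using hx
  have hSeq : (fun j => Q j (xx j)) '' {j | j ≠ j1} = S := by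
    apply Set.eq_of_subset_of_ncard_le
    · rintro _ ⟨j, hj, rfl⟩; exact hx2 j hj
    · rw [InjOn.ncard_image]
      · have : {j : Fin q | j ≠ j1} = ((Finset.univ.erase j1 : Finset (Fin q)) : Set (Fin q)) := by ext; simp
        rw [this, ncard_coe_finset, Finset.card_erase_of_mem (Finset.mem_univ _), Finset.card_univ, Fintype.card_fin]
        omega
      · intro j hj j' hj' he
        exact (hinj _ _ _ _ (hx1 j hj) (hx1 j' hj') he).1
    · exact toFinite _
  have hSx : ∀ j a, a ≤ n j → Q j a ∈ S → j ≠ j1 ∧ a = xx j := by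
    intro j a ha hs
    rw [← hSeq] at hs
    obtain ⟨j', hj', he⟩ := hs
    obtain ⟨rfl, e⟩ := hinj _ _ _ _ (hx1 j' hj') ha he
    exact ⟨hj', e.symm⟩
  refine ⟨S, hSq, fun j => if j = j1 then c else xx j, by simp, ?_⟩
  intro R hR hRS j a j' a' ha hac haR hac' ha' haR'
  have haS : Q j a ∉ S := fun h => Set.disjoint_left.1 hRS haR h
  have haS' : Q j' a' ∉ S := fun h => Set.disjoint_left.1 hRS haR' h
  have e1 : ∀ i, 0 ≤ i → i ≤ a → Q j i ∈ Sᶜ := by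
    intro i _ hi hiS
    obtain ⟨e1, e2⟩ := hSx j i (by omega) hiS
    simp only [e1, if_false] at hac
    obtain rfl : i = a := by omega
    exact haS hiS
  have e2 : ∀ i, a' ≤ i → i ≤ n j' → Q j' i ∈ Sᶜ := by
    intro i hi hin hiS
    obtain ⟨e1, e2⟩ := hSx j' i hin hiS
    simp only [e1, if_false] at hac'
    omega
  have r1 : Rch H' Sᶜ (Q j 0) (Q j a) := by
    refine Rch_seg (Nat.zero_le _) (fun i _ hi => hQ' j i (by omega) ?_) e1
    by_cases h : j = j1
    · right; simp only [if_pos h] at hac; omega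
    · left; exact h
  have r2 : Rch H' Sᶜ (Q j' a') (Q j' (n j')) := by
    refine Rch_seg ha' (fun i hi hi' => hQ' j' i hi' ?_) e2
    by_cases h : j' = j1
    · right; simp only [if_pos h] at hac'; omega
    · left; exact h
  exact hS _ (hA j) (e1 0 le_rfl (by omega)) _ (hB j') (e2 _ ha' le_rfl)
    ((r1.trans ((hR.2 _ haR _ haR').mono (fun w hw => fun h => Set.disjoint_left.1 hRS hw h))).trans r2)

def IsLk (G : SimpleGraph V) (A B : Set V) {n : ℕ} (L : Fin n → Set V) : Prop :=
  (∀ i, Cn G (L i) ∧ (L i ∩ A).Nonempty ∧ (L i ∩ B).Nonempty) ∧ ∀ i j, i ≠ j → Disjoint (L i) (L j)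

lemma cross (T : ℕ) (hT : 0 < T) : ∃ K, 0 < K ∧ ∀ q, ∃ s, ∀ {V : Type} [Finite V] (G : SimpleGraph V)
    (A B : Set V) {p : ℕ} (P : Fin p → Set V), (∀ i, Cn G (P i)) → (∀ i j, i ≠ j → Disjoint (P i) (P j)) →
    Lk G A B q → WM G T ∨ ∃ L : Fin q → Set V, IsLk G A B L ∧
      {i | K ≤ {j | (P i ∩ L j).Nonempty}.ncard}.ncard < s := by
  classical
  obtain ⟨K, N, hK, hN, hsl⟩ := slab T hT
  refine ⟨K, hK, fun q => ⟨Fintype.card (Fin K → Fin q) * ((N+2)*(2*q)) + 1, ?_⟩⟩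
  intro V _ G A B p P hPc hPd hLk
  obtain ⟨W, hW⟩ : ∃ W, W = 2 * q := ⟨_, rfl⟩
  obtain ⟨M, hM⟩ : ∃ M, M = (N+2)*W := ⟨_, rfl⟩
  rw [← hW, ← hM]
  let EP : SimpleGraph V := { Adj := fun x y => G.Adj x y ∧ ∃ i, x ∈ P i ∧ y ∈ P i
                              symm := ⟨fun x y ⟨h, i, h1, h2⟩ => ⟨h.symm, i, h2, h1⟩⟩
                              loopless := ⟨fun x h => G.loopless.irrefl x h.1⟩ }
  have hex : ∃ m, ∃ H : SimpleGraph V, EP ≤ H ∧ H ≤ G ∧ Lk H A B q ∧ H.edgeSet.ncard = m :=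
    ⟨_, G, fun x y h => h.1, le_rfl, hLk, rfl⟩
  obtain ⟨H, hH1, hH2, hH3, hH4⟩ := Nat.find_spec hex
  have hmin : ∀ H' : SimpleGraph V, EP ≤ H' → H' ≤ G → Lk H' A B q → H.edgeSet.ncard ≤ H'.edgeSet.ncard := by
    intro H' h1 h2 h3
    rw [hH4]
    exact Nat.find_min' hex ⟨H', h1, h2, h3, rfl⟩
  obtain ⟨L, hL1, hL2⟩ := hH3
  have hpath : ∀ j, ∃ (f : ℕ → V) (n : ℕ), f 0 ∈ A ∧ f n ∈ B ∧ (∀ i < n, H.Adj (f i) (f (i+1))) ∧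
      (∀ i ≤ n, f i ∈ L j) ∧ ∀ i j, i ≤ n → j ≤ n → f i = f j → i = j := by
    intro j
    obtain ⟨h1, ⟨x, hx, hxA⟩, ⟨y, hy, hyB⟩⟩ := hL1 j
    obtain ⟨f, n, rfl, rfl, h4, h5, h6⟩ := (h1.2 x hx y hy).path hx
    exact ⟨f, n, hxA, hyB, h4, h5, h6⟩
  choose Q n hA hB hQ hQL hQi using hpath
  have hinj : ∀ j i j' i', i ≤ n j → i' ≤ n j' → Q j i = Q j' i' → j = j' ∧ i = i' := by
    intro j i j' i' hi hi' he
    have : j = j' := by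
      by_contra hne
      exact Set.disjoint_left.1 (hL2 _ _ hne) (hQL j i hi) (he ▸ hQL j' i' hi')
    subst this
    exact ⟨rfl, hQi j i i' hi hi' he⟩
  by_cases hsm : {i | K ≤ {j | (P i ∩ Q j '' Set.Icc 0 (n j)).Nonempty}.ncard}.ncard <
      Fintype.card (Fin K → Fin q) * M + 1
  · right
    refine ⟨fun j => Q j '' Set.Icc 0 (n j), ⟨fun j => ⟨?_, ⟨_, ⟨0, by simp, rfl⟩, hA j⟩,
      ⟨_, ⟨n j, by simp, rfl⟩, hB j⟩⟩, ?_⟩, hsm⟩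
    · exact Cn_seg (Nat.zero_le _) (fun i _ hi => hH2 (hQ j i hi))
    · intro j j' hne
      refine (hL2 j j' hne).mono ?_ ?_
      · rintro _ ⟨i, hi, rfl⟩; exact hQL _ _ hi.2
      · rintro _ ⟨i, hi, rfl⟩; exact hQL _ _ hi.2
  left
  obtain ⟨I0, hI0⟩ : ∃ I0, I0 = {i | K ≤ {j | (P i ∩ Q j '' Set.Icc 0 (n j)).Nonempty}.ncard} := ⟨_, rfl⟩
  rw [← hI0, not_lt] at hsm
  have hφ : ∀ i : I0, ∃ φ : Fin K → Fin q, Function.Injective φ ∧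
      ∀ k, ∃ a ≤ n (φ k), Q (φ k) a ∈ P i := by
    rintro ⟨i, hi⟩
    rw [hI0] at hi
    obtain ⟨φ, h1, h2⟩ := exists_fin hi
    refine ⟨φ, h1, fun k => ?_⟩
    obtain ⟨_, hx, a, ha, rfl⟩ := h2 k
    exact ⟨a, ha.2, hx⟩
  choose φ hφi hφ using hφ
  have : Fintype I0 := Fintype.ofFinite _
  have hI0c : Fintype.card I0 = I0.ncard := by rw [← Nat.card_eq_fintype_card]; rfl
  obtain ⟨i00⟩ : Nonempty I0 := Fintype.card_pos_iff.1 (by omega)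
  have : Nonempty (Fin K → Fin q) := ⟨φ i00⟩
  have hq : 0 < q := lt_of_le_of_lt (Nat.zero_le _) (φ i00 ⟨0, hK⟩).2
  obtain ⟨φ0, hφ0⟩ := Fintype.exists_le_card_fiber_of_mul_le_card (f := φ) (n := M) (by omega)
  obtain ⟨F, hF⟩ : ∃ F, F = Finset.univ.filter (fun i => φ i = φ0) := ⟨_, rfl⟩
  rw [← hF] at hφ0
  have hMpos : 0 < M := by rw [hM, hW]; positivity
  have hFφ : ∀ i ∈ F, φ i = φ0 := fun i hi => by rw [hF] at hi; exact (Finset.mem_filter.1 hi).2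
  have hφ0i : Function.Injective φ0 := by
    obtain ⟨i, hi⟩ := Finset.card_pos.1 (lt_of_lt_of_le hMpos hφ0)
    rw [← hFφ i hi]; exact hφi i
  obtain ⟨j1, hj1⟩ : ∃ j1, j1 = φ0 ⟨0, hK⟩ := ⟨_, rfl⟩
  have hfp : ∀ i ∈ F, ∃ a, a ≤ n j1 ∧ Q j1 a ∈ P i ∧ ∀ b < a, Q j1 b ∉ P i := by
    intro i hi
    have hex : ∃ a, a ≤ n j1 ∧ Q j1 a ∈ P i := by
      have := hφ i ⟨0, hK⟩
      rw [hFφ i hi, ← hj1] at this; exact this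
    refine ⟨Nat.find hex, (Nat.find_spec hex).1, (Nat.find_spec hex).2, fun b hb hbP => ?_⟩
    exact Nat.find_min hex hb ⟨by have := (Nat.find_spec hex).1; omega, hbP⟩
  choose! fp fp1 fp2 fp3 using hfp
  have hPP : ∀ i ∈ F, ∀ i' ∈ F, fp i = fp i' → i = i' := by
    intro i hi i' hi' he
    by_contra hne
    exact Set.disjoint_left.1 (hPd i i' (fun h => hne (Subtype.ext h))) (fp2 i hi) (he ▸ fp2 i' hi')
  have hcard : M ≤ (F.image fp).card := by
    rw [Finset.card_image_of_injOn (fun i hi i' hi' he => hPP i hi i' hi' he)]; exact hφ0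
  obtain ⟨g, hg⟩ : ∃ g : Fin M ↪o ℕ, ∀ r, g r ∈ F.image fp :=
    ⟨(F.image fp).orderEmbOfCardLe hcard, (F.image fp).orderEmbOfCardLe_mem hcard⟩
  have hσ : ∀ r, ∃ i ∈ F, fp i = g r := fun r => by simpa using Finset.mem_image.1 (hg r)
  choose σ hσF hσg using hσ
  obtain ⟨R, hR⟩ : ∃ R : Fin M → Set V, R = fun r => P (σ r) := ⟨_, rfl⟩
  have hR0 : ∀ r, g r ≤ n j1 ∧ Q j1 (g r) ∈ R r ∧ ∀ b < g r, Q j1 b ∉ R r := by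
    intro r
    rw [← hσg, hR]
    exact ⟨fp1 _ (hσF r), fp2 _ (hσF r), fp3 _ (hσF r)⟩
  have hR2 : ∀ r k, ∃ a ≤ n (φ0 k), Q (φ0 k) a ∈ R r := by
    intro r k
    have := hφ (σ r) k
    rw [hFφ _ (hσF r)] at this
    rw [hR]; exact this
  have hRd : ∀ r r', r ≠ r' → Disjoint (R r) (R r') := by
    intro r r' hne
    rw [hR]
    refine hPd _ _ (fun h => hne (g.injective ?_))
    rw [← hσg, ← hσg, Subtype.ext h]
  have hRE : ∀ r, Cn EP (R r) := by
    intro r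
    rw [hR]
    exact (hPc _).mono_g (fun a ha b hb hab => ⟨hab, _, ha, hb⟩)
  have hRG : ∀ r, Cn G (R r) := fun r => by rw [hR]; exact hPc _
  have hcut : ∀ r : Fin M, 0 < r.1 → ∃ S : Set V, S.ncard < q ∧ ∃ cut : Fin q → ℕ, ∀ r', Disjoint (R r') S →
      (r' < r → ∀ j a, a ≤ n j → Q j a ∈ R r' → a ≤ cut j) ∧
      (r ≤ r' → ∀ j a, a ≤ n j → Q j a ∈ R r' → cut j < a) := by
    intro r hr
    have hg0 : g ⟨0, hMpos⟩ < g r := g.strictMono (by rw [Fin.lt_def]; exact hr)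
    have hr0 := hR0 r
    obtain ⟨c, hc⟩ : ∃ c, g r = c + 1 := ⟨g r - 1, by omega⟩
    rw [hc] at hr0
    have hne : ¬ EP.Adj (Q j1 c) (Q j1 (c+1)) := by
      rintro ⟨-, i, h1, h2⟩
      have : i = σ r := by
        by_contra hne
        exact Set.disjoint_left.1 (hPd _ _ hne) h2 (by have := hr0.2.1; rw [hR] at this; exact this)
      apply hr0.2.2 c (by omega)
      rw [this] at h1; rw [hR]; exact h1
    have hle : EP ≤ H.deleteEdges {s(Q j1 c, Q j1 (c+1))} := by
      intro x y hxy
      rw [deleteEdges_adj]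
      refine ⟨hH1 hxy, fun he => ?_⟩
      rw [Set.mem_singleton_iff, Sym2.eq_iff] at he
      rcases he with ⟨rfl, rfl⟩ | ⟨rfl, rfl⟩
      · exact hne hxy
      · exact hne hxy.symm
    obtain ⟨S, hS, cut, hcut1, hcut2⟩ := cutlem hA hB hQ hinj j1 c (by omega) (by
      intro hlk
      have := hmin _ hle ((deleteEdges_le _).trans hH2) hlk
      rw [edgeSet_deleteEdges] at this
      have h2 := ncard_sdiff_singleton_lt_of_mem (s := H.edgeSet) (a := s(Q j1 c, Q j1 (c+1)))
        (hQ j1 c (by omega)) (toFinite _)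
      omega)
    refine ⟨S, hS, cut, fun r' hr' => ⟨fun hlt j a ha haR => ?_, fun hge j a ha haR => ?_⟩⟩
    · by_contra hcon
      have h1 : g r' < g r := g.strictMono hlt
      exact hcut2 (R r') ((hRE r').mono_g (fun a _ b _ h => hle h)) hr' j1 (g r') j a
        (hR0 r').1 (by omega) (hR0 r').2.1 (not_le.1 hcon) ha haR
    · by_contra hcon
      have h1 : g r ≤ g r' := g.monotone hge
      exact hcut2 (R r') ((hRE r').mono_g (fun a _ b _ h => hle h)) hr' j a j1 (g r')
        ha (not_lt.1 hcon) haR (by omega) (hR0 r').1 (hR0 r').2.1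
  have hbl : ∀ b, b ≤ N → (b+1)*W < M := fun b hb => by
    rw [hM]; exact Nat.mul_lt_mul_of_pos_right (by omega) (by omega)
  have hcutb : ∀ b, b ≤ N → ∃ S : Set V, S.ncard < q ∧ ∃ cut : Fin q → ℕ, ∀ r', Disjoint (R r') S →
      (r'.1 < (b+1)*W → ∀ j a, a ≤ n j → Q j a ∈ R r' → a ≤ cut j) ∧
      ((b+1)*W ≤ r'.1 → ∀ j a, a ≤ n j → Q j a ∈ R r' → cut j < a) := by
    intro b hb
    obtain ⟨S, hS, cut, h⟩ := hcut ⟨(b+1)*W, hbl b hb⟩ (Nat.mul_pos (by omega) (by omega))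
    exact ⟨S, hS, cut, fun r' hr' => ⟨fun h' => (h r' hr').1 h', fun h' => (h r' hr').2 h'⟩⟩
  choose! S hS cut hcutb using hcutb
  have hpick : ∀ b, b < N → ∃ Y : Set V, Cn G Y ∧ (∀ k, ∃ a ≤ n (φ0 k), Q (φ0 k) a ∈ Y) ∧
      (∀ j a, a ≤ n j → Q j a ∈ Y → cut b j < a ∧ a ≤ cut (b+1) j) ∧
      ∃ r : Fin M, Y = R r ∧ (b+1)*W ≤ r.1 ∧ r.1 < (b+2)*W := by
    intro b hb
    have hb2 := hbl (b+1) hb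
    have : ∃ r : Fin M, (b+1)*W ≤ r.1 ∧ r.1 < (b+2)*W ∧ Disjoint (R r) (S b ∪ S (b+1)) := by
      by_contra hcon
      push Not at hcon
      have e3 : (b+1+1)*W = (b+1)*W + W := by ring
      have hd : ∀ d : Fin W, ∃ x, x ∈ S b ∪ S (b+1) ∧ ∃ r : Fin M, r.1 = (b+1)*W + d.1 ∧ x ∈ R r := by
        intro d
        have hd := d.2
        have := hcon ⟨(b+1)*W + d, by omega⟩ (by simp) (by simp only; rw [show (b+2)*W = (b+1+1)*W from rfl]; omega)
        rw [Set.not_disjoint_iff] at this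
        obtain ⟨x, h1, h2⟩ := this
        exact ⟨x, h2, _, rfl, h1⟩
      choose e he1 r he2 he3 using hd
      have hei : Function.Injective e := by
        intro d d' h
        by_contra hne
        have : r d ≠ r d' := fun h => hne (Fin.ext (by have := he2 d; have := he2 d'; rw [h] at *; omega))
        exact Set.disjoint_left.1 (hRd _ _ this) (he3 d) (h ▸ he3 d')
      have h1 := exists_fin_rng e hei
      have h2 : (range e).ncard ≤ (S b ∪ S (b+1)).ncard := ncard_le_ncard (by rintro _ ⟨d, rfl⟩; exact he1 d) (toFinite _)
      have h3 := ncard_union_le (S b) (S (b+1))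
      have h4 := hS b hb.le
      have h5 := hS (b+1) hb
      omega
    obtain ⟨r, h1, h2, h3⟩ := this
    rw [Set.disjoint_union_right] at h3
    exact ⟨R r, hRG r, hR2 r, fun j a ha haR => ⟨(hcutb b hb.le r h3.1).2 h1 j a ha haR,
      (hcutb (b+1) hb r h3.2).1 h2 j a ha haR⟩, r, rfl, h1, h2⟩
  choose! Y hY1 hY2 hY3 hY4 using hpick
  have hne : ∀ k b, b < N → cut b (φ0 k) + 1 ≤ min (cut (b+1) (φ0 k)) (n (φ0 k)) := by
    intro k b hb
    obtain ⟨a, ha, haY⟩ := hY2 b hb k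
    have := hY3 b hb _ a ha haY
    omega
  have hmono : ∀ k b', b' ≤ N → ∀ b, b ≤ b' → cut b (φ0 k) ≤ cut b' (φ0 k) := by
    intro k b'
    induction b' with
    | zero => intro _ b hb; rw [Nat.le_zero.1 hb]
    | succ b' ih =>
      intro hb' b hb
      rcases Nat.lt_or_ge b (b'+1) with h | h
      · have := ih (by omega) b (by omega)
        have := hne k b' (by omega)
        omega
      · rw [le_antisymm hb h]
  have hint : ∀ k b b' a, b < N → b' < N → cut b (φ0 k) < a → a ≤ cut (b+1) (φ0 k) →
      cut b' (φ0 k) < a → a ≤ cut (b'+1) (φ0 k) → b = b' := by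
    intro k b b' a hb hb' h1 h2 h3 h4
    rcases Nat.lt_trichotomy b b' with h | h | h
    · have := hmono k b' hb'.le (b+1) h; omega
    · exact h
    · have := hmono k b hb.le (b'+1) h; omega
  refine hsl G (fun k b => Q (φ0 k) '' Set.Icc (cut b (φ0 k) + 1) (min (cut (b+1) (φ0 k)) (n (φ0 k)))) Y
    ?_ hY1 ?_ ?_ ?_ ?_ ?_
  · intro k b hb
    exact Cn_seg (hne k b hb) (fun i h1 h2 => hH2 (hQ _ _ (by omega)))
  · intro k b hb
    obtain ⟨a, ha, haY⟩ := hY2 b hb k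
    have := hY3 b hb _ a ha haY
    exact ⟨_, haY, a, ⟨this.1, le_min this.2 ha⟩, rfl⟩
  · intro k k' b b' hb hb' hor
    rw [Set.disjoint_left]
    rintro _ ⟨a, ⟨h1, h2⟩, rfl⟩ ⟨a', ⟨h3, h4⟩, he⟩
    rw [le_min_iff] at h2 h4
    obtain ⟨e1, rfl⟩ := hinj _ _ _ _ h4.2 h2.2 he
    obtain rfl := hφ0i e1
    have := hint k' b b' a' hb hb' h1 h2.1 h3 h4.1
    tauto
  · intro b b' hb hb' hne
    obtain ⟨r, h1, h2, h3⟩ := hY4 b hb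
    obtain ⟨r', h1', h2', h3'⟩ := hY4 b' hb'
    rw [h1, h1']
    apply hRd
    rintro rfl
    rcases Nat.lt_or_gt_of_ne hne with h | h
    · have := Nat.mul_le_mul_right W (show b + 2 ≤ b' + 1 by omega); omega
    · have := Nat.mul_le_mul_right W (show b' + 2 ≤ b + 1 by omega); omega
  · intro k b b' hb hb' hne
    rw [Set.disjoint_left]
    rintro _ hx ⟨a, ⟨h1, h2⟩, rfl⟩
    rw [le_min_iff] at h2
    have := hY3 b hb _ a h2.2 hx
    exact hne (hint k b b' a hb hb' this.1 this.2 h1 h2.1)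
  · intro k b hb
    have e1 := hne k b (by omega)
    have e2 := hne k (b+1) hb
    rw [le_min_iff] at e1 e2
    refine ⟨_, ⟨cut (b+1) (φ0 k), ⟨e1.1, le_min le_rfl (by omega)⟩, rfl⟩, _,
      ⟨cut (b+1) (φ0 k) + 1, ⟨le_rfl, le_min e2.1 e2.2⟩, rfl⟩, hH2 (hQ _ _ (by omega))⟩
end Paper

namespace Paper
variable {V : Type} {G G' : SimpleGraph V} {A B C D P S X Z : Set V} {x y z : V}

def RG (G : SimpleGraph V) (C : Set V) : SimpleGraph V :=
  { Adj := fun x y => G.Adj x y ∧ x ∈ C ∧ y ∈ C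
    symm := ⟨fun _ _ ⟨h, h1, h2⟩ => ⟨h.symm, h2, h1⟩⟩
    loopless := ⟨fun x h => G.loopless.irrefl x h.1⟩ }
lemma Cn.ofRG (h : Cn (RG G C) D) : Cn G D := h.mono_g (fun _ _ _ _ h => h.1)
lemma Cn.subRG (h : Cn (RG G C) D) (hx : x ∈ D) (hC : x ∈ C) : D ⊆ C := fun y hy =>
  (h.2 x hx y hy).ind hC (fun _ _ _ _ _ h => h.2.2)
lemma Cn.toRG (h : Cn G D) (hD : D ⊆ C) : Cn (RG G C) D :=
  h.mono_g (fun _ ha _ hb h => ⟨h, hD ha, hD hb⟩)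
lemma AdjS.mono_g (h : AdjS G A B) (hg : G ≤ G') : AdjS G' A B := by
  obtain ⟨x, hx, y, hy, h⟩ := h; exact ⟨x, hx, y, hy, hg h⟩
lemma WM.mono {T : ℕ} (h : WM G T) (hg : G ≤ G') : WM G' T := by
  obtain ⟨N, h1, h2, h3⟩ := h
  exact ⟨N, fun v => (h1 v).mono_g (fun _ _ _ _ h => hg h), h2, fun a b hab => (h3 a b hab).mono_g hg⟩
lemma RG_le : RG G C ≤ G := fun _ _ h => h.1
lemma Lk.mono {n m : ℕ} (h : Lk G A B n) (hm : m ≤ n) : Lk G A B m := by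
  obtain ⟨L, h1, h2⟩ := h
  exact ⟨fun i => L (Fin.castLE hm i), fun i => h1 _, fun i j hij => h2 _ _ (by simpa using hij)⟩

lemma avoid {ι : Type} [Finite ι] {N p s : ℕ} (Bad : ι → Set (Fin p)) (h : ∀ e, (Bad e).ncard ≤ s)
    (hN : Nat.card ι ≤ N) (hp : N * s < p) : ∃ i, ∀ e, i ∉ Bad e := by
  classical
  have := Fintype.ofFinite ι
  by_contra hc
  push Not at hc
  have h1 : (Finset.univ : Finset (Fin p)) ⊆ Finset.univ.biUnion (fun e => (Bad e).toFinset) := by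
    intro i _
    obtain ⟨e, he⟩ := hc i
    simp only [Finset.mem_biUnion, Finset.mem_univ, true_and, Set.mem_toFinset]
    exact ⟨e, he⟩
  have h2 := Finset.card_le_card h1
  have h3 := Finset.card_biUnion_le_card_mul (Finset.univ : Finset ι) (fun e => (Bad e).toFinset) s
    (fun e _ => by rw [← Set.ncard_eq_toFinset_card']; exact h e)
  rw [Finset.card_univ, Fintype.card_fin] at h2
  rw [Finset.card_univ, ← Nat.card_eq_fintype_card] at h3
  have := Nat.mul_le_mul_right s hN
  omega

lemma IsLk_good {n K r : ℕ} (hm : r + K ≤ n) (J : Set (Fin n))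
    (hJ : J.ncard ≤ K) : ∃ g : Fin r → Fin n, Function.Injective g ∧ ∀ i, g i ∉ J := by
  have := ncard_add_ncard_compl J
  rw [Nat.card_fin] at this
  exact exists_fin (Z := Jᶜ) (by omega)

lemma proc (T : ℕ) (hT : 0 < T) : ∀ N, ∃ f, ∀ {V : Type} [Finite V] (G : SimpleGraph V) (n : ℕ), n ≤ N →
    ∀ (A B : Fin n → Set V), (∀ e, Lk G (A e) (B e) f) → WM G T ∨ ∃ P : Fin n → Set V,
      (∀ e, Cn G (P e) ∧ (P e ∩ A e).Nonempty ∧ (P e ∩ B e).Nonempty) ∧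
      ∀ e e', e ≠ e' → Disjoint (P e) (P e') := by
  obtain ⟨K, hK, hcr⟩ := cross T hT
  intro N
  induction N with
  | zero =>
    refine ⟨0, fun G n hn A B h => ?_⟩
    obtain rfl : n = 0 := by omega
    exact Or.inr ⟨fun e => e.elim0, fun e => e.elim0, fun e => e.elim0⟩
  | succ N ih =>
    obtain ⟨f, hf⟩ := ih
    obtain ⟨s, hs⟩ := hcr (f + K)
    refine ⟨max (N * s + 1) (f + K), fun {V} _ G n hn A B h => ?_⟩
    cases n with
    | zero => exact Or.inr ⟨fun e => e.elim0, fun e => e.elim0, fun e => e.elim0⟩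
    | succ n =>
      by_cases hW : WM G T
      · exact Or.inl hW
      obtain ⟨P, hP1, hP2⟩ := (h 0).mono (le_max_left (N * s + 1) (f + K))
      have hL : ∀ e : Fin n, ∃ L : Fin (f + K) → Set V, IsLk G (A e.succ) (B e.succ) L ∧
          {i | K ≤ {j | (P i ∩ L j).Nonempty}.ncard}.ncard < s := fun e =>
        (hs G _ _ P (fun i => (hP1 i).1) hP2 ((h e.succ).mono (le_max_right _ _))).resolve_left hW
      choose L hL1 hL2 using hL
      obtain ⟨i0, hi0⟩ := avoid (N := N) (s := s) (fun e => {i | K ≤ {j | (P i ∩ L e j).Nonempty}.ncard})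
        (fun e => (hL2 e).le) (by rw [Nat.card_fin]; omega) (by omega)
      rcases hf (RG G (P i0)ᶜ) n (by omega) (fun e => A e.succ \ P i0) (fun e => B e.succ \ P i0) (by
        intro e
        have hk := hi0 e
        simp only [Set.mem_ofPred_eq, not_le] at hk
        obtain ⟨g, hg1, hg2⟩ := IsLk_good (r := f) le_rfl {j | (P i0 ∩ L e j).Nonempty} hk.le
        have hd : ∀ i, L e (g i) ⊆ (P i0)ᶜ := fun i w hw hwP => hg2 i ⟨w, hwP, hw⟩
        refine ⟨fun i => L e (g i), fun i => ⟨((hL1 e).1 (g i)).1.toRG (hd i), ?_, ?_⟩,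
          fun i j hij => (hL1 e).2 _ _ (fun h => hij (hg1 h))⟩
        · obtain ⟨w, hw, hwA⟩ := ((hL1 e).1 (g i)).2.1
          exact ⟨w, hw, hwA, hd i hw⟩
        · obtain ⟨w, hw, hwA⟩ := ((hL1 e).1 (g i)).2.2
          exact ⟨w, hw, hwA, hd i hw⟩) with hWM | ⟨P', h1, h2⟩
      · exact Or.inl (hWM.mono RG_le)
      right
      have hsub : ∀ e, Disjoint (P i0) (P' e) := by
        intro e
        obtain ⟨w, hw, hw1, hw2⟩ := (h1 e).2.1
        exact (Set.disjoint_left.2 fun z hz hz' => (h1 e).1.subRG hw hw2 hz' hz)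
      refine ⟨Fin.cons (P i0) P', ?_, ?_⟩
      · intro e
        refine Fin.cases ?_ (fun e => ?_) e
        · exact hP1 i0
        · obtain ⟨w, hw, hw1, hw2⟩ := (h1 e).2.1
          obtain ⟨w', hw', hw1', hw2'⟩ := (h1 e).2.2
          exact ⟨(h1 e).1.ofRG, ⟨w, hw, hw1⟩, ⟨w', hw', hw1'⟩⟩
      · intro e e'
        refine Fin.cases ?_ (fun e => ?_) e
        · refine Fin.cases (fun h => absurd rfl h) (fun e' _ => hsub e') e'
        · refine Fin.cases (fun _ => (hsub e).symm) (fun e' h => ?_) e'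
          exact h2 e e' (fun h' => h (by rw [h']))

def Br (G : SimpleGraph V) (U : Set V) (k : ℕ) : Prop := ∃ 𝓑 : Set (Set V),
  (∀ X ∈ 𝓑, X ⊆ U ∧ Cn G X) ∧ (∀ X ∈ 𝓑, ∀ Y ∈ 𝓑, Tch G X Y) ∧
    ∀ S : Set V, S.ncard < k → ∃ X ∈ 𝓑, Disjoint X S

lemma brsplit [Finite V] {n : ℕ} (hn : 0 < n) : ∀ (p : ℕ) (𝓑 : Set (Set V)),
    (∀ X ∈ 𝓑, Cn G X) → (∀ X ∈ 𝓑, ∀ Y ∈ 𝓑, Tch G X Y) →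
    (∀ S : Set V, S.ncard < p * n → ∃ X ∈ 𝓑, Disjoint X S) →
    ∃ (Ts : Fin p → Set V) (𝓒 : Fin p → Set (Set V)), (∀ i, Cn G (Ts i)) ∧ (∀ i, Ts i ⊆ ⋃₀ 𝓑) ∧
      (∀ i j, i ≠ j → Disjoint (Ts i) (Ts j)) ∧ (∀ i, 𝓒 i ⊆ 𝓑) ∧
      (∀ i, ∀ X ∈ 𝓒 i, (X ∩ Ts i).Nonempty) ∧
      ∀ i (S : Set V), S.ncard < n → ∃ X ∈ 𝓒 i, Disjoint X S := by
  intro p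
  induction p with
  | zero => intro 𝓑 _ _ _; exact ⟨fun e => e.elim0, fun e => e.elim0, fun e => e.elim0, fun e => e.elim0, fun e => e.elim0, fun e => e.elim0, fun e => e.elim0, fun e => e.elim0⟩
  | succ p ih =>
    intro 𝓑 h1 h2 h3
    have hpn : n ≤ (p+1) * n := Nat.le_mul_of_pos_left _ (by omega)
    obtain ⟨X0, hX0, -⟩ := h3 ∅ (by simp; omega)
    obtain ⟨x0, hx0⟩ := (h1 X0 hX0).1
    have hU : Cn G (⋃₀ 𝓑) := by
      refine Cn_of (x := x0) ⟨X0, hX0, hx0⟩ ?_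
      rintro y ⟨Y, hY, hy⟩
      exact (((h1 X0 hX0).union (h1 Y hY) (h2 _ hX0 _ hY)).2 x0 (Or.inl hx0) y (Or.inr hy)).mono
        (union_subset (subset_sUnion_of_mem hX0) (subset_sUnion_of_mem hY))
    let Gd : Set (Set V) := {T | Cn G T ∧ T ⊆ ⋃₀ 𝓑 ∧ ∃ S : Set V, S.ncard ≤ n ∧ ∀ X ∈ 𝓑, (X ∩ T).Nonempty → ¬ Disjoint X S}
    have hGd : Gd.Nonempty := ⟨{x0}, Cn_single, by rintro _ rfl; exact ⟨X0, hX0, hx0⟩, {x0}, by simp; omega, by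
      rintro X hX ⟨w, hw, rfl⟩ hd
      exact Set.disjoint_left.1 hd hw rfl⟩
    obtain ⟨T, hT⟩ := (toFinite Gd).exists_maximal hGd
    obtain ⟨⟨hTc, hTU, S0, hS0, hS0h⟩, hTm⟩ := hT
    have hord : ∀ S : Set V, S.ncard < n → ∃ X ∈ 𝓑, (X ∩ T).Nonempty ∧ Disjoint X S := by
      intro S hS
      by_contra hcon
      push Not at hcon
      by_cases hTe : ⋃₀ 𝓑 ⊆ T
      · obtain ⟨X, hX, hXS⟩ := h3 S (by omega)
        obtain ⟨w, hw⟩ := (h1 X hX).1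
        exact hcon X hX ⟨w, hw, hTe ⟨X, hX, hw⟩⟩ hXS
      · obtain ⟨y, hy, hyT⟩ := Set.not_subset.1 hTe
        obtain ⟨t, ht⟩ := hTc.1
        obtain ⟨a, ha, b, hb, haT, hbT, hab⟩ := hU.cut (hTU ht) ht hy hyT
        have : insert b T ∈ Gd := by
          refine ⟨hTc.insert haT hab.symm, insert_subset hb hTU, insert b S, (ncard_insert_le b S).trans hS, ?_⟩
          rintro X hX ⟨w, hw, hwT⟩ hd
          rw [Set.disjoint_insert_right] at hd
          rcases hwT with rfl | hwT
          · exact hd.1 hw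
          · exact hcon X hX ⟨w, hw, hwT⟩ hd.2
        exact hbT (hTm this (subset_insert _ _) (mem_insert _ _))
    obtain ⟨Ts, 𝓒, c1, c2, c3, c4, c5, c6⟩ := ih {X ∈ 𝓑 | Disjoint X T} (fun X hX => h1 X hX.1)
      (fun X hX Y hY => h2 X hX.1 Y hY.1) (by
        intro S hS
        obtain ⟨X, hX, hXS⟩ := h3 (S ∪ S0) (by
          have := ncard_union_le S S0
          rw [Nat.succ_mul]; omega)
        rw [Set.disjoint_union_right] at hXS
        refine ⟨X, ⟨hX, ?_⟩, hXS.1⟩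
        by_contra hd
        exact hS0h X hX (Set.not_disjoint_iff_nonempty_inter.1 hd) hXS.2)
    have hdT : ∀ i, Disjoint T (Ts i) := by
      intro i
      rw [Set.disjoint_left]
      intro w hw hw'
      obtain ⟨X, hX, hwX⟩ := c2 i hw'
      exact Set.disjoint_left.1 hX.2 hwX hw
    refine ⟨Fin.cons T Ts, Fin.cons {X ∈ 𝓑 | (X ∩ T).Nonempty} 𝓒, ?_, ?_, ?_, ?_, ?_, ?_⟩
    · exact Fin.cases hTc c1
    · exact Fin.cases hTU (fun i => (c2 i).trans (sUnion_subset_sUnion (fun X hX => hX.1)))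
    · intro e e'
      refine Fin.cases ?_ (fun e => ?_) e
      · refine Fin.cases (fun h => absurd rfl h) (fun e' _ => hdT e') e'
      · refine Fin.cases (fun _ => (hdT e).symm) (fun e' h => ?_) e'
        exact c3 e e' (fun h' => h (by rw [h']))
    · exact Fin.cases (fun X hX => hX.1) (fun i => (c4 i).trans (fun X hX => hX.1))
    · exact Fin.cases (fun X hX => hX.2) c5
    · refine Fin.cases (fun S hS => ?_) c6
      obtain ⟨X, hX, h, h'⟩ := hord S hS
      exact ⟨X, ⟨hX, h⟩, h'⟩

lemma choosef {m p s : ℕ} (Bad : Fin p → Fin p → Set (Fin p)) (hB : ∀ x y, (Bad x y).ncard ≤ s)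
    (hp : m*m*m*(s+1) < p) : ∃ f : Fin m → Fin p, ∀ a b c, c ≠ a → c ≠ b → f c ∉ Bad (f a) (f b) := by
  classical
  by_contra hcon
  push Not at hcon
  have hidx : ∀ x y, ∃ g : Fin p → Fin (s+1), ∀ z ∈ Bad x y, ∀ z' ∈ Bad x y, g z = g z' → z = z' := by
    intro x y
    have h1 : Fintype.card (Bad x y) ≤ Fintype.card (Fin (s+1)) := by
      rw [Fintype.card_fin, ← Nat.card_eq_fintype_card]; exact (hB x y).trans (by omega)
    obtain ⟨g⟩ := Function.Embedding.nonempty_of_card_le h1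
    refine ⟨fun z => if h : z ∈ Bad x y then g ⟨z, h⟩ else 0, fun z hz z' hz' he => ?_⟩
    simp only [hz, hz', dif_pos] at he
    exact congrArg Subtype.val (g.injective he)
  choose idx hidx using hidx
  choose a b c hca hcb hbad using hcon
  let Ψ : (Fin m → Fin p) × Fin p → (Fin m × Fin m × Fin m × Fin (s+1)) × (Fin m → Fin p) := fun w =>
    ((a w.1, b w.1, c w.1, idx (w.1 (a w.1)) (w.1 (b w.1)) (w.1 (c w.1))), Function.update w.1 (c w.1) w.2)
  have hinj : Function.Injective Ψ := by
    rintro ⟨f, z⟩ ⟨f', z'⟩ h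
    simp only [Ψ, Prod.mk.injEq] at h
    obtain ⟨⟨h1, h2, h3, h4⟩, h5⟩ := h
    have hne : ∀ d, d ≠ c f → f d = f' d := by
      intro d hd
      have := congrFun h5 d
      rwa [Function.update_of_ne hd, Function.update_of_ne (h3 ▸ hd)] at this
    have hz : z = z' := by
      have := congrFun h5 (c f)
      rwa [Function.update_self, h3, Function.update_self] at this
    have ea := hne _ (hca f).symm
    have eb := hne _ (hcb f).symm
    have h6 := hbad f'
    rw [← h1, ← h2, ← h3] at h4 h6
    rw [← ea, ← eb] at h4 h6
    have h7 := hidx _ _ _ (hbad f) _ h6 h4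
    refine Prod.ext (funext fun d => ?_) hz
    by_cases hd : d = c f
    · rw [hd]; exact h7
    · exact hne d hd
  have hc := Fintype.card_le_of_injective Ψ hinj
  simp only [Fintype.card_prod, Fintype.card_fin, Fintype.card_pi, Finset.prod_const, Finset.card_univ] at hc
  have hp0 : 0 < p := by omega
  have : p ≤ m*m*m*(s+1) := by
    refine Nat.le_of_mul_le_mul_left ?_ (pow_pos hp0 m)
    calc p^m * p ≤ _ := hc
      _ = _ := by ring
  omega

lemma Cn.trim2 (hE : Cn G D) (hA : (D ∩ A).Nonempty) (hB : (D ∩ B).Nonempty)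
    (hd : Disjoint A B) (hn : ¬ AdjS G A B) : ∃ E ⊆ D \ (A ∪ B), Cn G E ∧
      AdjS G A E ∧ AdjS G B E := by
  obtain ⟨x, hx, hxA⟩ := hA
  obtain ⟨y, hy, hyB⟩ := hB
  obtain ⟨E1, h1, h2, h3, a, ha, b, hb, hab⟩ := hE.trim hx hxA hy hyB hd
  have haA : a ∉ A := fun h => hn ⟨a, h, b, hb.2, hab⟩
  obtain ⟨E, h4, h5, h6, c, hc, e, he, hce⟩ := h2.trim (A := Aᶜ) (B := A) ha haA h3 hxA disjoint_compl_left
  exact ⟨E, fun w hw => ⟨(h1 (h4 hw).1).1, fun h => h.elim (h4 hw).2 (h1 (h4 hw).1).2⟩, h5,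
    ⟨e, he.2, c, hc, hce.symm⟩, ⟨b, hb.2, a, h6, hab.symm⟩⟩

theorem gridthm (T : ℕ) (hT : 0 < T) : ∃ k, ∀ {V : Type} [Finite V] (G : SimpleGraph V),
    Br G Set.univ k → WM G T := by
  classical
  obtain ⟨K, hK, hcr⟩ := cross T hT
  obtain ⟨m, hm⟩ : ∃ m, m = Fintype.card (Fin T × Fin (2*T)) := ⟨_, rfl⟩
  obtain ⟨f0, hf0⟩ := proc T hT (m*m)
  obtain ⟨s, hs⟩ := hcr (f0 + m*K + 1)
  refine ⟨(m*m*m*(s+2+1)+1) * (f0 + m*K + 1), fun {V} _ G ⟨𝓑, b1, b2, b3⟩ => ?_⟩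
  by_cases hW : WM G T
  · exact hW
  obtain ⟨Ts, 𝓒, c1, c2, c3, c4, c5, c6⟩ := brsplit (G := G) (n := f0 + m*K + 1) (by omega)
    (m*m*m*(s+2+1)+1) 𝓑 (fun X hX => (b1 X hX).2) b2 b3
  have hL : ∀ i j, ∃ L : Fin (f0 + m*K + 1) → Set V, IsLk G (Ts i) (Ts j) L ∧
      {c | K ≤ {l | (Ts c ∩ L l).Nonempty}.ncard}.ncard < s := by
    intro i j
    refine (hs G _ _ Ts c1 c3 (menger ?_)).resolve_left hW
    intro S hS
    by_contra hlt
    obtain ⟨X, hX, hXS⟩ := c6 i S (by omega)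
    obtain ⟨Y, hY, hYS⟩ := c6 j S (by omega)
    obtain ⟨x, hx, hx'⟩ := c5 i X hX
    obtain ⟨y, hy, hy'⟩ := c5 j Y hY
    refine hS x hx' (Set.disjoint_left.1 hXS hx) y hy' (Set.disjoint_left.1 hYS hy) ?_
    refine (((b1 X (c4 i hX)).2.union (b1 Y (c4 j hY)).2 (b2 _ (c4 i hX) _ (c4 j hY))).2 x (Or.inl hx) y (Or.inr hy)).mono ?_
    exact union_subset (Set.subset_compl_iff_disjoint_right.2 hXS) (Set.subset_compl_iff_disjoint_right.2 hYS)
  choose L hL1 hL2 using hL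
  obtain ⟨f, hf⟩ := choosef (m := m) (s := s + 2)
    (fun x y => {c | K ≤ {l | (Ts c ∩ L x y l).Nonempty}.ncard} ∪ {x, y})
    (fun x y => (ncard_union_le _ _).trans (add_le_add (hL2 x y).le ((ncard_insert_le x {y}).trans (by simp)))) (by omega)
  have hfi : Function.Injective f := by
    intro a b hab
    by_contra hne
    exact hf b b a hne hne (Or.inr (Or.inl hab))
  have hTd : ∀ a b, a ≠ b → Disjoint (Ts (f a)) (Ts (f b)) := fun a b hab => c3 _ _ (fun h => hab (hfi h))
  obtain ⟨C, hC⟩ : ∃ C, C = (⋃ a, Ts (f a))ᶜ := ⟨_, rfl⟩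
  have hCd : ∀ a, Disjoint C (Ts (f a)) := fun a => by
    rw [hC, Set.disjoint_left]; exact fun w hw hw' => hw (mem_iUnion.2 ⟨a, hw'⟩)
  let ι := {e : Fin m × Fin m // e.1 < e.2 ∧ ¬ AdjS G (Ts (f e.1)) (Ts (f e.2))}
  have hι : Fintype.card ι ≤ m * m := by
    calc Fintype.card ι ≤ Fintype.card (Fin m × Fin m) := Fintype.card_subtype_le _
      _ = m * m := by simp
  let eq := Fintype.equivFin ι
  let Nb : Fin m → Set V := fun a => {x | x ∈ C ∧ ∃ y ∈ Ts (f a), G.Adj y x}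
  have hlk : ∀ e : Fin (Fintype.card ι), Lk (RG G C) (Nb (eq.symm e).1.1) (Nb (eq.symm e).1.2) f0 := by
    intro e
    obtain ⟨⟨⟨a, b⟩, hab, hnad⟩, -⟩ : ∃ w, w = eq.symm e := ⟨_, rfl⟩
    generalize eq.symm e = w
    obtain ⟨⟨a, b⟩, hab, hnad⟩ := w
    simp only at hab hnad ⊢
    have hJ : {l | ∃ c, c ≠ a ∧ c ≠ b ∧ (Ts (f c) ∩ L (f a) (f b) l).Nonempty}.ncard ≤ m * K := by
      have h1 : {l | ∃ c, c ≠ a ∧ c ≠ b ∧ (Ts (f c) ∩ L (f a) (f b) l).Nonempty} ⊆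
          ⋃ c ∈ {c | c ≠ a ∧ c ≠ b}, {l | (Ts (f c) ∩ L (f a) (f b) l).Nonempty} := by
        rintro l ⟨c, h1, h2, h3⟩
        exact mem_biUnion (show c ∈ {c | c ≠ a ∧ c ≠ b} from ⟨h1, h2⟩) h3
      have h2 : ((Finset.univ.filter (fun c => c ≠ a ∧ c ≠ b)).biUnion
          (fun c => {l | (Ts (f c) ∩ L (f a) (f b) l).Nonempty}.toFinset)).card ≤ m * K := by
        refine (Finset.card_biUnion_le_card_mul _ _ K ?_).trans
          (Nat.mul_le_mul_right _ ((Finset.card_filter_le _ _).trans (by simp)))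
        intro c hc
        rw [← Set.ncard_eq_toFinset_card']
        have := hf a b c (Finset.mem_filter.1 hc).2.1 (Finset.mem_filter.1 hc).2.2
        have := fun h => this (Or.inl h)
        exact (not_le.1 this).le
      refine le_trans ?_ h2
      rw [← ncard_coe_finset]
      refine ncard_le_ncard ?_ (toFinite _)
      rintro l ⟨c, h1, h2, h3⟩
      simp only [Finset.coe_biUnion, mem_iUnion, Set.coe_toFinset]
      exact ⟨c, by simp [h1, h2], h3⟩
    obtain ⟨g, hg1, hg2⟩ := IsLk_good (r := f0) (n := f0 + m*K+1) (by omega) _ hJ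
    have hE : ∀ i, ∃ E ⊆ L (f a) (f b) (g i) \ (Ts (f a) ∪ Ts (f b)), Cn G E ∧
      AdjS G (Ts (f a)) E ∧ AdjS G (Ts (f b)) E := fun i =>
        ((hL1 (f a) (f b)).1 (g i)).1.trim2 ((hL1 (f a) (f b)).1 (g i)).2.1 ((hL1 (f a) (f b)).1 (g i)).2.2
          (hTd a b hab.ne) hnad
    choose E e1 e2 e3 e4 using hE
    have hEC : ∀ i, E i ⊆ C := by
      intro i w hw
      rw [hC]
      intro hw'
      obtain ⟨c, hc⟩ := mem_iUnion.1 hw'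
      have h := e1 i hw
      by_cases hca : c = a
      · exact h.2 (Or.inl (hca ▸ hc))
      by_cases hcb : c = b
      · exact h.2 (Or.inr (hcb ▸ hc))
      exact hg2 i ⟨c, hca, hcb, w, hc, h.1⟩
    refine ⟨E, fun i => ⟨(e2 i).toRG (hEC i), ?_, ?_⟩, fun i j hij => ?_⟩
    · obtain ⟨x, hx, y, hy, h⟩ := e3 i
      exact ⟨y, hy, hEC i hy, x, hx, h⟩
    · obtain ⟨x, hx, y, hy, h⟩ := e4 i
      exact ⟨y, hy, hEC i hy, x, hx, h⟩
    · exact ((hL1 (f a) (f b)).2 _ _ (fun h => hij (hg1 h))).mono ((e1 i).trans sdiff_subset) ((e1 j).trans sdiff_subset)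
  rcases hf0 (RG G C) _ hι _ _ hlk with h | ⟨P, hP1, hP2⟩
  · exact h.mono RG_le
  have hPC : ∀ e, P e ⊆ C := fun e => by
    obtain ⟨w, hw, hw'⟩ := (hP1 e).2.1
    exact (hP1 e).1.subRG hw hw'.1
  let M : Fin m → Set V := fun a => Ts (f a) ∪ ⋃ e : {e // (eq.symm e).1.1 = a}, P e.1
  have hM1 : ∀ a, Cn G (M a) := by
    intro a
    refine Cn_iUnion (c1 _) (fun e => (hP1 e.1).1.ofRG) ?_
    rintro ⟨e, rfl⟩
    obtain ⟨w, hw, hw', y, hy, hyw⟩ := (hP1 e).2.1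
    exact ⟨y, hy, w, hw, Or.inr hyw⟩
  have hM2 : ∀ a b, a ≠ b → Disjoint (M a) (M b) := by
    intro a b hab
    simp only [M, Set.disjoint_union_left, Set.disjoint_union_right, Set.disjoint_iUnion_left, Set.disjoint_iUnion_right]
    refine ⟨⟨hTd a b hab, fun e => ((hCd b).mono_left (hPC _))⟩, fun e => ⟨((hCd a).mono_left (hPC _)).symm, ?_⟩⟩
    obtain ⟨e, rfl⟩ := e
    rintro ⟨e', rfl⟩
    exact hP2 _ _ (fun h => hab (congrArg (fun e => (eq.symm e).1.1) h))
  have hM3 : ∀ a b, a < b → AdjS G (M a) (M b) := by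
    intro a b hab
    by_cases hnad : AdjS G (Ts (f a)) (Ts (f b))
    · exact hnad.mono subset_union_left subset_union_left
    obtain ⟨e, he⟩ : ∃ e, eq.symm e = (⟨(a, b), hab, hnad⟩ : ι) := ⟨eq ⟨(a, b), hab, hnad⟩, by simp⟩
    obtain ⟨w, hw, hw', y, hy, hyw⟩ := (hP1 e).2.2
    refine ⟨w, Or.inr (mem_iUnion.2 ⟨⟨e, by rw [he]⟩, hw⟩), y, Or.inl ?_, hyw.symm⟩
    rw [he] at hy; exact hy
  let ee := Fintype.equivFin (Fin T × Fin (2*T))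
  refine ⟨fun h => M (Fin.cast hm.symm (ee h)), fun h => hM1 _, fun h h' hne => hM2 _ _ ?_, fun h h' hne => ?_⟩
  · intro he; exact hne (ee.injective (by simpa using he))
  · have : Fin.cast hm.symm (ee h) ≠ Fin.cast hm.symm (ee h') := fun he => hne.ne (ee.injective (by simpa using he))
    rcases lt_or_gt_of_ne this with h | h
    · exact hM3 _ _ h
    · exact (hM3 _ _ h).symm
end Paper

namespace Paper
variable {V : Type} {G G' : SimpleGraph V} {A B C D P S X Z : Set V} {x y z : V}

lemma Cn.conn (h : Cn G A) : (G.induce A).Connected := by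
  obtain ⟨⟨x, hx⟩, h2⟩ := h
  rw [connected_iff_exists_forall_reachable]
  refine ⟨⟨x, hx⟩, fun ⟨w, hw⟩ => ?_⟩
  have h := h2 x hx w hw
  have : ∀ y, Rch G A x y → ∀ hy : y ∈ A, (G.induce A).Reachable ⟨x, hx⟩ ⟨y, hy⟩ := by
    intro y hy
    induction hy with
    | refl => intro _; exact .refl _
    | tail _ hc ih =>
      intro hy
      exact (ih hc.2.1).trans (Adj.reachable (by simpa using hc.1))
  exact this w h hw

def TR {ι : Type} (T : SimpleGraph ι) : Prop := Cn T Set.univ ∧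
  ∀ a b, T.Adj a b → ¬ Relation.ReflTransGen (fun x y => T.Adj x y ∧ s(x,y) ≠ s(a,b)) a b

lemma TR.tree {ι : Type} {T : SimpleGraph ι} (h : TR T) : T.IsTree := by
  refine ⟨?_, ?_⟩
  · have := h.1.conn
    exact (Iso.connected_iff (SimpleGraph.induceUnivIso T)).1 this
  · rw [isAcyclic_iff_forall_adj_isBridge]
    intro a b hab
    rw [isBridge_iff, reachable_iff_reflTransGen]
    intro h'
    refine h.2 a b hab (Relation.ReflTransGen.mono ?_ _ _ h')
    intro x y hxy
    simpa [deleteEdges_adj] using hxy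

def leafT {ι : Type} (T : SimpleGraph ι) (t : ι) : SimpleGraph (Option ι) where
  Adj a b := match a, b with
    | some a, some b => T.Adj a b
    | none, some b => b = t
    | some a, none => a = t
    | none, none => False
  symm := ⟨by rintro (_ | a) (_ | b) h <;> first | exact h | exact SimpleGraph.Adj.symm h⟩
  loopless := ⟨by rintro (_ | a) h <;> first | exact h | exact T.loopless.irrefl _ h⟩

lemma Cn.leaf {ι : Type} {T : SimpleGraph ι} {t : ι} {S : Set ι} (h : Cn T S) :
    Cn (leafT T t) (some '' S) := by
  obtain ⟨⟨x, hx⟩, h2⟩ := h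
  refine Cn_of (x := some x) ⟨x, hx, rfl⟩ ?_
  rintro _ ⟨y, hy, rfl⟩
  have := h2 x hx y hy
  induction this with
  | refl => exact .refl
  | tail _ hc ih =>
    exact (ih hc.2.1).trans (Rch.adj (by exact hc.1) ⟨_, hc.2.1, rfl⟩ ⟨_, hc.2.2, rfl⟩)

lemma TR.leaf {ι : Type} {T : SimpleGraph ι} {t : ι} (h : TR T) : TR (leafT T t) := by
  constructor
  · have := Cn.insert (x := (none : Option ι)) (h.1.leaf (t := t)) (y := some t) ⟨t, mem_univ _, rfl⟩ (by exact rfl)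
    convert this
    ext (_ | x) <;> simp
  · have key : ∀ a b, T.Adj a b → ¬ Relation.ReflTransGen
        (fun x y => (leafT T t).Adj x y ∧ s(x,y) ≠ s(some a, some b)) (some a) (some b) := by
      intro a b hab hr
      have : ∀ y, Relation.ReflTransGen
        (fun x y => (leafT T t).Adj x y ∧ s(x,y) ≠ s(some a, some b)) (some a) y →
         Relation.ReflTransGen (fun x y => T.Adj x y ∧ s(x,y) ≠ s(a,b)) a (y.getD t) := by
        intro y hy
        induction hy with
        | refl => exact .refl
        | @tail u w _ hc ih =>
          rcases u with _ | u <;> rcases w with _ | w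
          · exact ih
          · have : w = t := hc.1
            subst this; exact ih
          · have : u = t := hc.1
            subst this; exact ih
          · refine ih.tail ⟨hc.1, fun h => hc.2 ?_⟩
            simpa using h
      exact h.2 a b hab (this _ hr)
    have key2 : ∀ y, Relation.ReflTransGen
        (fun x y => (leafT T t).Adj x y ∧ s(x,y) ≠ s(none, some t)) none y → y = none := by
      intro y hy
      induction hy with
      | refl => rfl
      | @tail u w _ hc ih =>
        subst ih
        rcases w with _ | w
        · rfl
        · have : w = t := hc.1
          subst this; exact absurd rfl hc.2
    rintro (_ | a) (_ | b) hab
    · exact hab.elim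
    · have : b = t := hab
      subst this
      intro h; simpa using key2 _ h
    · have : a = t := hab
      subst this
      intro h
      have h2 : Relation.ReflTransGen
        (fun x y => (leafT T a).Adj x y ∧ s(x,y) ≠ s(none, some a)) none (some a) := by
        have := Relation.reflTransGen_swap.2 h
        refine Relation.ReflTransGen.mono ?_ _ _ this
        rintro x y ⟨h1, h2⟩
        refine ⟨h1.symm, ?_⟩
        rw [Sym2.eq_swap, Sym2.eq_swap (a := none)]; exact h2
      simpa using key2 _ h2
    · exact key a b hab

abbrev Nb (G : SimpleGraph V) (D : Set V) : Set V := nbhdOfSet G D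

def PTD (G : SimpleGraph V) (k : ℕ) (U : Set V) : Prop :=
  ∃ (ι : Type) (T : SimpleGraph ι) (χ : ι → Finset V), TR T ∧ (∀ t, ∀ v ∈ χ t, v ∈ U) ∧
    (∀ v ∈ U, Cn T {t | v ∈ χ t}) ∧ (∀ u ∈ U, ∀ v ∈ U, G.Adj u v → ∃ t, u ∈ χ t ∧ v ∈ χ t) ∧
    (∀ t, (χ t).card ≤ 3*k+1) ∧ ∀ x ∉ U, (∃ t, ∀ v ∈ Nb G (cmp G Uᶜ x), v ∈ χ t) ∧
      (Nb G (cmp G Uᶜ x)).ncard + 1 ≤ 2*k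

lemma step_set [Finite V] {k : ℕ} (hk : 0 < k) (hB : ¬ Br G Set.univ k) (hC : Cn G C)
    (hW : (Nb G C).ncard + 1 ≤ 2*k) : ∃ S ⊆ C, S.Nonempty ∧ S.ncard ≤ k ∧
      ∀ C', Cn G C' → C' ⊆ C \ S → Nb G C' ⊆ Nb G C ∪ S → (Nb G C').ncard + 1 ≤ 2*k := by
  by_cases hW2 : (Nb G C).ncard + 2 ≤ 2*k
  · obtain ⟨c, hc⟩ := hC.1
    refine ⟨{c}, by simpa using hc, by simp, by simp; omega, fun C' _ _ h => ?_⟩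
    have := ncard_le_ncard h (toFinite _)
    have := ncard_union_le (Nb G C) {c}
    rw [ncard_singleton] at this; omega
  have hW3 : (Nb G C).ncard + 1 = 2*k := by omega
  have : ∃ S : Set V, S.ncard < k ∧ ∀ B, Cn G B → k ≤ (B ∩ Nb G C).ncard → ¬ Disjoint B S := by
    by_contra hc
    push Not at hc
    refine hB ⟨{B | Cn G B ∧ k ≤ (B ∩ Nb G C).ncard}, fun X hX => ⟨subset_univ _, hX.1⟩, ?_, ?_⟩
    · intro X hX Y hY
      by_contra ht
      have : Disjoint (X ∩ Nb G C) (Y ∩ Nb G C) := by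
        rw [Set.disjoint_left]
        intro a ha hb
        exact ht ⟨a, ha.1, a, hb.1, Or.inl rfl⟩
      have h1 := ncard_union_eq this
      have h2 : (X ∩ Nb G C ∪ Y ∩ Nb G C).ncard ≤ (Nb G C).ncard :=
        ncard_le_ncard (union_subset inter_subset_right inter_subset_right) (toFinite _)
      have := hX.2; have := hY.2
      omega
    · intro S hS
      obtain ⟨B, h1, h2, h3⟩ := hc S hS
      exact ⟨B, ⟨h1, h2⟩, h3⟩
  obtain ⟨S, hS, hhit⟩ := this
  have main : ∀ C', Cn G C' → Disjoint C' S → ((Nb G C' ∩ Nb G C) \ S).ncard < k := by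
    intro C' hC' hd
    by_contra hlt
    push Not at hlt
    have hcn : Cn G (C' ∪ ((Nb G C' ∩ Nb G C) \ S)) := by
      have := Cn_iUnion (B := fun i : ↥((Nb G C' ∩ Nb G C) \ S) => {i.1}) hC' (fun _ => Cn_single) ?_
      · convert this
        ext x; simp; tauto
      · rintro ⟨i, ⟨⟨_, d, hd, hid⟩, _⟩, _⟩
        exact ⟨d, hd, i, rfl, Or.inr hid.symm⟩
    refine hhit _ hcn (hlt.trans (ncard_le_ncard ?_ (toFinite _))) ?_
    · exact fun x hx => ⟨Or.inr hx, hx.1.2⟩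
    · rw [Set.disjoint_union_left]
      exact ⟨hd, Set.disjoint_sdiff_left⟩
  refine ⟨S ∩ C, inter_subset_right, ?_, (ncard_le_ncard Set.inter_subset_left (toFinite _)).trans hS.le, ?_⟩
  · by_contra hne
    rw [not_nonempty_iff_eq_empty] at hne
    have := main C hC (by rw [Set.disjoint_iff_inter_eq_empty, inter_comm]; exact hne)
    rw [inter_self] at this
    have h2 := le_ncard_sdiff S (Nb G C) 
    omega
  · intro C' hC' hs hN
    have hd : Disjoint C' S := by
      rw [Set.disjoint_left]
      intro a ha hb; exact (hs ha).2 ⟨hb, (hs ha).1⟩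
    have h1 := main C' hC' hd
    have h2 : Nb G C' ⊆ ((Nb G C' ∩ Nb G C) \ S) ∪ S := by
      intro a ha
      by_cases h : a ∈ S
      · exact Or.inr h
      · rcases hN ha with h' | h'
        · exact Or.inl ⟨⟨ha, h'⟩, h⟩
        · exact absurd h'.1 h
    have := ncard_le_ncard h2 (toFinite _)
    have := ncard_union_le ((Nb G C' ∩ Nb G C) \ S) S
    omega

lemma PTD_step [Finite V] {k : ℕ} (hk : 0 < k) (hB : ¬ Br G Set.univ k) {U : Set V} (h : PTD G k U)
    (hx : x ∉ U) : ∃ U', U ⊂ U' ∧ PTD G k U' := by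
  classical
  obtain ⟨ι, T, χ, hT, h1, h2, h3, h4, h5⟩ := h
  obtain ⟨⟨t, ht⟩, hW⟩ := h5 x hx
  obtain ⟨C, hCe⟩ : ∃ C, C = cmp G Uᶜ x := ⟨_, rfl⟩
  have hxU : x ∈ Uᶜ := hx
  have hC : Cn G C := hCe ▸ Cn_cmp hxU
  have hCU : C ⊆ Uᶜ := hCe ▸ cmp_sub hxU
  rw [← hCe] at ht hW
  have hNU : Nb G C ⊆ U := by
    rintro v ⟨hv, d, hd, hvd⟩
    by_contra hvU
    subst hCe
    exact hv (cmp_step hxU hd hvU hvd.symm)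
  obtain ⟨S, hSC, hS0, hSk, hS⟩ := step_set hk hB hC hW
  have hfin : (Nb G C ∪ S).Finite := toFinite _
  obtain ⟨Z, hZ⟩ : ∃ Z : Finset V, ∀ v, v ∈ Z ↔ v ∈ Nb G C ∪ S := ⟨hfin.toFinset, fun v => by simp⟩
  have hSU : ∀ v ∈ S, v ∉ U := fun v hv => hCU (hSC hv)
  refine ⟨U ∪ S, ?_, Option ι, leafT T t, fun o => o.elim Z χ, hT.leaf, ?_, ?_, ?_, ?_, ?_⟩
  · obtain ⟨s, hs⟩ := hS0
    exact ⟨subset_union_left, fun h => hSU s hs (h (Or.inr hs))⟩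
  · rintro (_ | i) v hv
    · rcases (hZ v).1 hv with h | h
      · exact Or.inl (hNU h)
      · exact Or.inr h
    · exact Or.inl (h1 i v hv)
  · intro v hv
    by_cases hvU : v ∈ U
    · have hb := (h2 v hvU).leaf (t := t)
      by_cases hvN : v ∈ Nb G C
      · have := hb.insert (x := (none : Option ι)) (y := some t) ⟨t, ht v hvN, rfl⟩ (by exact rfl)
        convert this
        ext (_ | i) <;> simp [hZ, hvN]
      · convert hb
        have : v ∉ S := fun h => hSU v h hvU
        ext (_ | i) <;> simp [hZ, hvN, this]
    · have hvS : v ∈ S := hv.resolve_left hvU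
      convert Cn_single (G := leafT T t) (x := (none : Option ι))
      ext (_ | i)
      · simp [hZ, hvS]
      · simpa using fun h => hvU (h1 i v h)
  · have hSN : ∀ u ∈ S, ∀ v ∈ U ∪ S, G.Adj u v → u ∈ Z ∧ v ∈ Z := by
      intro u hu v hv huv
      refine ⟨(hZ u).2 (Or.inr hu), (hZ v).2 ?_⟩
      by_cases hvS : v ∈ S
      · exact Or.inr hvS
      · exact Or.inl ⟨fun h => hCU h (hv.resolve_right hvS), u, hSC hu, huv.symm⟩
    intro u hu v hv huv
    by_cases huS : u ∈ S
    · exact ⟨none, hSN u huS v hv huv⟩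
    by_cases hvS : v ∈ S
    · exact ⟨none, (hSN v hvS u hu huv.symm).symm⟩
    obtain ⟨i, hi⟩ := h3 u (hu.resolve_right huS) v (hv.resolve_right hvS) huv
    exact ⟨some i, hi⟩
  · rintro (_ | i)
    · have : Z.card = (Nb G C ∪ S).ncard := by
        rw [← ncard_coe_finset]; congr 1; ext v; simpa using hZ v
      have := ncard_union_le (Nb G C) S
      show Z.card ≤ _
      omega
    · exact h4 i
  · intro y hy
    have hyU : y ∉ U := fun h => hy (Or.inl h)
    have hyS : y ∉ S := fun h => hy (Or.inr h)
    obtain ⟨C', hC'⟩ : ∃ C', C' = cmp G (U ∪ S)ᶜ y := ⟨_, rfl⟩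
    have hyc : y ∈ (U ∪ S)ᶜ := hy
    have hCn : Cn G C' := hC' ▸ Cn_cmp hyc
    have hsub : C' ⊆ (U ∪ S)ᶜ := hC' ▸ cmp_sub hyc
    have hsubU : C' ⊆ Uᶜ := fun a ha h => hsub ha (Or.inl h)
    have hyC' : y ∈ C' := hC' ▸ mem_cmp
    have hNC' : Nb G C' ⊆ U ∪ S := by
      rintro v ⟨hv, d, hd, hvd⟩
      by_contra hvU
      subst hC'
      exact hv (cmp_step hyc hd hvU hvd.symm)
    rw [← hC']
    by_cases hyC : y ∈ C
    · have hCC : C' ⊆ C := by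
        subst hCe
        exact hCn.sub_cmp' hsubU hyC' hyC
      have hNN : Nb G C' ⊆ Nb G C ∪ S := by
        rintro v ⟨hv, d, hd, hvd⟩
        by_cases hvS : v ∈ S
        · exact Or.inr hvS
        refine Or.inl ⟨fun hvC => ?_, d, hCC hd, hvd⟩
        rcases hNC' ⟨hv, d, hd, hvd⟩ with h | h
        · exact hCU hvC h
        · exact hvS h
      exact ⟨⟨none, fun v hv => (hZ v).2 (hNN hv)⟩,
        hS C' hCn (fun a ha => ⟨hCC ha, fun h => hsub ha (Or.inr h)⟩) hNN⟩
    · have hE : C' = cmp G Uᶜ y := by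
        refine Subset.antisymm (hCn.sub_cmp hsubU hyC') ?_
        intro z hz
        have hcd : Disjoint (cmp G Uᶜ y) C := by
          rw [Set.disjoint_left]
          intro a ha hb
          subst hCe
          exact hyC (Rch.trans hb (Rch.symm ha))
        subst hC'
        refine (Rch_cmp hyU hz).mono ?_
        intro a ha h
        rcases h with h | h
        · exact cmp_sub (show y ∈ Uᶜ from hyU) ha h
        · exact Set.disjoint_left.1 hcd ha (hSC h)
      rw [hE]
      obtain ⟨⟨i, hi⟩, h7⟩ := h5 y hyU
      exact ⟨⟨some i, hi⟩, h7⟩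

theorem tw_br [Finite V] {k : ℕ} (hk : 0 < k) (h : ¬ HasTreewidthAtMost G (3*k)) : Br G Set.univ k := by
  by_contra hB
  have h0 : PTD G k ∅ := by
    refine ⟨Unit, ⊥, fun _ => ∅, ⟨?_, by simp⟩, by simp, by simp, by simp, by simp, ?_⟩
    · convert Cn_single (G := (⊥ : SimpleGraph Unit)) (x := ()) using 1
      ext; simp
    · intro x _
      have : Nb G (cmp G ∅ᶜ x) = ∅ := by
        ext v
        simp only [Set.mem_empty_iff_false, iff_false]
        rintro ⟨hv, d, hd, hvd⟩
        exact hv (cmp_step (by simp) hd (by simp) hvd.symm)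
      rw [this]
      simp; omega
  obtain ⟨U, hU, hmax⟩ := (toFinite {U | PTD G k U}).exists_maximal ⟨_, h0⟩
  by_cases hUu : U = Set.univ
  · subst hUu
    obtain ⟨ι, T, χ, hT, h1, h2, h3, h4, h5⟩ := hU
    refine h ⟨ι, T, χ, hT.tree, fun v => ?_, fun u v => h3 u (mem_univ _) v (mem_univ _),
      fun v => (h2 v (mem_univ _)).conn, h4⟩
    exact (h2 v (mem_univ _)).1
  · obtain ⟨x, hx⟩ := (ne_univ_iff_exists_notMem _).1 hUu
    obtain ⟨U', h1, h2⟩ := PTD_step hk hB hU hx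
    exact h1.2 (hmax h2 h1.1)
end Paper

namespace Paper
variable {V : Type} {G G' : SimpleGraph V} {A B C D P S X Z : Set V} {x y z : V}

def IPf (G : SimpleGraph V) (p : ℕ → V) (m : ℕ) : Prop := (∀ i < m, G.Adj (p i) (p (i+1))) ∧
  ∀ i j, i < j → j ≤ m → p i ≠ p j ∧ (G.Adj (p i) (p j) → j = i+1)

lemma ipath {R Q : V → Prop} (h : Cn G D) (hx : x ∈ D) (hR : R x) (hy : y ∈ D) (hQ : Q y) :
    ∃ p m, IPf G p m ∧ (∀ i ≤ m, p i ∈ D) ∧ R (p 0) ∧ Q (p m) ∧ (∀ i < m, ¬ Q (p i)) ∧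
      ∀ i, 0 < i → i ≤ m → ¬ R (p i) := by
  classical
  have hex : ∃ m, ∃ p : ℕ → V, R (p 0) ∧ Q (p m) ∧ (∀ i < m, G.Adj (p i) (p (i+1))) ∧ ∀ i ≤ m, p i ∈ D := by
    obtain ⟨f, n, h1, h2, h3, h4, -⟩ := (h.2 x hx y hy).path hx
    exact ⟨n, f, by rwa [h1], by rwa [h2], h3, h4⟩
  obtain ⟨m, hm⟩ : ∃ m, m = Nat.find hex := ⟨_, rfl⟩
  obtain ⟨p, h1, h2, h3, h4⟩ := Nat.find_spec hex
  have hmin : ∀ m' < m, ¬ ∃ p : ℕ → V, R (p 0) ∧ Q (p m') ∧ (∀ i < m', G.Adj (p i) (p (i+1))) ∧ ∀ i ≤ m', p i ∈ D :=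
    fun m' h => Nat.find_min hex (hm ▸ h)
  rw [← hm] at h2 h3 h4
  have short : ∀ i j, i < j → i + (m - j) < m → j ≤ m → (p i = p j ∨ (G.Adj (p i) (p j) ∧ i + 1 < j)) → False := by
    intro i j hij hlt hj hor
    rcases hor with he | ⟨ha, hlt2⟩
    · refine hmin (i + (m-j)) hlt ⟨fun k => if k ≤ i then p k else p (k - i + j), by simpa, ?_, ?_, ?_⟩
      · by_cases hjm : j = m
        · subst hjm; simp [he, h2]
        · simp only; rw [if_neg (by omega)]; convert h2 using 2; omega
      · intro k hk
        simp only
        by_cases hki : k < i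
        · rw [if_pos (by omega), if_pos (by omega)]; exact h3 k (by omega)
        · by_cases hki : k = i
          · subst hki; rw [if_pos le_rfl, if_neg (by omega), he]
            convert h3 j (by omega) using 2; omega
          · rw [if_neg (by omega), if_neg (by omega)]
            convert h3 (k - i + j) (by omega) using 2; omega
      · intro k hk
        simp only
        split_ifs
        · exact h4 _ (by omega)
        · exact h4 _ (by omega)
    · refine hmin (i + 1 + (m-j)) (by omega) ⟨fun k => if k ≤ i then p k else p (k - (i+1) + j), by simpa, ?_, ?_, ?_⟩
      · simp only; rw [if_neg (by omega)]; convert h2 using 2; omega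
      · intro k hk
        simp only
        by_cases hki : k < i
        · rw [if_pos (by omega), if_pos (by omega)]; exact h3 k (by omega)
        · by_cases hki : k = i
          · subst hki; rw [if_pos le_rfl, if_neg (by omega)]
            convert ha using 2; omega
          · rw [if_neg (by omega), if_neg (by omega)]
            convert h3 (k - (i+1) + j) (by omega) using 2; omega
      · intro k hk
        simp only
        split_ifs
        · exact h4 _ (by omega)
        · exact h4 _ (by omega)
  refine ⟨p, m, ⟨h3, fun i j hij hj => ⟨fun he => short i j hij (by omega) hj (Or.inl he), fun ha => ?_⟩⟩, h4, h1, h2, ?_, ?_⟩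
  · by_contra hne
    exact short i j hij (by omega) hj (Or.inr ⟨ha, by omega⟩)
  · intro i hi hq
    exact hmin i hi ⟨p, h1, hq, fun k hk => h3 k (by omega), fun k hk => h4 k (by omega)⟩
  · intro i hi0 hi hr
    refine hmin (m - i) (by omega) ⟨fun k => p (k + i), by simpa, ?_, fun k hk => ?_, fun k hk => h4 _ (by omega)⟩
    · simp only; convert h2 using 2; omega
    · simp only; convert h3 (k + i) (by omega) using 2; omega

lemma IPf.walk {p : ℕ → V} {m : ℕ} (h : IPf G p m) : ∃ w : G.Walk (p 0) (p m), w.support.Nodup ∧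
    (∀ a, a ∈ w.support ↔ ∃ i ≤ m, a = p i) ∧ w.length = m ∧ ∀ i < m, s(p i, p (i+1)) ∈ w.edges := by
  induction m with
  | zero => exact ⟨.nil, by simp, by simp, by simp, by simp⟩
  | succ m ih =>
    obtain ⟨w, h1, h2, h3, h4⟩ := ih ⟨fun i hi => h.1 i (by omega), fun i j hij hj => h.2 i j hij (by omega)⟩
    refine ⟨w.concat (h.1 m (by omega)), ?_, ?_, by simp [h3], ?_⟩
    · rw [Walk.support_concat, List.nodup_append]
      refine ⟨h1, by simp, ?_⟩
      intro a ha b hb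
      simp only [List.mem_singleton] at hb
      subst hb
      obtain ⟨i, hi, rfl⟩ := (h2 a).1 ha
      exact (h.2 i (m+1) (by omega) le_rfl).1
    · intro a
      rw [Walk.support_concat, List.mem_append, h2, List.mem_singleton]
      constructor
      · rintro (⟨i, hi, rfl⟩ | rfl)
        · exact ⟨i, by omega, rfl⟩
        · exact ⟨m+1, le_rfl, rfl⟩
      · rintro ⟨i, hi, rfl⟩
        by_cases him : i = m+1
        · subst him; exact Or.inr rfl
        · exact Or.inl ⟨i, by omega, rfl⟩
    · intro i hi
      rw [Walk.edges_concat, List.concat_eq_append, List.mem_append]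
      by_cases him : i = m
      · subst him; right; simp
      · left; exact h4 i (by omega)

lemma IPf.adj {p : ℕ → V} {m i j : ℕ} (h : IPf G p m) (hi : i ≤ m) (hj : j ≤ m)
    (ha : G.Adj (p i) (p j)) : j = i + 1 ∨ i = j + 1 := by
  rcases lt_trichotomy i j with hl | rfl | hl
  · exact Or.inl ((h.2 i j hl hj).2 ha)
  · exact absurd ha (G.loopless.irrefl _)
  · exact Or.inr ((h.2 j i hl hi).2 ha.symm)
lemma IPf.inj {p : ℕ → V} {m i j : ℕ} (h : IPf G p m) (hi : i ≤ m) (hj : j ≤ m)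
    (ha : p i = p j) : i = j := by
  rcases lt_trichotomy i j with hl | rfl | hl
  · exact absurd ha (h.2 i j hl hj).1
  · rfl
  · exact absurd ha.symm (h.2 j i hl hi).1
lemma IPf.seg {p : ℕ → V} {m i j : ℕ} (h : IPf G p m) (hij : i ≤ j) (hj : j ≤ m) : Cn G (p '' Set.Icc i j) :=
  Cn_seg hij (fun k _ hk => h.1 k (by omega))

lemma IPf.edge {p : ℕ → V} {m i j : ℕ} (h : IPf G p m) {w : G.Walk (p 0) (p m)}
    (hw : ∀ i < m, s(p i, p (i+1)) ∈ w.edges) (hi : i ≤ m) (hj : j ≤ m)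
    (ha : G.Adj (p i) (p j)) : s(p i, p j) ∈ w.edges := by
  rcases h.adj hi hj ha with rfl | rfl
  · exact hw i (by omega)
  · rw [Sym2.eq_swap]; exact hw j (by omega)

lemma exIP (h : Cn G D) (hx : x ∈ D) (hy : y ∈ D) : ∃ w : G.Walk x y, IsIPath G w ∧ ∀ z ∈ w.support, z ∈ D := by
  obtain ⟨p, m, hp, h1, h2, h3, -, -⟩ := ipath (R := (· = x)) (Q := (· = y)) h hx rfl hy rfl
  subst h2; subst h3
  obtain ⟨w, w1, w2, w3, w4⟩ := hp.walk
  refine ⟨w, ⟨(Walk.isPath_def w).2 w1, ?_⟩, fun z hz => ?_⟩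
  · intro a ha b hb hab
    rw [Walk.mem_verts_toSubgraph] at ha hb
    obtain ⟨i, hi, rfl⟩ := (w2 a).1 ha
    obtain ⟨j, hj, rfl⟩ := (w2 b).1 hb
    rw [Walk.adj_toSubgraph_iff_mem_edges]
    exact hp.edge w4 hi hj hab
  · obtain ⟨i, hi, rfl⟩ := (w2 z).1 hz
    exact h1 i hi

def Anti (G : SimpleGraph V) (A B : Set V) : Prop := ∀ a ∈ A, ∀ b ∈ B, a ≠ b ∧ ¬ G.Adj a b
lemma Anti.symm (h : Anti G A B) : Anti G B A :=
  fun a ha b hb => ⟨(h b hb a ha).1.symm, fun h' => (h b hb a ha).2 h'.symm⟩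
lemma Anti.mono (h : Anti G A B) (h1 : C ⊆ A) (h2 : D ⊆ B) : Anti G C D :=
  fun a ha b hb => h a (h1 ha) b (h2 hb)

def Att (G : SimpleGraph V) (x : V) (D : Set V) : Prop := ∃ d ∈ D, G.Adj x d
lemma Att.mono (h : Att G x A) (h1 : A ⊆ B) : Att G x B := by
  obtain ⟨d, hd, h⟩ := h; exact ⟨d, h1 hd, h⟩

def Star (G : SimpleGraph V) : Prop := ∀ v x y, G.Adj v x → G.Adj v y → x ≠ y → ¬ G.Adj x y →
  ∀ D1 D2, Cn G D1 → Cn G D2 → Anti G D1 D2 → v ∉ D1 → v ∉ D2 → x ∉ D1 → x ∉ D2 → y ∉ D1 → y ∉ D2 →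
  Att G x D1 → Att G x D2 → Att G y D1 → Att G y D2 → False

lemma star_of_sparse (hS : Sparse G) : Star G := by
  intro v x y hvx hvy hxy hnxy D1 D2 c1 c2 hA hv1 hv2 hx1 hx2 hy1 hy2 ax1 ax2 ay1 ay2
  have hD : Cn G (insert y D1 ∪ D2) := by
    obtain ⟨d, hd, h⟩ := ay1
    obtain ⟨e, he, h'⟩ := ay2
    exact (c1.insert hd h).union c2 ⟨y, Or.inl rfl, e, he, Or.inr h'⟩
  obtain ⟨d, hd, h⟩ := ax1
  obtain ⟨e, he, h'⟩ := ax2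
  obtain ⟨p, m, hp, h1, ⟨h2, h2'⟩, ⟨h3, h3'⟩, h4, h5⟩ := ipath (R := fun a => a ∈ D1 ∧ G.Adj x a)
    (Q := fun a => a ∈ D2 ∧ G.Adj x a) hD (Or.inl (Or.inr hd)) ⟨hd, h⟩ (Or.inr he) ⟨he, h'⟩
  have hxD : ∀ i ≤ m, p i ≠ x := by
    rintro i hi rfl
    rcases h1 i hi with (h | h) | h
    · exact hxy h
    · exact hx1 h
    · exact hx2 h
  have hvD : ∀ i ≤ m, p i ≠ v := by
    rintro i hi rfl
    rcases h1 i hi with (h | h) | h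
    · exact hvy.ne h
    · exact hv1 h
    · exact hv2 h
  have hyp : ∃ i ≤ m, p i = y := by
    by_contra hc
    push Not at hc
    have : ∀ i ≤ m, p i ∈ D1 := by
      intro i
      induction i with
      | zero => exact fun _ => h2
      | succ i ih =>
        intro hi
        rcases h1 (i+1) hi with (h | h) | h
        · exact absurd h (hc _ hi)
        · exact h
        · exact absurd (hp.1 i (by omega)) (hA _ (ih (by omega)) _ h).2
    exact (hA _ (this m le_rfl) _ h3).1 rfl
  have hm0 : m ≠ 0 := by rintro rfl; exact (hA _ h2 _ h3).1 rfl
  have hm1 : m ≠ 1 := by rintro rfl; exact (hA _ h2 _ h3).2 (hp.1 0 (by omega))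
  have hxa : ∀ i ≤ m, G.Adj x (p i) → i = 0 ∨ i = m := by
    intro i hi ha
    rcases h1 i hi with (h | h) | h
    · rw [h] at ha; exact absurd ha hnxy
    · by_contra hc; push Not at hc; exact h5 i (by omega) hi ⟨h, ha⟩
    · by_contra hc; push Not at hc; exact h4 i (by omega) ⟨h, ha⟩
  obtain ⟨w, w1, w2, w3, w4⟩ := hp.walk
  obtain ⟨c, hc⟩ : ∃ c, c = Walk.cons h2' (w.concat h3'.symm) := ⟨_, rfl⟩
  have hcs : ∀ a, a ∈ c.support ↔ a = x ∨ ∃ i ≤ m, a = p i := by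
    intro a
    rw [hc, Walk.support_cons, List.mem_cons, Walk.support_concat, List.mem_append, w2, List.mem_singleton]
    constructor
    · rintro (h | h | h)
      exacts [Or.inl h, Or.inr h, Or.inl h]
    · rintro (h | h)
      exacts [Or.inl h, Or.inr (Or.inl h)]
  have hce : ∀ e, e ∈ c.edges ↔ e = s(x, p 0) ∨ e ∈ w.edges ∨ e = s(p m, x) := by
    intro e
    rw [hc, Walk.edges_cons, List.mem_cons, Walk.edges_concat, List.concat_eq_append, List.mem_append, List.mem_singleton]
  have hind : ∀ a b, a ∈ c.support → b ∈ c.support → G.Adj a b → s(a,b) ∈ c.edges := by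
    intro a b ha hb hab
    rw [hcs] at ha hb; rw [hce]
    rcases ha with rfl | ⟨i, hi, rfl⟩
    · rcases hb with rfl | ⟨j, hj, rfl⟩
      · exact absurd hab (G.loopless.irrefl _)
      · rcases hxa j hj hab with rfl | rfl
        · exact Or.inl rfl
        · exact Or.inr (Or.inr Sym2.eq_swap)
    · rcases hb with rfl | ⟨j, hj, rfl⟩
      · rcases hxa i hi hab.symm with rfl | rfl
        · exact Or.inl Sym2.eq_swap
        · exact Or.inr (Or.inr rfl)
      · exact Or.inr (Or.inl (hp.edge w4 hi hj hab))
  have hhole : IsHole G c := by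
    refine ⟨?_, ?_, ?_⟩
    · rw [hc, Walk.cons_isCycle_iff]
      constructor
      · rw [Walk.isPath_def, Walk.support_concat, List.nodup_append]
        refine ⟨w1, by simp, ?_⟩
        intro a ha b hb
        simp only [List.mem_singleton] at hb
        subst hb
        obtain ⟨i, hi, rfl⟩ := (w2 a).1 ha
        exact hxD i hi
      · rw [Walk.edges_concat, List.concat_eq_append, List.mem_append, List.mem_singleton]
        rintro (h | h)
        · obtain ⟨i, hi, h⟩ := (w2 x).1 (w.fst_mem_support_of_mem_edges h)
          exact hxD i hi h.symm
        · rw [Sym2.eq_swap, Sym2.congr_left] at h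
          exact hm0 (hp.inj (by omega) le_rfl h).symm
    · rw [hc]; simp [w3]; omega
    · intro a ha b hb hab
      rw [Walk.mem_verts_toSubgraph] at ha hb
      rw [Walk.adj_toSubgraph_iff_mem_edges]
      exact hind a b ha hb hab
  obtain ⟨a, b, hab, h6⟩ := hS x c hhole v (by
    rw [hcs]; rintro (h | ⟨i, hi, h⟩)
    · exact hvx.ne h
    · exact hvD i hi h.symm)
  have hab' : G.Adj a b := hab.adj_sub
  obtain ⟨i, hi, hiy⟩ := hyp
  have e1 := h6 x ((hcs x).2 (Or.inl rfl)) hvx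
  have e2 := h6 y ((hcs y).2 (Or.inr ⟨i, hi, hiy.symm⟩)) hvy
  rcases e1 with rfl | rfl <;> rcases e2 with rfl | rfl
  · exact hxy rfl
  · exact hnxy hab'
  · exact hnxy hab'.symm
  · exact hxy rfl

lemma no_pyr (hP : ¬ ContainsPyramid G) {a b1 b2 b3 : V} {D1 D2 D3 : Set V}
    (h12 : G.Adj b1 b2) (h23 : G.Adj b2 b3) (h13 : G.Adj b1 b3) (c1 : Cn G D1) (c2 : Cn G D2) (c3 : Cn G D3)
    (m1 : b1 ∈ D1) (m2 : b2 ∈ D2) (m3 : b3 ∈ D3) (n1 : a ∉ D1) (n2 : a ∉ D2) (n3 : a ∉ D3)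
    (a1 : Att G a D1) (a2 : Att G a D2) (a3 : Att G a D3)
    (h1 : ¬ (G.Adj a b1 ∧ G.Adj a b2)) (h2 : ¬ G.Adj a b3)
    (e12 : ∀ p ∈ D1, ∀ q ∈ D2, p ≠ q ∧ (G.Adj p q → p = b1 ∧ q = b2))
    (e13 : ∀ p ∈ D1, ∀ q ∈ D3, p ≠ q ∧ (G.Adj p q → p = b1 ∧ q = b3))
    (e23 : ∀ p ∈ D2, ∀ q ∈ D3, p ≠ q ∧ (G.Adj p q → p = b2 ∧ q = b3)) : False := by
  have key : ∀ D b, Cn G D → b ∈ D → a ∉ D → Att G a D → ∃ w : G.Walk a b, IsIPath G w ∧ 1 ≤ w.length ∧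
      (w.length = 1 → G.Adj a b) ∧ ∀ z ∈ w.support, z ≠ a → z ∈ D := by
    intro D b c m n ⟨d, hd, had⟩
    obtain ⟨w, hw, hs⟩ := exIP (c.insert hd had) (Or.inl rfl) (Or.inr m)
    refine ⟨w, hw, ?_, fun h => Walk.adj_of_length_eq_one h, fun z hz hza => (hs z hz).resolve_left hza⟩
    by_contra hl
    have : w.length = 0 := by omega
    have := Walk.eq_of_length_eq_zero this
    subst this; exact n m
  obtain ⟨w1, i1, l1, s1, k1⟩ := key D1 b1 c1 m1 n1 a1
  obtain ⟨w2, i2, l2, s2, k2⟩ := key D2 b2 c2 m2 n2 a2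
  obtain ⟨w3, i3, l3, s3, k3⟩ := key D3 b3 c3 m3 n3 a3
  exact hP ⟨a, b1, b2, b3, w1, w2, w3, h12, h23, h13, i1, i2, i3, l1, l2, l3,
    fun h => h1 ⟨s1 h.1, s2 h.2⟩, fun h => h2 (s3 h.2), fun h => h2 (s3 h.2),
    fun p hp hpa q hq hqa => e12 p (k1 p hp hpa) q (k2 q hq hqa),
    fun p hp hpa q hq hqa => e13 p (k1 p hp hpa) q (k3 q hq hqa),
    fun p hp hpa q hq hqa => e23 p (k2 p hp hpa) q (k3 q hq hqa)⟩

lemma no_prism (hP : ¬ ContainsPrism G) {a1 a2 a3 b1 b2 b3 : V} {D1 D2 D3 : Set V}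
    (g12 : G.Adj a1 a2) (g23 : G.Adj a2 a3) (g13 : G.Adj a1 a3)
    (h12 : G.Adj b1 b2) (h23 : G.Adj b2 b3) (h13 : G.Adj b1 b3) (c1 : Cn G D1) (c2 : Cn G D2) (c3 : Cn G D3)
    (m1 : b1 ∈ D1) (m2 : b2 ∈ D2) (m3 : b3 ∈ D3) (n1 : a1 ∈ D1) (n2 : a2 ∈ D2) (n3 : a3 ∈ D3)
    (d1 : a1 ≠ b1) (d2 : a2 ≠ b2) (d3 : a3 ≠ b3)
    (e12 : ∀ p ∈ D1, ∀ q ∈ D2, p ≠ q ∧ (G.Adj p q → (p = a1 ∧ q = a2) ∨ (p = b1 ∧ q = b2)))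
    (e13 : ∀ p ∈ D1, ∀ q ∈ D3, p ≠ q ∧ (G.Adj p q → (p = a1 ∧ q = a3) ∨ (p = b1 ∧ q = b3)))
    (e23 : ∀ p ∈ D2, ∀ q ∈ D3, p ≠ q ∧ (G.Adj p q → (p = a2 ∧ q = a3) ∨ (p = b2 ∧ q = b3))) : False := by
  have key : ∀ D a b, Cn G D → b ∈ D → a ∈ D → a ≠ b → ∃ w : G.Walk a b, IsIPath G w ∧ 1 ≤ w.length ∧
      ∀ z ∈ w.support, z ∈ D := by
    intro D a b c m n hab
    obtain ⟨w, hw, hs⟩ := exIP c n m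
    refine ⟨w, hw, ?_, hs⟩
    by_contra hl
    have : w.length = 0 := by omega
    exact hab (Walk.eq_of_length_eq_zero this)
  obtain ⟨w1, i1, l1, k1⟩ := key D1 a1 b1 c1 m1 n1 d1
  obtain ⟨w2, i2, l2, k2⟩ := key D2 a2 b2 c2 m2 n2 d2
  obtain ⟨w3, i3, l3, k3⟩ := key D3 a3 b3 c3 m3 n3 d3
  exact hP ⟨a1, a2, a3, b1, b2, b3, w1, w2, w3, g12, g23, g13, h12, h23, h13, i1, i2, i3, l1, l2, l3,
    fun p hp q hq => e12 p (k1 p hp) q (k2 q hq),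
    fun p hp q hq => e13 p (k1 p hp) q (k3 q hq),
    fun p hp q hq => e23 p (k2 p hp) q (k3 q hq)⟩
end Paper

namespace Paper
variable {V : Type} {G G' : SimpleGraph V} {A B C D P S X Z : Set V} {x y z : V}

lemma nsc (h : ¬ HasStarCutset G) {v : V} (hA : A.Nonempty) (hB : B.Nonempty) (hd : Anti G A B)
    (h1 : v ∉ A) (h2 : v ∉ B) (hc : ∀ x, x ∉ A → x ∉ B → x = v ∨ G.Adj v x) : False := by
  refine h ⟨A, (A ∪ B)ᶜ, B, ⟨?_, ?_, ?_, ?_, fun a ha b hb => (hd a ha b hb).2⟩, hA, hB, v, by simp [h1, h2], ?_⟩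
  · ext x; simp; tauto
  · rw [Set.disjoint_left]; intro x h1 h2; exact h2 (Or.inl h1)
  · rw [Set.disjoint_left]; intro x h1 h2; exact (hd x h1 x h2).1 rfl
  · rw [Set.disjoint_left]; intro x h1 h2; exact h1 (Or.inr h2)
  · intro x hx
    simp only [mem_compl_iff, mem_union, not_or] at hx
    exact hc x hx.1 hx.2

def Ev (G : SimpleGraph V) (v : V) : Set V := {x | x ≠ v ∧ ¬ G.Adj v x}

section
variable (hsc : ¬ HasStarCutset G) (hnc : ∃ x y, x ≠ y ∧ ¬ G.Adj x y)
include hsc hnc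
lemma Ev_ne (v : V) : (Ev G v).Nonempty := by
  by_contra hne
  have hall : ∀ x, x ≠ v → G.Adj v x := by
    intro x hx
    by_contra h
    exact hne ⟨x, hx, h⟩
  obtain ⟨x, y, hxy, hn⟩ := hnc
  have hx : v ≠ x := by rintro rfl; exact hn (hall y hxy.symm)
  have hy : v ≠ y := by rintro rfl; exact hn (hall x hxy).symm
  refine nsc hsc (A := {x}) (B := {y}) (v := v) (by simp) (by simp) ?_ hx hy ?_
  · rintro a rfl b rfl; exact ⟨hxy, hn⟩
  · intro z _ _; by_cases h : z = v
    · exact Or.inl h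
    · exact Or.inr (hall z h)
lemma Ev_cn (v : V) : Cn G (Ev G v) := by
  obtain ⟨x, hx⟩ := Ev_ne hsc hnc v
  refine Cn_of_cut hx fun P hP hxP hcl => ?_
  by_contra hn
  obtain ⟨y, hy, hyP⟩ := Set.not_subset.1 hn
  refine nsc hsc (A := P) (B := Ev G v \ P) (v := v) ⟨x, hxP⟩ ⟨y, hy, hyP⟩ ?_ (fun h => (hP h).1 rfl) (fun h => h.1.1 rfl) ?_
  · exact fun a ha b hb => ⟨fun h => hb.2 (h ▸ ha), fun h => hb.2 (hcl a ha b hb.1 h)⟩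
  · intro z h1 h2
    by_contra hc
    push Not at hc
    exact h2 ⟨hc, h1⟩
lemma Ev_att {v w : V} (h : G.Adj v w) : Att G w (Ev G v) := by
  by_contra hn
  refine nsc hsc (A := {w}) (B := Ev G v) (v := v) (by simp) (Ev_ne hsc hnc v) ?_ (by simpa using h.ne) (fun h => h.1 rfl) ?_
  · rintro a rfl b hb
    refine ⟨?_, fun h' => hn ⟨b, hb, h'⟩⟩
    rintro rfl; exact hb.2 h
  · intro z h1 h2
    by_contra hc
    push Not at hc
    exact h2 hc
end

lemma Cn_pre {q : ℕ → V} {M j : ℕ} {v : V} (hq : IPf G q M) (hj : j ≤ M + 1) (hv : G.Adj v (q 0)) :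
    Cn G (insert v (q '' Set.Iio j)) := by
  rcases Nat.eq_zero_or_pos j with rfl | h
  · convert Cn_single (G := G) (x := v); simp
  · have := (hq.seg (i := 0) (j := j-1) (by omega) (by omega)).insert (x := v) (y := q 0) ⟨0, by simp, rfl⟩ hv
    convert this using 3
    ext k; simp; omega

lemma no_tri3 (hS : Star G) (hP : ¬ ContainsPyramid G) (hR : ¬ ContainsPrism G)
    (hsc : ¬ HasStarCutset G) {v a a' b : V} (hva : G.Adj v a) (hva' : G.Adj v a') (haa : G.Adj a a')
    (hvb : G.Adj v b) (hba : ¬ G.Adj a b) (hba' : ¬ G.Adj a' b) (nba : b ≠ a) (nba' : b ≠ a') : False := by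
  have hnc : ∃ x y, x ≠ y ∧ ¬ G.Adj x y := ⟨a, b, nba.symm, hba⟩
  have hD : Cn G (insert a (insert b (Ev G v))) := by
    obtain ⟨d, hd, h⟩ := Ev_att hsc hnc hvb
    obtain ⟨e, he, h'⟩ := Ev_att hsc hnc hva
    exact ((Ev_cn hsc hnc v).insert hd h).insert (Or.inr he) h'
  obtain ⟨q, M, hq, q1, q2, q3, q4, q5⟩ := ipath (R := (· = b)) (Q := (· = a)) hD (Or.inr (Or.inl rfl)) rfl (Or.inl rfl) rfl
  have hqE : ∀ i, 0 < i → i < M → q i ∈ Ev G v := fun i h h' =>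
    ((q1 i h'.le).resolve_left (q4 i h')).resolve_left (q5 i h h'.le)
  have hM0 : M ≠ 0 := by rintro rfl; exact nba (q2.symm.trans q3)
  have hM1 : M ≠ 1 := by
    rintro rfl; have := hq.1 0 (by omega); rw [q2, q3] at this; exact hba this.symm
  have hqv : ∀ i ≤ M, q i ≠ v := by
    intro i hi
    by_cases h0 : i = 0
    · rw [h0, q2]; exact hvb.ne'
    by_cases h1 : i = M
    · rw [h1, q3]; exact hva.ne'
    exact (hqE i (by omega) (by omega)).1
  have hvq : ∀ i ≤ M, G.Adj v (q i) → i = 0 ∨ i = M := by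
    intro i hi h
    by_contra hc; push Not at hc
    exact (hqE i (by omega) (by omega)).2 h
  have hqa' : ∀ i ≤ M, q i ≠ a' := by
    intro i hi
    by_cases h0 : i = 0
    · rw [h0, q2]; exact nba'
    by_cases h1 : i = M
    · rw [h1, q3]; exact haa.ne
    intro h; have := (hqE i (by omega) (by omega)).2; rw [h] at this; exact this hva'
  have hq0 : G.Adj v (q 0) := by rw [q2]; exact hvb
  have hqM : G.Adj v (q M) := by rw [q3]; exact hva
  have ha'q : ∀ i < M, ¬ G.Adj a' (q i) := by
    intro i hi h
    by_cases h0 : i = 0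
    · rw [h0, q2] at h; exact hba' h
    refine hS a' v (q i) hva'.symm h (hqv i hi.le).symm (hqE i (by omega) hi).2 (q '' Set.Icc 0 (i-1)) (q '' Set.Icc (i+1) M)
      (hq.seg (by omega) (by omega)) (hq.seg (by omega) (by omega)) ?_ ?_ ?_ ?_ ?_ ?_ ?_ ⟨q 0, ⟨0, by simp, rfl⟩, hq0⟩
      ⟨q M, ⟨M, by simp; omega, rfl⟩, hqM⟩ ⟨q (i-1), ⟨i-1, by simp, rfl⟩, ?_⟩ ⟨q (i+1), ⟨i+1, by simp; omega, rfl⟩, hq.1 i hi⟩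
    · rintro _ ⟨k, hk, rfl⟩ _ ⟨k', hk', rfl⟩
      simp only [Set.mem_Icc] at hk hk'
      exact ⟨fun h => by have := hq.inj (by omega) (by omega) h; omega, fun h => by have := hq.adj (by omega) (by omega) h; omega⟩
    · rintro ⟨k, hk, h⟩; simp only [Set.mem_Icc] at hk; exact hqa' k (by omega) h
    · rintro ⟨k, hk, h⟩; simp only [Set.mem_Icc] at hk; exact hqa' k (by omega) h
    · rintro ⟨k, hk, h⟩; simp only [Set.mem_Icc] at hk; exact hqv k (by omega) h
    · rintro ⟨k, hk, h⟩; simp only [Set.mem_Icc] at hk; exact hqv k (by omega) h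
    · rintro ⟨k, hk, h⟩; simp only [Set.mem_Icc] at hk; have := hq.inj (by omega) (by omega) h; omega
    · rintro ⟨k, hk, h⟩; simp only [Set.mem_Icc] at hk; have := hq.inj (by omega) (by omega) h; omega
    · have := hq.1 (i-1) (by omega); rw [show i-1+1 = i by omega] at this; exact this.symm
  have hD2 : Cn G (insert a' (Ev G a)) := by
    obtain ⟨d, hd, h⟩ := Ev_att hsc hnc haa
    exact (Ev_cn hsc hnc a).insert hd h
  obtain ⟨s, l, hs, s1, s2, ⟨s3, s3'⟩, s4, s5⟩ := ipath (R := (· = a'))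
    (Q := fun z => z ∈ Ev G a ∧ ∃ i < M, z = q i ∨ G.Adj z (q i)) (y := b) hD2 (Or.inl rfl) rfl (Or.inr ⟨nba, hba⟩)
    ⟨⟨nba, hba⟩, 0, by omega, Or.inl q2.symm⟩
  have hsE : ∀ i, 0 < i → i ≤ l → s i ∈ Ev G a := fun i h h' => (s1 i h').resolve_left (s5 i h h')
  have hl0 : l ≠ 0 := by rintro rfl; rw [s2] at s3; exact s3.2 haa
  have hsv : ∀ i ≤ l, s i ≠ v := by
    intro i hi
    by_cases h0 : i = 0
    · rw [h0, s2]; exact hva'.ne'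
    intro h; have := (hsE i (by omega) hi).2; rw [h] at this; exact this hva.symm
  have hsq1 : ∀ i < l, ∀ j < M, ¬ G.Adj (s i) (q j) := by
    intro i hi j hj h
    by_cases h0 : i = 0
    · rw [h0, s2] at h; exact ha'q j hj h
    exact s4 i hi ⟨hsE i (by omega) hi.le, j, hj, Or.inr h⟩
  have hsqne : ∀ i ≤ l, ∀ j ≤ M, s i ≠ q j := by
    intro i hi j hj h
    by_cases h0 : i = 0
    · rw [h0, s2] at h; exact hqa' j hj h.symm
    by_cases hjM : j = M
    · rw [hjM, q3] at h; exact (hsE i (by omega) hi).1 h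
    by_cases hil : i = l
    · refine hsq1 (l-1) (by omega) j (by omega) ?_
      rw [← h, hil]; have := hs.1 (l-1) (by omega); rw [show l-1+1 = l by omega] at this; exact this
    exact s4 i (by omega) ⟨hsE i (by omega) hi, j, by omega, Or.inl h⟩
  have hsq : ∀ i ≤ l, ∀ j ≤ M, G.Adj (s i) (q j) → (i = 0 ∧ j = M) ∨ (i = l ∧ j < M) := by
    intro i hi j hj h
    by_cases hjM : j = M
    · left; refine ⟨?_, hjM⟩
      by_contra h0
      rw [hjM, q3] at h; exact (hsE i (by omega) hi).2 h.symm
    · right; refine ⟨?_, by omega⟩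
      by_contra h0; exact hsq1 i (by omega) j (by omega) h
  obtain ⟨j, hj, hsj⟩ : ∃ j < M, G.Adj (s l) (q j) := by
    obtain ⟨j, hj, h⟩ := s3'
    exact ⟨j, hj, h.resolve_left (hsqne l le_rfl j hj.le)⟩
  have hsvadj : ∀ e ≤ l, G.Adj v (s e) → e = 0 := by
    intro e he hve
    by_contra h0
    refine hS v (q M) (s e) hqM hve (hsqne e he M le_rfl).symm ?_ (s '' Set.Icc 0 (e-1)) (s '' Set.Ioc e l ∪ q '' Set.Icc j (M-1))
      (hs.seg (by omega) (by omega)) ?_ ?_ ?_ ?_ ?_ ?_ ?_ ?_ ⟨a', ⟨0, by simp, s2⟩, by rw [q3]; exact haa⟩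
      ⟨q (M-1), Or.inr ⟨M-1, by simp; omega, rfl⟩, ?_⟩ ⟨s (e-1), ⟨e-1, by simp, rfl⟩, ?_⟩ ?_
    · rw [q3]; exact (hsE e (by omega) he).2
    · by_cases hel : e = l
      · subst hel; simpa using hq.seg (i := j) (j := M-1) (by omega) (by omega)
      · refine Cn.union ?_ (hq.seg (by omega) (by omega)) ⟨s l, ⟨l, by simp; omega, rfl⟩, q j, ⟨j, by simp; omega, rfl⟩, Or.inr hsj⟩
        convert hs.seg (i := e+1) (j := l) (by omega) (by omega) using 2
        ext k; simp
    · rintro _ ⟨k, hk, rfl⟩ _ (⟨k', hk', rfl⟩ | ⟨k', hk', rfl⟩)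
      · simp only [Set.mem_Icc, Set.mem_Ioc] at hk hk'
        exact ⟨fun h => by have := hs.inj (by omega) (by omega) h; omega, fun h => by have := hs.adj (by omega) (by omega) h; omega⟩
      · simp only [Set.mem_Icc] at hk hk'
        exact ⟨hsqne _ (by omega) _ (by omega), hsq1 _ (by omega) _ (by omega)⟩
    · rintro ⟨k, hk, h⟩; simp only [Set.mem_Icc] at hk; exact hsv k (by omega) h
    · rintro (⟨k, hk, h⟩ | ⟨k, hk, h⟩)
      · simp only [Set.mem_Ioc] at hk; exact hsv k (by omega) h
      · simp only [Set.mem_Icc] at hk; exact hqv k (by omega) h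
    · rintro ⟨k, hk, h⟩; simp only [Set.mem_Icc] at hk; exact hsqne k (by omega) _ le_rfl h
    · rintro (⟨k, hk, h⟩ | ⟨k, hk, h⟩)
      · simp only [Set.mem_Ioc] at hk; exact hsqne k (by omega) _ le_rfl h
      · simp only [Set.mem_Icc] at hk; have := hq.inj (by omega) (by omega) h; omega
    · rintro ⟨k, hk, h⟩; simp only [Set.mem_Icc] at hk; have := hs.inj (by omega) (by omega) h; omega
    · rintro (⟨k, hk, h⟩ | ⟨k, hk, h⟩)
      · simp only [Set.mem_Ioc] at hk; have := hs.inj (by omega) (by omega) h; omega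
      · simp only [Set.mem_Icc] at hk; exact hsqne _ he _ (by omega) h.symm
    · have := hq.1 (M-1) (by omega); rw [show M-1+1 = M by omega] at this; exact this.symm
    · have := hs.1 (e-1) (by omega); rw [show e-1+1 = e by omega] at this; exact this.symm
    · by_cases hel : e = l
      · subst hel; exact ⟨q j, Or.inr ⟨j, by simp; omega, rfl⟩, hsj⟩
      · exact ⟨s (e+1), Or.inl ⟨e+1, by simp; omega, rfl⟩, hs.1 e (by omega)⟩
  have cons : ∀ i j, i < j → j < M → G.Adj (s l) (q i) → G.Adj (s l) (q j) → j = i+1 := by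
    intro i j hij hjM hi hj
    by_contra hne
    refine hS (s l) (q i) (q j) hi hj (fun h => by have := hq.inj (by omega) (by omega) h; omega)
      (fun h => by have := hq.adj (by omega) (by omega) h; omega) (q '' Set.Icc (i+1) (j-1))
      (insert v (q '' Set.Iio i) ∪ q '' Set.Icc (j+1) M) (hq.seg (by omega) (by omega)) ?_ ?_ ?_ ?_ ?_ ?_ ?_ ?_
      ⟨q (i+1), ⟨i+1, by simp; omega, rfl⟩, hq.1 i (by omega)⟩ ?_ ⟨q (j-1), ⟨j-1, by simp; omega, rfl⟩, ?_⟩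
      ⟨q (j+1), Or.inr ⟨j+1, by simp; omega, rfl⟩, hq.1 j hjM⟩
    · exact (Cn_pre hq (by omega) hq0).union (hq.seg (by omega) le_rfl) ⟨v, Or.inl rfl, q M, ⟨M, by simp; omega, rfl⟩, Or.inr hqM⟩
    · rintro _ ⟨k, hk, rfl⟩ _ ((rfl | ⟨k', hk', rfl⟩) | ⟨k', hk', rfl⟩)
      · simp only [Set.mem_Icc] at hk
        exact ⟨hqv k (by omega), fun h => by have := hvq k (by omega) h.symm; omega⟩
      all_goals
        simp only [Set.mem_Icc, Set.mem_Iio] at hk hk'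
        exact ⟨fun h => by have := hq.inj (by omega) (by omega) h; omega, fun h => by have := hq.adj (by omega) (by omega) h; omega⟩
    · rintro ⟨k, hk, h⟩; simp only [Set.mem_Icc] at hk; exact hsqne l le_rfl k (by omega) h.symm
    · rintro ((h | ⟨k, hk, h⟩) | ⟨k, hk, h⟩)
      · exact hsv l le_rfl h
      all_goals simp only [Set.mem_Icc, Set.mem_Iio] at hk; exact hsqne l le_rfl k (by omega) h.symm
    · rintro ⟨k, hk, h⟩; simp only [Set.mem_Icc] at hk; have := hq.inj (by omega) (by omega) h; omega
    · rintro ((h | ⟨k, hk, h⟩) | ⟨k, hk, h⟩)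
      · exact hqv i (by omega) h
      all_goals simp only [Set.mem_Icc, Set.mem_Iio] at hk; have := hq.inj (by omega) (by omega) h; omega
    · rintro ⟨k, hk, h⟩; simp only [Set.mem_Icc] at hk; have := hq.inj (by omega) (by omega) h; omega
    · rintro ((h | ⟨k, hk, h⟩) | ⟨k, hk, h⟩)
      · exact hqv j (by omega) h
      all_goals simp only [Set.mem_Icc, Set.mem_Iio] at hk; have := hq.inj (by omega) (by omega) h; omega
    · by_cases h0 : i = 0
      · subst h0; exact ⟨v, Or.inl (Or.inl rfl), hq0.symm⟩
      · refine ⟨q (i-1), Or.inl (Or.inr ⟨i-1, by simp; omega, rfl⟩), ?_⟩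
        have := hq.1 (i-1) (by omega); rw [show i-1+1 = i by omega] at this; exact this.symm
    · have := hq.1 (j-1) (by omega); rw [show j-1+1 = j by omega] at this; exact this.symm
  by_cases huniq : ∃ i j, i < j ∧ j < M ∧ G.Adj (s l) (q i) ∧ G.Adj (s l) (q j)
  · obtain ⟨i, j, hij, hjM, hi, hj⟩ := huniq
    have := cons i j hij hjM hi hj
    subst this
    have huse : ∀ k < M, G.Adj (s l) (q k) → k = i ∨ k = i+1 := by
      intro k hk hadj
      rcases lt_trichotomy k i with h | h | h
      · have := cons k i h (by omega) hadj hi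
        have := cons k (i+1) (by omega) (by omega) hadj hj
        omega
      · exact Or.inl h
      · exact Or.inr (cons i k h hk hi hadj)
    refine no_prism hR (a1 := v) (a2 := a) (a3 := a') (b1 := q i) (b2 := q (i+1)) (b3 := s l)
      (D1 := insert v (q '' Set.Iio (i+1))) (D2 := q '' Set.Icc (i+1) M) (D3 := s '' Set.Icc 0 l)
      hva haa hva' (hq.1 i (by omega)) hj.symm hi.symm (Cn_pre hq (by omega) hq0) (hq.seg (by omega) le_rfl) (hs.seg (by omega) le_rfl)
      (Or.inr ⟨i, by simp, rfl⟩) ⟨i+1, by simp; omega, rfl⟩ ⟨l, by simp, rfl⟩ (Or.inl rfl) ⟨M, by simp; omega, q3⟩ ⟨0, by simp, s2⟩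
      (hqv i (by omega)).symm (Ne.symm (q4 _ hjM)) (Ne.symm (s5 l (by omega) le_rfl)) ?_ ?_ ?_
    · rintro _ (rfl | ⟨k, hk, rfl⟩) _ ⟨k', hk', rfl⟩
      · simp only [Set.mem_Icc] at hk'
        refine ⟨(hqv k' (by omega)).symm, fun h => Or.inl ⟨rfl, ?_⟩⟩
        rcases hvq k' (by omega) h with h | h
        · omega
        · rw [h, q3]
      · simp only [Set.mem_Icc, Set.mem_Iio] at hk hk'
        refine ⟨fun h => by have := hq.inj (by omega) (by omega) h; omega, fun h => Or.inr ?_⟩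
        have := hq.adj (by omega) (by omega) h
        have h1 : k = i := by omega
        have h2 : k' = i+1 := by omega
        rw [h1, h2]; exact ⟨rfl, rfl⟩
    · rintro _ (rfl | ⟨k, hk, rfl⟩) _ ⟨k', hk', rfl⟩
      · simp only [Set.mem_Icc] at hk'
        refine ⟨(hsv k' (by omega)).symm, fun h => Or.inl ⟨rfl, ?_⟩⟩
        rw [hsvadj k' (by omega) h, s2]
      · simp only [Set.mem_Icc, Set.mem_Iio] at hk hk'
        refine ⟨(hsqne k' (by omega) k (by omega)).symm, fun h => Or.inr ?_⟩
        rcases hsq k' (by omega) k (by omega) h.symm with ⟨h1, h2⟩ | ⟨h1, h2⟩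
        · omega
        · subst h1
          have := huse k h2 h.symm
          have h1 : k = i := by omega
          rw [h1]; exact ⟨rfl, rfl⟩
    · rintro _ ⟨k, hk, rfl⟩ _ ⟨k', hk', rfl⟩
      simp only [Set.mem_Icc] at hk hk'
      refine ⟨(hsqne k' (by omega) k (by omega)).symm, fun h => ?_⟩
      rcases hsq k' (by omega) k (by omega) h.symm with ⟨h1, h2⟩ | ⟨h1, h2⟩
      · left; rw [h1, h2]; exact ⟨q3, s2⟩
      · right; subst h1
        have := huse k h2 h.symm
        have h1 : k = i+1 := by omega
        rw [h1]; exact ⟨rfl, rfl⟩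
  · have huse : ∀ k < M, G.Adj (s l) (q k) → k = j := by
      intro k hk hadj
      rcases lt_trichotomy k j with h | h | h
      · exact absurd ⟨k, j, h, hj, hadj, hsj⟩ huniq
      · exact h
      · exact absurd ⟨j, k, h, hk, hsj, hadj⟩ huniq
    refine no_pyr hP (a := q j) (b1 := v) (b2 := a) (b3 := a')
      (D1 := insert v (q '' Set.Iio j)) (D2 := q '' Set.Icc (j+1) M) (D3 := s '' Set.Icc 0 l)
      hva haa hva' (Cn_pre hq (by omega) hq0) (hq.seg (by omega) le_rfl) (hs.seg (by omega) le_rfl)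
      (Or.inl rfl) ⟨M, by simp; omega, q3⟩ ⟨0, by simp, s2⟩ ?_ ?_ ?_ ?_
      ⟨q (j+1), ⟨j+1, by simp; omega, rfl⟩, hq.1 j hj⟩ ⟨s l, ⟨l, by simp, rfl⟩, hsj.symm⟩ ?_
      (fun h => ha'q j hj h.symm) ?_ ?_ ?_
    · rintro (h | ⟨k, hk, h⟩)
      · exact hqv j (by omega) h
      · simp only [Set.mem_Iio] at hk; have := hq.inj (by omega) (by omega) h; omega
    · rintro ⟨k, hk, h⟩; simp only [Set.mem_Icc] at hk; have := hq.inj (by omega) (by omega) h; omega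
    · rintro ⟨k, hk, h⟩; simp only [Set.mem_Icc] at hk; exact hsqne k (by omega) j (by omega) h
    · by_cases h0 : j = 0
      · subst h0; exact ⟨v, Or.inl rfl, hq0.symm⟩
      · refine ⟨q (j-1), Or.inr ⟨j-1, by simp; omega, rfl⟩, ?_⟩
        have := hq.1 (j-1) (by omega); rw [show j-1+1 = j by omega] at this; exact this.symm
    · rintro ⟨h1, h2⟩
      have := hvq j (by omega) h1.symm
      rw [← q3] at h2
      have := hq.adj (by omega) le_rfl h2
      omega
    · rintro _ (rfl | ⟨k, hk, rfl⟩) _ ⟨k', hk', rfl⟩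
      · simp only [Set.mem_Icc] at hk'
        refine ⟨(hqv k' (by omega)).symm, fun h => ⟨rfl, ?_⟩⟩
        rcases hvq k' (by omega) h with h | h
        · omega
        · rw [h, q3]
      · simp only [Set.mem_Icc, Set.mem_Iio] at hk hk'
        exact ⟨fun h => by have := hq.inj (by omega) (by omega) h; omega, fun h => by have := hq.adj (by omega) (by omega) h; omega⟩
    · rintro _ (rfl | ⟨k, hk, rfl⟩) _ ⟨k', hk', rfl⟩
      · simp only [Set.mem_Icc] at hk'
        refine ⟨(hsv k' (by omega)).symm, fun h => ⟨rfl, ?_⟩⟩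
        rw [hsvadj k' (by omega) h, s2]
      · simp only [Set.mem_Icc, Set.mem_Iio] at hk hk'
        refine ⟨(hsqne k' (by omega) k (by omega)).symm, fun h => ?_⟩
        rcases hsq k' (by omega) k (by omega) h.symm with ⟨h1, h2⟩ | ⟨h1, h2⟩
        · omega
        · subst h1
          have := huse k h2 h.symm
          omega
    · rintro _ ⟨k, hk, rfl⟩ _ ⟨k', hk', rfl⟩
      simp only [Set.mem_Icc] at hk hk'
      refine ⟨(hsqne k' (by omega) k (by omega)).symm, fun h => ?_⟩
      rcases hsq k' (by omega) k (by omega) h.symm with ⟨h1, h2⟩ | ⟨h1, h2⟩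
      · rw [h1, h2]; exact ⟨q3, s2⟩
      · subst h1
        have := huse k h2 h.symm
        omega

theorem tri_free (hV : VerySparse G) (hsc : ¬ HasStarCutset G) (hnc : ∃ x y, x ≠ y ∧ ¬ G.Adj x y)
    {v a a' : V} (h1 : G.Adj v a) (h2 : G.Adj v a') (h3 : G.Adj a a') : False := by
  have hS := star_of_sparse hV.1
  have diam : ∀ x y w, G.Adj v x → G.Adj v y → G.Adj v w → G.Adj w x → G.Adj w y → x ≠ y → G.Adj x y := by
    intro x y w hx hy hw hwx hwy hne
    by_contra hn
    have hnv : ∀ z, G.Adj v z → z ∉ Ev G v := fun z hz h => h.2 hz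
    refine hS w x y hwx hwy hne hn {v} (Ev G v) Cn_single (Ev_cn hsc hnc v) ?_ (by simpa using hw.ne') (hnv w hw)
      (by simpa using hx.ne') (hnv x hx) (by simpa using hy.ne') (hnv y hy) ⟨v, rfl, hx.symm⟩
      (Ev_att hsc hnc hx) ⟨v, rfl, hy.symm⟩ (Ev_att hsc hnc hy)
    rintro _ rfl z hz
    exact ⟨hz.1.symm, hz.2⟩
  by_cases hb : ∃ b, G.Adj v b ∧ ¬ G.Adj a b ∧ b ≠ a
  · obtain ⟨b, hb1, hb2, hb3⟩ := hb
    refine no_tri3 hS hV.2.1 hV.2.2 hsc h1 h2 h3 hb1 hb2 (fun h => hb2 ?_) hb3 ?_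
    · exact diam a b a' h1 hb1 h2 h3.symm h hb3.symm
    · rintro rfl; exact hb2 h3
  · push Not at hb
    refine nsc hsc (A := {v}) (B := Ev G v) (v := a) (by simp) (Ev_ne hsc hnc v) ?_ (by simpa using h1.ne') (fun h => h.2 h1) ?_
    · rintro _ rfl z hz
      exact ⟨hz.1.symm, hz.2⟩
    · intro x hx1 hx2
      by_contra hc
      push Not at hc
      by_cases hvx : G.Adj v x
      · exact hc.1 (hb x hvx hc.2)
      · exact hx2 ⟨hx1, hvx⟩
end Paper

namespace Paper
variable {V : Type} {G G' : SimpleGraph V} {A B C D P S X Z U K L : Set V} {x y z v w a u k0 k1 : V} {𝓑 : Set (Set V)} {k : ℕ}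

def Bm (G : SimpleGraph V) (U : Set V) (k : ℕ) (𝓑 : Set (Set V)) : Prop :=
  (∀ X ∈ 𝓑, X ⊆ U ∧ Cn G X) ∧ (∀ X ∈ 𝓑, ∀ Y ∈ 𝓑, Tch G X Y) ∧
    ∀ S : Set V, S.ncard < k → ∃ X ∈ 𝓑, Disjoint X S

def Crit (G : SimpleGraph V) (U : Set V) (k : ℕ) (𝓑 : Set (Set V)) : Prop :=
  Bm G U k 𝓑 ∧ ∀ U' ⊂ U, ¬ Br G U' k

lemma exists_crit [Finite V] (h : Br G Set.univ k) : ∃ U 𝓑, Crit G U k 𝓑 := by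
  obtain ⟨U, ⟨𝓑, h1⟩, h2⟩ := (toFinite {U | Br G U k}).exists_minimal ⟨_, h⟩
  exact ⟨U, 𝓑, h1, fun U' hU' h' => hU'.2 (h2 h' hU'.1)⟩

lemma Bm.miss (hB : Bm G U k 𝓑) (hA : ∀ y ∈ A, ∀ z ∈ U, G.Adj y z → z ∈ A ∨ z ∈ C)
    {X0 : Set V} (hX0 : X0 ∈ 𝓑) (h0 : Anti G A X0) (hX : X ∈ 𝓑) (hy : y ∈ X) (hyA : y ∈ A) : ∃ c ∈ X, c ∈ C := by
  by_contra hc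
  push Not at hc
  have hs : X ⊆ A := fun z hz => ((hB.1 X hX).2.2 y hy z hz).ind hyA (fun a ha haX b hb hab =>
    (hA a ha b ((hB.1 X hX).1 hb) hab).resolve_right (hc b hb))
  obtain ⟨x, hx, z, hz, h⟩ := hB.2.1 X hX X0 hX0
  exact h.elim (h0 x (hs hx) z hz).1 (h0 x (hs hx) z hz).2

lemma Crit.red [Finite V] (hc : Crit G U k 𝓑) (hAU : A ⊆ U)
    (hA : ∀ y ∈ A, ∀ z ∈ U, G.Adj y z → z ∈ A ∨ z ∈ ({v, k0, k1} : Set V))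
    (hvA : ∀ c ∈ ({v, k0, k1} : Set V), c ∉ A) {X0 : Set V} (hX0 : X0 ∈ 𝓑) (h0 : Anti G A X0)
    (hDA : D ⊆ A) (hD : D = ∅ ∨ Cn G D ∧ Att G v D) (hk0 : v = k0 ∨ G.Adj v k0 ∨ Att G k0 D)
    (hk1 : v = k1 ∨ G.Adj v k1 ∨ Att G k1 D) (hkk : k0 = k1 ∨ G.Adj k0 k1) : A ⊆ D := by
  classical
  obtain ⟨hB, hcr⟩ := hc
  have hne : Att G k0 D ∨ Att G k1 D → Cn G D ∧ Att G v D := by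
    rintro (⟨d, hd, _⟩ | ⟨d, hd, _⟩) <;> exact hD.resolve_left (fun h => by simp [h] at hd)
  have tmp : Br G (U \ (A \ D)) k := by
    obtain ⟨f, hf⟩ : ∃ f : Set V → Set V, ∀ X, f X = X \ A ∪ {y | y ∈ D ∧ v ∈ X} := ⟨_, fun _ => rfl⟩
    have hf1 : ∀ {X x}, x ∈ X → x ∉ A → x ∈ f X := fun h h' => by rw [hf]; exact Or.inl ⟨h, h'⟩
    have hf2 : ∀ {X}, v ∈ X → D ⊆ f X := fun h y h' => by rw [hf]; exact Or.inr ⟨h', h⟩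
    have hc0 : ∀ {c}, c ∈ ({v, k0, k1} : Set V) → c = v ∨ c = k0 ∨ c = k1 := fun h => by simpa using h
    have hm := fun {X y} => hB.miss hA hX0 h0 (X := X) (y := y)
    have vk : ∀ {X c}, v ∈ X → c ∈ X → c ∈ ({v, k0, k1} : Set V) → Rch G (f X) v c := by
      intro X c hv hcX hcC
      have hvf := hf1 hv (hvA v (by simp))
      have hcf := hf1 hcX (hvA c hcC)
      have att : (Cn G D ∧ Att G v D) → Att G c D → Rch G (f X) v c := by
        rintro ⟨h1, d, hd, h2⟩ ⟨e, he, h3⟩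
        exact (Rch.adj h2 hvf (hf2 hv hd)).trans (((h1.2 d hd e he).mono (hf2 hv)).trans (Rch.adj h3.symm (hf2 hv he) hcf))
      rcases hc0 hcC with rfl | rfl | rfl
      · exact .refl
      · rcases hk0 with rfl | h | h
        · exact .refl
        · exact Rch.adj h hvf hcf
        · exact att (hne (Or.inl h)) h
      · rcases hk1 with rfl | h | h
        · exact .refl
        · exact Rch.adj h hvf hcf
        · exact att (hne (Or.inr h)) h
    have cc : ∀ {X c c'}, c ∈ X → c' ∈ X → c ∈ ({v, k0, k1} : Set V) → c' ∈ ({v, k0, k1} : Set V) →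
        Rch G (f X) c c' := by
      intro X c c' h1 h2 h3 h4
      by_cases hv : v ∈ X
      · exact (vk hv h1 h3).symm.trans (vk hv h2 h4)
      · have e1 := (hc0 h3).resolve_left (fun h => hv (h ▸ h1))
        have e2 := (hc0 h4).resolve_left (fun h => hv (h ▸ h2))
        have g1 := hf1 h1 (hvA _ h3)
        have g2 := hf1 h2 (hvA _ h4)
        rcases e1 with rfl | rfl <;> rcases e2 with rfl | rfl
        · exact .refl
        · rcases hkk with rfl | h
          · exact .refl
          · exact Rch.adj h g1 g2
        · rcases hkk with rfl | h
          · exact .refl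
          · exact Rch.adj h.symm g1 g2
        · exact .refl
    refine ⟨f '' 𝓑, ?_, ?_, ?_⟩
    · rintro _ ⟨X, hX, rfl⟩
      refine ⟨?_, ?_⟩
      · rw [hf]
        rintro y (hy | hy)
        · exact ⟨(hB.1 X hX).1 hy.1, fun h => hy.2 h.1⟩
        · exact ⟨hAU (hDA hy.1), fun h => h.2 hy.1⟩
      · obtain ⟨x, hx, hxA⟩ : ∃ x ∈ X, x ∉ A := by
          obtain ⟨y, hy⟩ := (hB.1 X hX).2.1
          by_cases hyA : y ∈ A
          · obtain ⟨c, h1, h2⟩ := hm hX hy hyA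
            exact ⟨c, h1, hvA c h2⟩
          · exact ⟨y, hy, hyA⟩
        have key : ∀ y, Rch G X x y → (y ∉ A → Rch G (f X) x y) ∧
            (y ∈ A → ∃ c ∈ X, c ∈ ({v, k0, k1} : Set V) ∧ Rch G (f X) x c) := by
          intro y h
          induction h with
          | refl => exact ⟨fun _ => .refl, fun h => absurd h hxA⟩
          | @tail b c _ h ih =>
            by_cases hb : b ∈ A <;> by_cases hc : c ∈ A <;> simp only [hb, hc, not_true_eq_false, not_false_eq_true, false_imp_iff, true_imp_iff, and_true, true_and] at ih ⊢
            · exact ih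
            · obtain ⟨e, h1, h2, h3⟩ := ih
              exact h3.trans (cc h1 h.2.2 h2 ((hA b hb c ((hB.1 X hX).1 h.2.2) h.1).resolve_left hc))
            · exact ⟨b, h.2.1, (hA c hc b ((hB.1 X hX).1 h.2.1) h.1.symm).resolve_left hb, ih⟩
            · exact ih.trans (Rch.adj h.1 (hf1 h.2.1 hb) (hf1 h.2.2 hc))
        refine Cn_of (hf1 hx hxA) (fun y hy => ?_)
        have hy' := hy
        rw [hf] at hy
        rcases hy with hy | ⟨hyD, hv⟩
        · exact (key y ((hB.1 X hX).2.2 x hx y hy.1)).1 hy.2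
        · refine ((key v ((hB.1 X hX).2.2 x hx v hv)).1 (hvA v (by simp))).trans ?_
          obtain ⟨h1, d, hd, h2⟩ := hD.resolve_left (fun h => by simp [h] at hyD)
          exact (Rch.adj h2 (hf1 hv (hvA v (by simp))) (hf2 hv hd)).trans ((h1.2 d hd y hyD).mono (hf2 hv))
    · rintro _ ⟨X, hX, rfl⟩ _ ⟨Y, hY, rfl⟩
      have tt : ∀ {X Y c c'}, c ∈ X → c' ∈ Y → c ∈ ({v, k0, k1} : Set V) → c' ∈ ({v, k0, k1} : Set V) →
          c = v → Tch G (f X) (f Y) := by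
        rintro X Y c c' h1 h2 h3 h4 rfl
        have g1 := hf1 h1 (hvA _ h3)
        have g2 := hf1 h2 (hvA _ h4)
        have att : Att G c' D → Tch G (f X) (f Y) := fun ⟨d, hd, h⟩ => ⟨d, hf2 h1 hd, c', g2, Or.inr h.symm⟩
        rcases hc0 h4 with rfl | rfl | rfl
        · exact ⟨_, g1, _, g2, Or.inl rfl⟩
        · rcases hk0 with h | h | h
          · exact ⟨_, g1, _, g2, Or.inl h⟩
          · exact ⟨_, g1, _, g2, Or.inr h⟩
          · exact att h
        · rcases hk1 with h | h | h
          · exact ⟨_, g1, _, g2, Or.inl h⟩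
          · exact ⟨_, g1, _, g2, Or.inr h⟩
          · exact att h
      have tc : ∀ {c c'}, c ∈ X → c' ∈ Y → c ∈ ({v, k0, k1} : Set V) → c' ∈ ({v, k0, k1} : Set V) →
          Tch G (f X) (f Y) := by
        intro c c' h1 h2 h3 h4
        by_cases e1 : c = v
        · exact tt h1 h2 h3 h4 e1
        by_cases e2 : c' = v
        · exact (tt h2 h1 h4 h3 e2).symm
        have g1 := hf1 h1 (hvA _ h3)
        have g2 := hf1 h2 (hvA _ h4)
        refine ⟨_, g1, _, g2, ?_⟩
        rcases (hc0 h3).resolve_left e1 with rfl | rfl <;> rcases (hc0 h4).resolve_left e2 with rfl | rfl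
        · exact Or.inl rfl
        · exact hkk
        · exact hkk.imp Eq.symm (fun h => h.symm)
        · exact Or.inl rfl
      obtain ⟨x, hx, y, hy, h⟩ := hB.2.1 X hX Y hY
      by_cases hxA : x ∈ A
      · obtain ⟨c, hcX, hcC⟩ := hm hX hx hxA
        by_cases hyA : y ∈ A
        · obtain ⟨c', hcX', hcC'⟩ := hm hY hy hyA
          exact tc hcX hcX' hcC hcC'
        · exact tc hcX hy hcC ((hA x hxA y ((hB.1 Y hY).1 hy) (h.resolve_left (fun h => hyA (h ▸ hxA)))).resolve_left hyA)
      · by_cases hyA : y ∈ A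
        · obtain ⟨c', hcX', hcC'⟩ := hm hY hy hyA
          exact tc hx hcX' ((hA y hyA x ((hB.1 X hX).1 hx) (h.resolve_left (fun h => hxA (h ▸ hyA))).symm).resolve_left hxA) hcC'
        · exact ⟨x, hf1 hx hxA, y, hf1 hy hyA, h⟩
    · intro S hS
      obtain ⟨S', h1, h2, h3⟩ : ∃ S' : Set V, S'.ncard < k ∧ S \ D ⊆ S' ∧ ((S ∩ D).Nonempty → v ∈ S') := by
        by_cases h : (S ∩ D).Nonempty
        · refine ⟨insert v (S \ D), ?_, Set.subset_insert _ _, fun _ => Set.mem_insert _ _⟩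
          have := ncard_insert_le v (S \ D)
          have h5 : S \ D ⊂ S := ⟨sdiff_subset, fun h' => by
            obtain ⟨y, hy⟩ := h; exact (h' hy.1).2 hy.2⟩
          have h4 := ncard_lt_ncard h5 (toFinite _)
          omega
        · exact ⟨S, hS, sdiff_subset, fun h' => absurd h' h⟩
      obtain ⟨X, hX, hd⟩ := hB.2.2 S' h1
      refine ⟨f X, ⟨X, hX, rfl⟩, Set.disjoint_left.2 ?_⟩
      rw [hf]
      rintro y (hy | hy) hyS
      · exact Set.disjoint_left.1 hd hy.1 (h2 ⟨hyS, fun h => hy.2 (hDA h)⟩)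
      · exact Set.disjoint_left.1 hd hy.2 (h3 ⟨y, hyS, hy.1⟩)
  by_contra hAD
  obtain ⟨y, hy, hyD⟩ := Set.not_subset.1 hAD
  have hss : U \ (A \ D) ⊂ U := ⟨sdiff_subset, fun h => (h (hAU hy)).2 ⟨hy, hyD⟩⟩
  exact hcr _ hss tmp

def CK (G : SimpleGraph V) (K : Set V) : Prop := K = ∅ ∨ ∃ k0 k1, K = {k0, k1} ∧ (k0 = k1 ∨ G.Adj k0 k1)
def NoCC (G : SimpleGraph V) (X : Set V) : Prop := ∀ K, CK G K → ∀ x ∈ X, x ∉ K → ∀ y ∈ X, y ∉ K → Rch G (X \ K) x y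

lemma Crit.nocc [Finite V] (hk : 3 ≤ k) (hc : Crit G U k 𝓑) : NoCC G U := by
  intro K hK x hx hxK y hy hyK
  by_contra hxy
  have hKc : K.ncard < k := by
    rcases hK with rfl | ⟨k0, k1, rfl, _⟩
    · simp; omega
    · have := ncard_insert_le k0 {k1}; rw [ncard_singleton] at this; omega
  obtain ⟨X0, hX0, hd⟩ := hc.1.2.2 K hKc
  have hX : X0 ⊆ U \ K := fun z hz => ⟨(hc.1.1 X0 hX0).1 hz, Set.disjoint_left.1 hd hz⟩
  have main : ∀ x ∈ U \ K, Disjoint (cmp G (U \ K) x) X0 → False := by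
    intro x hx hdx
    have hcl : ∀ y ∈ cmp G (U \ K) x, ∀ z ∈ U, G.Adj y z → z ∈ cmp G (U \ K) x ∨ z ∈ K := by
      intro y hy z hz hyz
      by_contra h
      push Not at h
      exact h.1 (cmp_step hx hy ⟨hz, h.2⟩ hyz)
    have han : Anti G (cmp G (U \ K) x) X0 := fun y hy z hz =>
      ⟨fun h => Set.disjoint_left.1 hdx hy (h ▸ hz), fun h => Set.disjoint_left.1 hdx (cmp_step hx hy (hX hz) h) hz⟩
    have : ∃ v k1, (∀ c ∈ ({v, v, k1} : Set V), c ∉ cmp G (U \ K) x) ∧ K ⊆ {v, v, k1} ∧ (v = k1 ∨ G.Adj v k1) := by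
      rcases hK with rfl | ⟨k0, k1, rfl, h⟩
      · obtain ⟨y, hy⟩ := (hc.1.1 X0 hX0).2.1
        exact ⟨y, y, by simpa using fun h => Set.disjoint_left.1 hdx h hy, by simp, Or.inl rfl⟩
      · refine ⟨k0, k1, fun c hcc hcx => (cmp_sub hx hcx).2 (by simpa using hcc), by simp, h⟩
    obtain ⟨v, k1, h1, h2, h3⟩ := this
    exact hc.red (D := ∅) ((cmp_sub hx).trans sdiff_subset) (fun y hy z hz h => (hcl y hy z hz h).imp_right (fun h => h2 h)) h1
      hX0 han (empty_subset _) (Or.inl rfl) (Or.inl rfl) (h3.imp_right Or.inl) h3 (mem_cmp (x := x))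
  by_cases h1 : Disjoint (cmp G (U \ K) x) X0
  · exact main x ⟨hx, hxK⟩ h1
  · refine main y ⟨hy, hyK⟩ (Set.disjoint_left.2 fun z hz hzX => ?_)
    obtain ⟨w, hw, hwX⟩ := Set.not_disjoint_iff.1 h1
    exact hxy ((Rch.trans hw (((hc.1.1 X0 hX0).2.2 w hwX z hzX).mono hX)).trans (Rch.symm hz))
end Paper

namespace Paper
variable {V : Type} {G G' : SimpleGraph V} {A B C D P S X Z U K L : Set V} {x y z v w a u k0 k1 : V} {𝓑 : Set (Set V)} {k : ℕ}

def Tf (G : SimpleGraph V) : Prop := ∀ a b c, G.Adj a b → G.Adj a c → G.Adj b c → False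
def Nn (G : SimpleGraph V) (X : Set V) (w : V) : Set V := {y | y ∈ X ∧ y ≠ w ∧ ¬ G.Adj w y}

lemma ck1 : CK G {w} := Or.inr ⟨w, w, by simp, Or.inl rfl⟩

lemma nn_cn (hT : Tf G) (hS : Star G) (hX : NoCC G X) (hw : w ∈ X) (ha : a ∈ Nn G X w) : Cn G (Nn G X w) := by
  refine Cn_of ha fun y hy => ?_
  by_contra hya
  obtain ⟨A, hA⟩ : ∃ A, A = cmp G (Nn G X w) a := ⟨_, rfl⟩
  have hAc : Cn G A := hA ▸ Cn_cmp ha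
  have hAs : A ⊆ Nn G X w := hA ▸ cmp_sub ha
  have haA : a ∈ A := hA ▸ mem_cmp
  have hyA : y ∉ A := hA ▸ hya
  have hAn : ∀ b ∈ A, ∀ z ∈ Nn G X w, G.Adj b z → z ∈ A := by
    intro b hb z hz h; rw [hA] at hb ⊢; exact cmp_step ha hb hz h
  obtain ⟨E, hE⟩ : ∃ E : Set V, E = {z | z ∈ X ∧ z ≠ w ∧ z ∉ A ∧ ¬ (G.Adj w z ∧ Att G z A)} := ⟨_, rfl⟩
  have hyE : y ∈ E := by rw [hE]; exact ⟨hy.1, hy.2.1, hyA, fun h => hy.2.2 h.1⟩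
  obtain ⟨D, hD⟩ : ∃ D, D = cmp G E y := ⟨_, rfl⟩
  have hDs : D ⊆ E := hD ▸ cmp_sub hyE
  have hDE : ∀ z ∈ D, z ∈ X ∧ z ≠ w ∧ z ∉ A ∧ ¬ (G.Adj w z ∧ Att G z A) := fun z hz => by
    have := hDs hz; rwa [hE] at this
  have hDc : Cn G D := hD ▸ Cn_cmp hyE
  have hAD : Anti G A D := by
    intro b hb d hd
    refine ⟨fun h => (hDE d hd).2.2.1 (h ▸ hb), fun h => (hDE d hd).2.2.2 ⟨?_, b, hb, h.symm⟩⟩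
    by_contra hwd
    exact (hDE d hd).2.2.1 (hAn b hb d ⟨(hDE d hd).1, (hDE d hd).2.1, hwd⟩ h)
  have hDn : ∀ d ∈ D, ∀ z ∈ X, G.Adj d z → z ∈ D ∨ z = w ∨ (G.Adj w z ∧ Att G z A ∧ Att G z D) := by
    intro d hd z hz h
    by_cases hzE : z ∈ E
    · left; rw [hD] at hd ⊢; exact cmp_step hyE hd hzE h
    · by_cases hzw : z = w
      · exact Or.inr (Or.inl hzw)
      · have hzA : z ∉ A := fun hzA => (hAD z hzA d hd).2 h.symm
        rw [hE] at hzE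
        by_cases h2 : G.Adj w z ∧ Att G z A
        · exact Or.inr (Or.inr ⟨h2.1, h2.2, d, hd, h.symm⟩)
        · exact absurd ⟨hz, hzw, hzA, h2⟩ hzE
  have huniq : ∀ z z', G.Adj w z → Att G z A → Att G z D → G.Adj w z' → Att G z' A → Att G z' D → z = z' := by
    intro z z' h1 h2 h3 h4 h5 h6
    by_contra hne
    exact hS w z z' h1 h4 hne (hT w z z' h1 h4) A D hAc hDc hAD (fun h => (hAs h).2.1 rfl) (fun h => (hDE _ h).2.1 rfl)
      (fun h => (hAs h).2.2 h1) (fun h => (hDE _ h).2.2.2 ⟨h1, h2⟩) (fun h => (hAs h).2.2 h4) (fun h => (hDE _ h).2.2.2 ⟨h4, h5⟩) h2 h3 h5 h6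
  have fin : ∀ z, (w = z ∨ G.Adj w z ∧ Att G z A) → (∀ z', G.Adj w z' → Att G z' A → Att G z' D → z' = z) → False := by
    intro z hz hu
    have hyD : y ∈ D := hD ▸ mem_cmp
    have hn1 : a ∉ ({w, z} : Set V) := by
      rintro (h | h)
      · exact ha.2.1 h
      · rcases hz with h' | h'
        · exact ha.2.1 (h.trans h'.symm)
        · exact ha.2.2 (by rw [mem_singleton_iff] at h; rw [h]; exact h'.1)
    have hn2 : y ∉ ({w, z} : Set V) := by
      rintro (h | h)
      · exact hy.2.1 h
      · rcases hz with h' | h'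
        · exact hy.2.1 (h.trans h'.symm)
        · exact hy.2.2 (by rw [mem_singleton_iff] at h; rw [h]; exact h'.1)
    have := hX {w, z} (Or.inr ⟨w, z, rfl, hz.imp_right And.left⟩) y hy.1 hn2 a ha.1 hn1
    have := this.ind (P := D) hyD (fun d hd _ e he hde => by
      rcases hDn d hd e he.1 hde with h | h | ⟨h1, h2, h3⟩
      · exact h
      · exact absurd (Or.inl h) he.2
      · exact absurd (Or.inr (hu e h1 h2 h3)) he.2)
    exact (hDE a this).2.2.1 haA
  by_cases h : ∃ z, G.Adj w z ∧ Att G z A ∧ Att G z D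
  · obtain ⟨z, h1, h2, h3⟩ := h
    exact fin z (Or.inr ⟨h1, h2⟩) (fun z' h4 h5 h6 => huniq _ _ h4 h5 h6 h1 h2 h3)
  · exact fin w (Or.inl rfl) (fun z' h4 h5 h6 => absurd ⟨z', h4, h5, h6⟩ h)

lemma nn_att (hT : Tf G) (hX : NoCC G X) (ha : a ∈ Nn G X w) (hb : y ∈ X) (hwb : G.Adj w y) :
    Att G y (Nn G X w) := by
  by_contra hc
  have := hX {w} ck1 y hb (fun h => hwb.ne h.symm) a ha.1 (fun h => ha.2.1 h)
  have := this.ind (P := {y}) rfl (fun d hd _ e he hde => by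
    rw [mem_singleton_iff] at hd; subst hd
    exact absurd ⟨e, ⟨he.1, he.2, fun h => hT w d e hwb h hde⟩, hde⟩ hc)
  rw [mem_singleton_iff] at this
  exact ha.2.2 (this ▸ hwb)

def Th (G : SimpleGraph V) (X : Set V) (a w : V) : Prop := ∃ D1 D2, D1 ⊆ X ∧ D2 ⊆ X ∧ Cn G D1 ∧ Cn G D2 ∧ Anti G D1 D2 ∧
  a ∉ D1 ∧ a ∉ D2 ∧ w ∉ D1 ∧ w ∉ D2 ∧ Att G a D1 ∧ Att G a D2 ∧ Att G w D1 ∧ Att G w D2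

lemma th_base (hT : Tf G) (hS : Star G) (hX : NoCC G X) (haX : a ∈ X) (hw : w ∈ Nn G X a) :
    ∃ s ∈ Nn G X a, Th G X a s := by
  have nb : ∀ K, CK G K → a ∉ K → w ∉ K → ∃ b ∈ X, b ∉ K ∧ G.Adj a b := by
    intro K hK h1 h2
    by_contra hc
    push Not at hc
    have := (hX K hK a haX h1 w hw.1 h2).ind (P := {a}) rfl (fun d hd _ e he hde => by
      rw [mem_singleton_iff] at hd; subst hd
      exact absurd hde (hc e he.1 he.2))
    exact hw.2.1 this
  obtain ⟨b, hb, _, hab⟩ := nb ∅ (Or.inl rfl) (by simp) (by simp)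
  obtain ⟨c, hc, hcb, hac⟩ := nb {b} ck1 (fun h => hab.ne h) (fun h => hw.2.2 (by rw [mem_singleton_iff] at h; rwa [h]))
  have hbc := hT a b c hab hac
  obtain ⟨e, he, hbe⟩ := nn_att hT hX hw hb hab
  obtain ⟨f, hf, hcf⟩ := nn_att hT hX hw hc hac
  obtain ⟨s, m, hs, h1, h2, h3, h4, h5⟩ := ipath (R := fun y => G.Adj b y) (Q := fun y => G.Adj c y) (nn_cn hT hS hX haX hw) he hbe hf hcf
  have hcb' : c ≠ b := hcb
  have hsne : ∀ i ≤ m, s i ≠ b ∧ s i ≠ c := fun i hi => ⟨fun h => (h1 i hi).2.2 (h ▸ hab), fun h => (h1 i hi).2.2 (h ▸ hac)⟩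
  refine ⟨s 0, h1 0 (by omega), {b}, insert c (s '' Set.Icc 1 m), by simpa using hb, ?_, Cn_single, ?_, ?_, hab.ne, ?_, ?_, ?_, ⟨b, rfl, hab⟩,
    ⟨c, Or.inl rfl, hac⟩, ⟨b, rfl, h2.symm⟩, ?_⟩
  · rintro _ (rfl | ⟨i, hi, rfl⟩)
    · exact hc
    · exact (h1 i hi.2).1
  · by_cases hm : m = 0
    · subst hm; simpa using Cn_single
    · exact (hs.seg (by omega) le_rfl).insert ⟨m, by simp; omega, rfl⟩ h3
  · rintro _ rfl _ (rfl | ⟨i, hi, rfl⟩)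
    · exact ⟨fun h => hcb h.symm, hbc⟩
    · exact ⟨fun h => (hsne i hi.2).1 h.symm, h5 i hi.1 hi.2⟩
  · rintro (h | ⟨i, hi, h⟩)
    · exact hac.ne h
    · exact (h1 i hi.2).2.1 h
  · exact fun h => (hsne 0 (by omega)).1 h
  · rintro (h | ⟨i, hi, h⟩)
    · exact (hsne 0 (by omega)).2 h
    · have := hs.inj hi.2 (by omega) h; simp at hi; omega
  · by_cases hm : m = 0
    · subst hm; exact ⟨c, Or.inl rfl, h3.symm⟩
    · exact ⟨s 1, Or.inr ⟨1, by simp; omega, rfl⟩, hs.1 0 (by omega)⟩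
end Paper

namespace Paper
variable {V : Type} {G G' : SimpleGraph V} {A B C D P S X Z U K L : Set V} {x y z v w w' a u k0 k1 : V} {𝓑 : Set (Set V)} {k : ℕ}

lemma IPf.anti {p : ℕ → V} {m : ℕ} (h : IPf G p m) {I J : Set ℕ} (hI : ∀ i ∈ I, i ≤ m) (hJ : ∀ i ∈ J, i ≤ m)
    (hIJ : ∀ i ∈ I, ∀ j ∈ J, i ≠ j ∧ i + 1 ≠ j ∧ j + 1 ≠ i) : Anti G (p '' I) (p '' J) := by
  rintro _ ⟨i, hi, rfl⟩ _ ⟨j, hj, rfl⟩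
  have := hIJ i hi j hj
  exact ⟨fun e => this.1 (h.inj (hI i hi) (hJ j hj) e), fun e => by have := h.adj (hI i hi) (hJ j hj) e; omega⟩

lemma IPf.rev {p : ℕ → V} {m : ℕ} (h : IPf G p m) : IPf G (fun i => p (m - i)) m := by
  refine ⟨fun i hi => ?_, fun i j hij hj => ⟨fun e => ?_, fun e => ?_⟩⟩
  · have := h.1 (m - (i+1)) (by omega); rw [show m - (i+1) + 1 = m - i by omega] at this; exact this.symm
  · have := h.inj (i := m - i) (j := m - j) (by omega) (by omega) e; omega
  · have := h.adj (i := m - i) (j := m - j) (by omega) (by omega) e; omega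

lemma Anti.union (h1 : Anti G A C) (h2 : Anti G B C) : Anti G (A ∪ B) C := by
  rintro a (ha | ha) c hc
  · exact h1 a ha c hc
  · exact h2 a ha c hc
lemma Anti.union' (h1 : Anti G A B) (h2 : Anti G A C) : Anti G A (B ∪ C) := (h1.symm.union h2.symm).symm
lemma Anti.insert (h1 : Anti G A C) (h : ∀ c ∈ C, x ≠ c ∧ ¬ G.Adj x c) : Anti G (insert x A) C := by
  rintro a (rfl | ha) c hc
  · exact h c hc
  · exact h1 a ha c hc

def Ho (G : SimpleGraph V) (X : Set V) (p : ℕ → V) (m : ℕ) (w : V) : Prop := IPf G p m ∧ (∀ i ≤ m, p i ∈ X) ∧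
  (∀ i ≤ m, G.Adj w (p i) ↔ i = 0 ∨ i = m) ∧ ∀ i ≤ m, p i ≠ w

lemma Ho.rev {p : ℕ → V} {m : ℕ} (h : Ho G X p m w) : Ho G X (fun i => p (m - i)) m w :=
  ⟨h.1.rev, fun i hi => h.2.1 _ (by omega), fun i hi => by rw [h.2.2.1 _ (by omega)]; omega, fun i hi => h.2.2.2 _ (by omega)⟩

lemma Ho.t1 {p : ℕ → V} {m i j : ℕ} (hT : Tf G) (hS : Star G) (h : Ho G X p m w) (hv : ∀ i ≤ m, p i ≠ v) (hvw : v ≠ w)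
    (hi : 0 < i) (hij : i < j) (hj : j < m) (h1 : G.Adj v (p i)) (h2 : G.Adj v (p j)) : False := by
  have h3 := hT _ _ _ h1 h2
  have hj1 : j ≠ i + 1 := fun e => h3 (e ▸ h.1.1 i (by omega))
  obtain ⟨h0, -, hw, hwp⟩ := h
  have w0 : G.Adj w (p 0) := (hw 0 (by omega)).2 (Or.inl rfl)
  have wm : G.Adj w (p m) := (hw m (by omega)).2 (Or.inr rfl)
  refine hS v _ _ h1 h2 (fun e => by have := h0.inj (by omega) (by omega) e; omega) h3 (p '' Set.Icc (i+1) (j-1))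
    (insert w (p '' Set.Iio i) ∪ p '' Set.Icc (j+1) m) (h0.seg (by omega) (by omega))
    ((Cn_pre h0 (by omega) w0).union (h0.seg (by omega) le_rfl) ⟨w, Or.inl rfl, p m, ⟨m, by simp; omega, rfl⟩, Or.inr wm⟩)
    ?_ ?_ ?_ ?_ ?_ ?_ ?_ ⟨p (i+1), ⟨i+1, by simp; omega, rfl⟩, h0.1 i (by omega)⟩
    ⟨p (i-1), Or.inl (Or.inr ⟨i-1, by simp; omega, rfl⟩), ?_⟩ ⟨p (j-1), ⟨j-1, by simp; omega, rfl⟩, ?_⟩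
    ⟨p (j+1), Or.inr ⟨j+1, by simp; omega, rfl⟩, h0.1 j (by omega)⟩
  · refine Anti.union' (Anti.symm (Anti.insert (Anti.symm (h0.anti ?_ ?_ ?_)) ?_)) (h0.anti ?_ ?_ ?_)
    all_goals try (simp only [Set.mem_Icc, Set.mem_Iio]; intros; omega)
    rintro _ ⟨l, hl, rfl⟩
    simp only [Set.mem_Icc] at hl
    exact ⟨fun e => hwp l (by omega) e.symm, fun e => by have := (hw l (by omega)).1 e; omega⟩
  · rintro ⟨l, hl, e⟩; simp at hl; exact hv l (by omega) e
  · rintro ((e | ⟨l, hl, e⟩) | ⟨l, hl, e⟩)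
    · exact hvw e
    · simp at hl; exact hv l (by omega) e
    · simp at hl; exact hv l (by omega) e
  · rintro ⟨l, hl, e⟩; simp at hl; have := h0.inj (by omega) (by omega) e; omega
  · rintro ((e | ⟨l, hl, e⟩) | ⟨l, hl, e⟩)
    · exact hwp i (by omega) e
    · simp at hl; have := h0.inj (by omega) (by omega) e; omega
    · simp at hl; have := h0.inj (by omega) (by omega) e; omega
  · rintro ⟨l, hl, e⟩; simp at hl; have := h0.inj (by omega) (by omega) e; omega
  · rintro ((e | ⟨l, hl, e⟩) | ⟨l, hl, e⟩)
    · exact hwp j (by omega) e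
    · simp at hl; have := h0.inj (by omega) (by omega) e; omega
    · simp at hl; have := h0.inj (by omega) (by omega) e; omega
  · have := h0.1 (i-1) (by omega); rw [show i - 1 + 1 = i by omega] at this; exact this.symm
  · have := h0.1 (j-1) (by omega); rw [show j - 1 + 1 = j by omega] at this; exact this.symm

def Lv (G : SimpleGraph V) (p : ℕ → V) (m : ℕ) (w w' : V) (s : ℕ → V) (n z : ℕ) : Prop := IPf G s n ∧ G.Adj w w' ∧
  (∀ i ≤ n, s i ≠ w ∧ ¬ G.Adj w (s i)) ∧ G.Adj w' (s 0) ∧ (∀ i, 0 < i → i ≤ n → ¬ G.Adj w' (s i)) ∧ (∀ i ≤ n, s i ≠ w') ∧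
  (∀ i ≤ m, p i ≠ w' ∧ ¬ G.Adj w' (p i)) ∧ (∀ i ≤ n, ∀ j ≤ m, s i ≠ p j) ∧ (∀ i < n, ∀ j, 0 < j → j < m → ¬ G.Adj (s i) (p j)) ∧
  0 < z ∧ z < m ∧ G.Adj (s n) (p z)

lemma Lv.rev {p s : ℕ → V} {m n z : ℕ} (h : Lv G p m w w' s n z) : Lv G (fun i => p (m - i)) m w w' s n (m - z) := by
  obtain ⟨h1, h2, h3, h4, h5, h6, h7, h8, h9, h10, h11, h12⟩ := h
  exact ⟨h1, h2, h3, h4, h5, h6, fun i hi => h7 _ (by omega), fun i hi j hj => h8 i hi _ (by omega),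
    fun i hi j hj hj' => h9 i hi _ (by omega) (by omega), by omega, by omega, by
      simp only; rw [show m - (m - z) = z by omega]; exact h12⟩

lemma Lv.c1 {p s : ℕ → V} {m n z j : ℕ} (hS : Star G) (hp : Ho G X p m w) (h : Lv G p m w w' s n z) (hj : j ≤ n)
    (h1 : G.Adj (s j) (p 0)) (h2 : ∀ i < j, ¬ G.Adj (s i) (p 0) ∧ ¬ G.Adj (s i) (p m)) : False := by
  obtain ⟨g1, g2, g3, g4, g5, g6, g7, g8, g9, g10, g11, g12⟩ := h
  obtain ⟨h0, -, hw, hwp⟩ := hp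
  have w0 : G.Adj w (p 0) := (hw 0 (by omega)).2 (Or.inl rfl)
  have wm : G.Adj w (p m) := (hw m (by omega)).2 (Or.inr rfl)
  refine hS (p 0) w (s j) w0.symm h1.symm (g3 j hj).1.symm (g3 j hj).2 (insert w' (s '' Set.Iio j)) (s '' Set.Icc (j+1) n ∪ p '' Set.Icc z m)
    (Cn_pre g1 (by omega) g4) ?_ ?_ ?_ ?_ ?_ ?_ ?_ ?_ ⟨w', Or.inl rfl, g2⟩ ⟨p m, Or.inr ⟨m, by simp; omega, rfl⟩, wm⟩ ?_ ?_
  · by_cases e : j = n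
    · subst e; simpa using h0.seg (by omega) le_rfl
    · exact (g1.seg (by omega) le_rfl).union (h0.seg (by omega) le_rfl) ⟨s n, ⟨n, by simp; omega, rfl⟩, p z, ⟨z, by simp; omega, rfl⟩, Or.inr g12⟩
  · refine Anti.union' (Anti.insert (g1.anti ?_ ?_ ?_) ?_) (Anti.insert ?_ ?_)
    all_goals try (simp only [Set.mem_Icc, Set.mem_Iio]; intros; omega)
    · rintro _ ⟨l, hl, rfl⟩
      simp only [Set.mem_Icc] at hl
      exact ⟨(g6 l hl.2).symm, g5 l (by omega) hl.2⟩
    · rintro _ ⟨i, hi, rfl⟩ _ ⟨l, hl, rfl⟩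
      simp only [Set.mem_Icc, Set.mem_Iio] at hi hl
      refine ⟨g8 i (by omega) l hl.2, fun e => ?_⟩
      by_cases hlm : l = m
      · subst hlm; exact (h2 i hi).2 e
      · exact g9 i (by omega) l (by omega) (by omega) e
    · rintro _ ⟨l, hl, rfl⟩
      simp only [Set.mem_Icc] at hl
      exact ⟨(g7 l hl.2).1.symm, (g7 l hl.2).2⟩
  · rintro (e | ⟨l, hl, e⟩)
    · exact (g7 0 (by omega)).1 e
    · simp at hl; exact g8 l (by omega) 0 (by omega) e
  · rintro (⟨l, hl, e⟩ | ⟨l, hl, e⟩)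
    · simp at hl; exact g8 l (by omega) 0 (by omega) e
    · simp at hl; have := h0.inj (by omega) (by omega) e; omega
  · rintro (e | ⟨l, hl, e⟩)
    · exact g2.ne e
    · simp at hl; exact (g3 l (by omega)).1 e
  · rintro (⟨l, hl, e⟩ | ⟨l, hl, e⟩)
    · simp at hl; exact (g3 l (by omega)).1 e
    · simp at hl; exact hwp l (by omega) e
  · rintro (e | ⟨l, hl, e⟩)
    · exact g6 j hj e
    · simp at hl; have := g1.inj (by omega) (by omega) e; omega
  · rintro (⟨l, hl, e⟩ | ⟨l, hl, e⟩)
    · simp at hl; have := g1.inj (by omega) (by omega) e; omega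
    · simp at hl; exact g8 j hj l (by omega) e.symm
  · by_cases e : j = 0
    · subst e; exact ⟨w', Or.inl rfl, g4.symm⟩
    · refine ⟨s (j-1), Or.inr ⟨j-1, by simp; omega, rfl⟩, ?_⟩
      have := g1.1 (j-1) (by omega); rw [show j - 1 + 1 = j by omega] at this; exact this.symm
  · by_cases e : j = n
    · subst e; exact ⟨p z, Or.inr ⟨z, by simp; omega, rfl⟩, g12⟩
    · exact ⟨s (j+1), Or.inl ⟨j+1, by simp; omega, rfl⟩, g1.1 j (by omega)⟩

lemma Lv.c2 {p s : ℕ → V} {m n z : ℕ} (hS : Star G) (hp : Ho G X p m w) (h : Lv G p m w w' s n z) :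
    ∀ j ≤ n, ¬ G.Adj (s j) (p 0) ∧ ¬ G.Adj (s j) (p m) := by
  intro j
  induction j using Nat.strong_induction_on with
  | _ j ih =>
    intro hj
    refine ⟨fun e => h.c1 hS hp hj e (fun i hi => ih i hi (by omega)), fun e => ?_⟩
    exact h.rev.c1 hS hp.rev hj (by simpa using e) (fun i hi => by simpa using (ih i hi (by omega)).symm)

lemma Lv.th {p s : ℕ → V} {m n z c : ℕ} (hT : Tf G) (hS : Star G) (hp : Ho G X p m w) (h : Lv G p m w w' s n z) (hc : 0 < c) (hcz : c ≤ z)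
    (hwX : w ∈ X) (hsX : ∀ i ≤ n, s i ∈ X) : Th G X (p c) w' := by
  have hc2 := h.c2 hS hp
  have ht1 := fun {v i j} => hp.t1 hT hS (v := v) (i := i) (j := j)
  obtain ⟨g1, g2, g3, g4, g5, g6, g7, g8, g9, g10, g11, g12⟩ := h
  obtain ⟨h0, hpX, hw, hwp⟩ := hp
  have w0 : G.Adj w (p 0) := (hw 0 (by omega)).2 (Or.inl rfl)
  refine ⟨insert w (p '' Set.Iio c), p '' Set.Icc (c+1) z ∪ s '' Set.Icc 0 n, ?_, ?_, Cn_pre h0 (by omega) w0, ?_, ?_, ?_, ?_, ?_, ?_,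
    ⟨p (c-1), Or.inr ⟨c-1, by simp; omega, rfl⟩, ?_⟩, ?_, ⟨w, Or.inl rfl, g2.symm⟩, ⟨s 0, Or.inr ⟨0, by simp, rfl⟩, g4⟩⟩
  · rintro _ (rfl | ⟨i, hi, rfl⟩)
    · exact hwX
    · simp at hi; exact hpX i (by omega)
  · rintro _ (⟨i, hi, rfl⟩ | ⟨i, hi, rfl⟩)
    · simp at hi; exact hpX i (by omega)
    · simp at hi; exact hsX i (by omega)
  · by_cases e : c = z
    · subst e; simpa using g1.seg (by omega) le_rfl
    · exact (h0.seg (by omega) (by omega)).union (g1.seg (by omega) le_rfl) ⟨p z, ⟨z, by simp; omega, rfl⟩, s n, ⟨n, by simp, rfl⟩, Or.inr g12.symm⟩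
  · refine Anti.union' (Anti.insert (h0.anti ?_ ?_ ?_) ?_) (Anti.insert ?_ ?_)
    all_goals try (simp only [Set.mem_Icc, Set.mem_Iio]; intros; omega)
    · rintro _ ⟨l, hl, rfl⟩
      simp only [Set.mem_Icc] at hl
      exact ⟨(hwp l (by omega)).symm, fun e => by have := (hw l (by omega)).1 e; omega⟩
    · rintro _ ⟨i, hi, rfl⟩ _ ⟨l, hl, rfl⟩
      simp only [Set.mem_Icc, Set.mem_Iio] at hi hl
      refine ⟨(g8 l (by omega) i (by omega)).symm, fun e => ?_⟩
      by_cases hi0 : i = 0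
      · subst hi0; exact (hc2 l (by omega)).1 e.symm
      · by_cases hln : l = n
        · subst hln
          exact ht1 (fun i hi => (g8 l le_rfl i hi).symm) (g3 l le_rfl).1 (by omega) (show i < z by omega) (by omega) e.symm g12
        · exact g9 l (by omega) i (by omega) (by omega) e.symm
    · rintro _ ⟨l, hl, rfl⟩
      simp only [Set.mem_Icc] at hl
      exact ⟨(g3 l hl.2).1.symm, (g3 l hl.2).2⟩
  · rintro (e | ⟨l, hl, e⟩)
    · exact hwp c (by omega) e
    · simp at hl; have := h0.inj (by omega) (by omega) e; omega
  · rintro (⟨l, hl, e⟩ | ⟨l, hl, e⟩)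
    · simp at hl; have := h0.inj (by omega) (by omega) e; omega
    · simp at hl; exact g8 l (by omega) c (by omega) e
  · rintro (e | ⟨l, hl, e⟩)
    · exact g2.ne e.symm
    · simp at hl; exact (g7 l (by omega)).1 e
  · rintro (⟨l, hl, e⟩ | ⟨l, hl, e⟩)
    · simp at hl; exact (g7 l (by omega)).1 e
    · simp at hl; exact g6 l (by omega) e
  · have := h0.1 (c-1) (by omega); rw [show c - 1 + 1 = c by omega] at this; exact this.symm
  · by_cases e : c = z
    · subst e; exact ⟨s n, Or.inr ⟨n, by simp, rfl⟩, g12.symm⟩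
    · exact ⟨p (c+1), Or.inl ⟨c+1, by simp; omega, rfl⟩, h0.1 c (by omega)⟩
end Paper

namespace Paper
variable {V : Type} {G G' : SimpleGraph V} {A B C D P S X Z U K L : Set V} {x y z v w w' a u k0 k1 : V} {𝓑 : Set (Set V)} {k : ℕ}

lemma th_hole (h : Th G X a w) (haX : a ∈ X) (haw : a ≠ w) (hn : ¬ G.Adj w a) :
    ∃ p m c, Ho G X p m w ∧ 0 < c ∧ c < m ∧ p c = a := by
  obtain ⟨D1, D2, h1, h2, h3, h4, h5, h6, h7, h8, h9, ⟨d1, e1, f1⟩, ⟨d2, e2, f2⟩, ⟨d3, e3, f3⟩, ⟨d4, e4, f4⟩⟩ := h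
  have hc : Cn G (insert a D1 ∪ D2) := (h3.insert e1 f1).union h4 ⟨a, Or.inl rfl, d2, e2, Or.inr f2⟩
  obtain ⟨p, m, hp, g1, g2, g3, g4, g5⟩ := ipath (R := fun y => y ∈ D1 ∧ G.Adj w y) (Q := fun y => y ∈ D2 ∧ G.Adj w y) hc
    (Or.inl (Or.inr e3)) ⟨e3, f3⟩ (Or.inr e4) ⟨e4, f4⟩
  obtain ⟨c, hcm, hca⟩ : ∃ c ≤ m, p c = a := by
    by_contra hcon
    push Not at hcon
    have : ∀ i ≤ m, p i ∈ D1 := by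
      intro i
      induction i with
      | zero => exact fun _ => g2.1
      | succ i ih =>
        intro hi
        rcases g1 (i+1) hi with (h | h) | h
        · exact absurd h (hcon _ hi)
        · exact h
        · exact absurd (hp.1 i (by omega)) (h5 _ (ih (by omega)) _ h).2
    exact (h5 _ (this m le_rfl) _ g3.1).1 rfl
  refine ⟨p, m, c, ⟨hp, fun i hi => ?_, fun i hi => ⟨fun e => ?_, ?_⟩, fun i hi e => ?_⟩, ?_, ?_, hca⟩
  · rcases g1 i hi with (h | h) | h
    · exact h ▸ haX
    · exact h1 h
    · exact h2 h
  · rcases g1 i hi with (h | h) | h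
    · exact absurd (h ▸ e) hn
    · by_contra hcon; exact g5 i (by omega) hi ⟨h, e⟩
    · by_contra hcon; exact g4 i (by omega) ⟨h, e⟩
  · rintro (rfl | rfl)
    · exact g2.2
    · exact g3.2
  · rcases g1 i hi with (h | h) | h
    · exact haw (h.symm.trans e)
    · exact h8 (e ▸ h)
    · exact h9 (e ▸ h)
  · rcases Nat.eq_zero_or_pos c with rfl | h
    · exact absurd (hca ▸ g2.1) h6
    · exact h
  · rcases hcm.lt_or_eq with h | rfl
    · exact h
    · exact absurd (hca ▸ g3.1) h7

lemma th_on {p : ℕ → V} {m c : ℕ} (hp : Ho G X p m w) (hwX : w ∈ X) (hc : 1 < c) (hcm : c < m) : Th G X (p c) (p 0) := by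
  obtain ⟨h0, hpX, hw, hwp⟩ := hp
  have w0 : G.Adj w (p 0) := (hw 0 (by omega)).2 (Or.inl rfl)
  have wm : G.Adj w (p m) := (hw m (by omega)).2 (Or.inr rfl)
  refine ⟨p '' Set.Icc 1 (c-1), insert w (p '' Set.Icc (c+1) m), ?_, ?_, h0.seg (by omega) (by omega),
    (h0.seg (by omega) le_rfl).insert ⟨m, by simp; omega, rfl⟩ wm, ?_, ?_, ?_, ?_, ?_, ⟨p (c-1), ⟨c-1, by simp; omega, rfl⟩, ?_⟩,
    ⟨p (c+1), Or.inr ⟨c+1, by simp; omega, rfl⟩, h0.1 c (by omega)⟩, ⟨p 1, ⟨1, by simp; omega, rfl⟩, h0.1 0 (by omega)⟩, ⟨w, Or.inl rfl, w0.symm⟩⟩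
  · rintro _ ⟨i, hi, rfl⟩; simp at hi; exact hpX i (by omega)
  · rintro _ (rfl | ⟨i, hi, rfl⟩)
    · exact hwX
    · simp at hi; exact hpX i (by omega)
  · refine Anti.symm (Anti.insert (h0.anti ?_ ?_ ?_) ?_)
    all_goals try (simp only [Set.mem_Icc]; intros; omega)
    rintro _ ⟨l, hl, rfl⟩
    simp only [Set.mem_Icc] at hl
    exact ⟨(hwp l (by omega)).symm, fun e => by have := (hw l (by omega)).1 e; omega⟩
  · rintro ⟨l, hl, e⟩; simp at hl; have := h0.inj (by omega) (by omega) e; omega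
  · rintro (e | ⟨l, hl, e⟩)
    · exact hwp c (by omega) e
    · simp at hl; have := h0.inj (by omega) (by omega) e; omega
  · rintro ⟨l, hl, e⟩; simp at hl; have := h0.inj (by omega) (by omega) e; omega
  · rintro (e | ⟨l, hl, e⟩)
    · exact hwp 0 (by omega) e
    · simp at hl; have := h0.inj (by omega) (by omega) e; omega
  · have := h0.1 (c-1) (by omega); rw [show c - 1 + 1 = c by omega] at this; exact this.symm

lemma th_step (hT : Tf G) (hS : Star G) (hX : NoCC G X) (haX : a ∈ X) (hw : w ∈ Nn G X a) (h : Th G X a w) (hw' : w' ∈ Nn G X a)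
    (hww : G.Adj w w') : Th G X a w' := by
  obtain ⟨p, m, c, hp, hc, hcm, rfl⟩ := th_hole h haX hw.2.1.symm (fun h => hw.2.2 h.symm)
  obtain ⟨h0, hpX, hwa, hwp⟩ := id hp
  have hwc : ¬ G.Adj w' (p c) := fun h => hw'.2.2 h.symm
  by_cases hon : ∃ i ≤ m, p i = w'
  · obtain ⟨i, hi, rfl⟩ := hon
    rcases (hwa i hi).1 hww with rfl | rfl
    · refine th_on hp hw.1 ?_ hcm
      by_contra hc1
      exact hwc (by rw [show c = 0 + 1 by omega]; exact h0.1 0 (by omega))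
    · have := th_on hp.rev hw.1 (c := i - c) ?_ (by omega)
      · simpa [show i - (i - c) = c by omega] using this
      · by_contra hc1
        exact hwc (by rw [show i = c + 1 by omega]; exact (h0.1 c (by omega)).symm)
  push Not at hon
  have haw : p c ∈ Nn G X w := ⟨haX, hw.2.1.symm, fun h => hw.2.2 h.symm⟩
  have w0 : G.Adj w (p 0) := (hwa 0 (by omega)).2 (Or.inl rfl)
  have wm : G.Adj w (p m) := (hwa m (by omega)).2 (Or.inr rfl)
  have hnp : ∀ i ≤ m, ¬ G.Adj w' (p i) := by
    intro i hi e
    have e3 := hT w' w (p i) hww.symm e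
    have : i ≠ 0 ∧ i ≠ m := ⟨fun h => e3 (h ▸ w0), fun h => e3 (h ▸ wm)⟩
    refine hS w' w (p i) hww.symm e (hwp i hi).symm e3 (p '' Set.Icc 0 (i-1)) (p '' Set.Icc (i+1) m) (h0.seg (by omega) (by omega)) (h0.seg (by omega) le_rfl)
      (h0.anti ?_ ?_ ?_) ?_ ?_ ?_ ?_ ?_ ?_ ⟨p 0, ⟨0, by simp, rfl⟩, w0⟩ ⟨p m, ⟨m, by simp; omega, rfl⟩, wm⟩ ⟨p (i-1), ⟨i-1, by simp, rfl⟩, ?_⟩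
      ⟨p (i+1), ⟨i+1, by simp; omega, rfl⟩, h0.1 i (by omega)⟩
    all_goals try (simp only [Set.mem_Icc]; intros; omega)
    · rintro ⟨l, hl, e⟩; simp at hl; exact hon l (by omega) e
    · rintro ⟨l, hl, e⟩; simp at hl; exact hon l (by omega) e
    · rintro ⟨l, hl, e⟩; simp at hl; exact hwp l (by omega) e
    · rintro ⟨l, hl, e⟩; simp at hl; exact hwp l (by omega) e
    · rintro ⟨l, hl, e⟩; simp at hl; have := h0.inj (by omega) (by omega) e; omega
    · rintro ⟨l, hl, e⟩; simp at hl; have := h0.inj (by omega) (by omega) e; omega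
    · have := h0.1 (i-1) (by omega); rw [show i - 1 + 1 = i by omega] at this; exact this.symm
  obtain ⟨e, he, hwe⟩ := nn_att hT hX haw hw'.1 hww
  obtain ⟨s, n, hs, g1, g2, g3, g4, g5⟩ := ipath (R := fun y => G.Adj w' y) (Q := fun y => ∃ j, 0 < j ∧ j < m ∧ (y = p j ∨ G.Adj y (p j)))
    (nn_cn hT hS hX hw.1 haw) he hwe haw ⟨c, hc, hcm, Or.inl rfl⟩
  have hsp : ∀ i ≤ n, ∀ j ≤ m, s i ≠ p j := by
    intro i hi j hj e
    have hj0 : j ≠ 0 := fun h => (g1 i hi).2.2 (by rw [e, h]; exact w0)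
    have hjm : j ≠ m := fun h => (g1 i hi).2.2 (by rw [e, h]; exact wm)
    have : i = n := by by_contra h; exact g4 i (by omega) ⟨j, by omega, by omega, Or.inl e⟩
    rcases Nat.eq_zero_or_pos i with hi0 | hi0
    · exact hnp j hj (by rw [← e, hi0]; exact g2)
    · refine g4 (i-1) (by omega) ⟨j, by omega, by omega, Or.inr ?_⟩
      have := hs.1 (i-1) (by omega); rw [show i - 1 + 1 = i by omega] at this; rwa [← e]
  obtain ⟨z, hz0, hzm, hz⟩ := g3
  have hlv : Lv G p m w w' s n z := ⟨hs, hww, fun i hi => (g1 i hi).2, g2, g5, fun i hi e => (g1 i hi).2.2 (e ▸ hww),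
    fun i hi => ⟨hon i hi, hnp i hi⟩, hsp, fun i hi j hj hj' e => g4 i hi ⟨j, hj, hj', Or.inr e⟩, hz0, hzm, hz.resolve_left (hsp n le_rfl z (by omega))⟩
  rcases le_total c z with hcz | hcz
  · exact hlv.th hT hS hp hc hcz hw.1 (fun i hi => (g1 i hi).1)
  · have := hlv.rev.th hT hS hp.rev (c := m - c) (by omega) (by omega) hw.1 (fun i hi => (g1 i hi).1)
    simpa [show m - (m - c) = c by omega] using this

lemma th_all (hT : Tf G) (hS : Star G) (hX : NoCC G X) (haX : a ∈ X) (hw : w ∈ Nn G X a) : Th G X a w := by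
  obtain ⟨s, hs, h⟩ := th_base hT hS hX haX hw
  have hr := (nn_cn hT hS hX haX hw).2 s hs w hw
  exact hr.ind (P := {y | Th G X a y}) h (fun b hb hbD c hc hbc => th_step hT hS hX haX hbD hb hc hbc)

lemma sep_ex [Finite V] (hT : Tf G) (hS : Star G) (ha : a ∈ U) (hu : u ∈ U) (hau : a ≠ u) (h1 : G.Adj v a) (h2 : G.Adj v u) :
    ∃ K, CK G K ∧ a ∉ K ∧ u ∉ K ∧ ¬ Rch G ((U \ {v}) \ K) a u := by
  by_contra hcon
  push Not at hcon
  obtain ⟨X, ⟨hXU, haX, huX, hXK⟩, hmin⟩ := (toFinite {X : Set V | X ⊆ U \ {v} ∧ a ∈ X ∧ u ∈ X ∧ ∀ K, CK G K → a ∉ K → u ∉ K → Rch G (X \ K) a u}).exists_minimal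
    ⟨U \ {v}, subset_rfl, ⟨ha, h1.ne'⟩, ⟨hu, h2.ne'⟩, hcon⟩
  have hX : NoCC G X := by
    have main : ∀ K, CK G K → ∀ x ∈ X, x ∉ K → a ∉ cmp G (X \ K) x → u ∉ cmp G (X \ K) x → False := by
      intro K hK x hx hxK h3 h4
      have hxD : x ∈ X \ K := ⟨hx, hxK⟩
      have := hmin (y := X \ cmp G (X \ K) x) ⟨sdiff_subset.trans hXU, ⟨haX, h3⟩, ⟨huX, h4⟩, ?_⟩ sdiff_subset hx
      · exact this.2 mem_cmp
      intro K' hK' h5 h6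
      have hstep : ∀ b ∈ cmp G (X \ K) x, ∀ y ∈ X, y ∉ cmp G (X \ K) x → G.Adj b y → y ∈ K := by
        intro b hb y hy hyn hby
        by_contra hyK; exact hyn (cmp_step hxD hb ⟨hy, hyK⟩ hby)
      have hKK : ∀ c ∈ K, ∀ d ∈ K, c = d ∨ G.Adj c d := by
        rcases hK with rfl | ⟨k0, k1, rfl, h⟩
        · simp
        · rintro c (rfl | rfl) d (rfl | rfl)
          · exact Or.inl rfl
          · exact h
          · exact h.imp Eq.symm (fun h => h.symm)
          · exact Or.inl rfl
      have hKn : ∀ c ∈ K, c ∉ cmp G (X \ K) x := fun c hc h => (cmp_sub hxD h).2 hc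
      obtain ⟨R, hR⟩ : ∃ R, R = (X \ cmp G (X \ K) x) \ K' := ⟨_, rfl⟩
      have key : ∀ y, Rch G (X \ K') a y → (y ∉ cmp G (X \ K) x → Rch G R a y) ∧
          (y ∈ cmp G (X \ K) x → ∃ c ∈ K, c ∈ X ∧ c ∉ K' ∧ Rch G R a c) := by
        intro y h
        induction h with
        | refl => exact ⟨fun _ => .refl, fun h => absurd h h3⟩
        | @tail b c _ h ih =>
          by_cases hb : b ∈ cmp G (X \ K) x <;> by_cases hc : c ∈ cmp G (X \ K) x <;>
            simp only [hb, hc, not_true_eq_false, not_false_eq_true, false_imp_iff, true_imp_iff, and_true, true_and] at ih ⊢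
          · exact ih
          · obtain ⟨e, g1, g2, g3, g4⟩ := ih
            refine g4.trans ?_
            rcases hKK e g1 c (hstep b hb c h.2.2.1 hc h.1) with rfl | g
            · exact .refl
            · exact Rch.adj g (hR ▸ ⟨⟨g2, hKn e g1⟩, g3⟩) (hR ▸ ⟨⟨h.2.2.1, hc⟩, h.2.2.2⟩)
          · exact ⟨b, hstep c hc b h.2.1.1 hb h.1.symm, h.2.1.1, h.2.1.2, ih⟩
          · exact ih.trans (Rch.adj h.1 (hR ▸ ⟨⟨h.2.1.1, hb⟩, h.2.1.2⟩) (hR ▸ ⟨⟨h.2.2.1, hc⟩, h.2.2.2⟩))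
      exact hR ▸ (key u (hXK K' hK' h5 h6)).1 h4
    intro K hK x hx hxK y hy hyK
    by_contra hxy
    have d : ∀ z, z ∈ cmp G (X \ K) x → z ∈ cmp G (X \ K) y → False := fun z h h' => hxy (Rch.trans h (Rch.symm h'))
    have hauK : a ∉ K → u ∉ K → ∀ x, x ∈ X \ K → (a ∈ cmp G (X \ K) x ↔ u ∈ cmp G (X \ K) x) := fun h h' x _ =>
      ⟨fun e => Rch.trans e (hXK K hK h h'), fun e => Rch.trans e (hXK K hK h h').symm⟩
    have hKs : ∀ x, x ∈ X \ K → ∀ c ∈ cmp G (X \ K) x, c ∉ K := fun x hx c hc => (cmp_sub hx hc).2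
    have m1 := main K hK x hx hxK
    have m2 := main K hK y hy hyK
    have d1 := d a
    have d2 := d u
    have e1 := fun h h' => hauK h h' x ⟨hx, hxK⟩
    have e2 := fun h h' => hauK h h' y ⟨hy, hyK⟩
    have f1 := hKs x ⟨hx, hxK⟩ a
    have f2 := hKs x ⟨hx, hxK⟩ u
    have f3 := hKs y ⟨hy, hyK⟩ a
    have f4 := hKs y ⟨hy, hyK⟩ u
    by_cases c1 : a ∈ cmp G (X \ K) x
    · exact m2 (d1 c1) fun c2 => d1 c1 ((e2 (f1 c1) (f4 c2)).2 c2)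
    · refine m1 c1 fun c2 => m2 (fun c3 => c1 ((e1 (f3 c3) (f2 c2)).2 c2)) (d2 c2)
  obtain ⟨D1, D2, g1, g2, g3, g4, g5, g6, g7, g8, g9, g10, g11, g12, g13⟩ :=
    th_all hT hS hX haX ⟨huX, hau.symm, hT v a u h1 h2⟩
  exact hS v a u h1 h2 hau (hT v a u h1 h2) D1 D2 g3 g4 g5 (fun h => (hXU (g1 h)).2 rfl) (fun h => (hXU (g2 h)).2 rfl) g6 g7 g8 g9 g10 g11 g12 g13
end Paper

namespace Paper
variable {V : Type} {G G' : SimpleGraph V} {A B C D P S X Z U K L : Set V} {x y z v w w' a u k0 k1 : V} {𝓑 : Set (Set V)} {k : ℕ}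

def Lgt (G : SimpleGraph V) (U : Set V) (y : V) : Prop := ∃ b c, ∀ z ∈ U, G.Adj y z → z = b ∨ z = c

structure ApD (G : SimpleGraph V) (U : Set V) (𝓑 : Set (Set V)) (a : V) where
  (v k0 k1 p q u : V)
  (L0 L1 D : Set V)
  aU : a ∈ U
  kU0 : k0 ∈ U
  kU1 : k1 ∈ U
  kk : G.Adj k0 k1
  ha : ¬ Lgt G U a
  h0 : ¬ Lgt G U k0
  h1 : ¬ Lgt G U k1
  c0 : Cn G L0
  c1 : Cn G L1
  s0 : L0 ⊆ U
  s1 : L1 ⊆ U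
  l0 : ∀ y ∈ L0, Lgt G U y
  l1 : ∀ y ∈ L1, Lgt G U y
  n0 : ∀ y ∈ L0, ∀ z ∈ U, G.Adj y z → z ∈ L0 ∨ z = a ∨ z = k0
  n1 : ∀ y ∈ L1, ∀ z ∈ U, G.Adj y z → z ∈ L1 ∨ z = a ∨ z = k1
  dj : ∀ y ∈ L0, y ∉ L1
  pL : p ∈ L0
  qL : q ∈ L1
  ap : G.Adj a p
  aq : G.Adj a q
  na : ∀ z ∈ U, G.Adj a z → z = v ∨ z = p ∨ z = q
  t0 : Att G k0 L0
  t1 : Att G k1 L1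
  br : ∀ X ∈ 𝓑, v ∉ X → k0 ∉ X → k1 ∉ X → ∀ y ∈ X, y ≠ a ∧ y ∉ L0 ∧ y ∉ L1
  cD : Cn G D
  sD : D ⊆ U
  nD : ∀ y ∈ D, ∀ z ∈ U, G.Adj y z → z ∈ D ∨ z = v ∨ z = k0 ∨ z = k1
  D0 : k0 ∉ D
  D1 : k1 ∉ D
  tD0 : Att G k0 D
  tD1 : Att G k1 D
  uD : u ∈ D
  hu : ¬ Lgt G U u
  dD : ∀ y ∈ D, y ≠ a ∧ y ∉ L0 ∧ y ∉ L1
  vn : v ∉ D ∧ v ∉ L0 ∧ v ∉ L1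

def ApD.swap (h : ApD G U 𝓑 a) : ApD G U 𝓑 a :=
  { v := h.v, k0 := h.k1, k1 := h.k0, p := h.q, q := h.p, u := h.u, L0 := h.L1, L1 := h.L0, D := h.D, aU := h.aU, kU0 := h.kU1, kU1 := h.kU0,
    kk := h.kk.symm, ha := h.ha, h0 := h.h1, h1 := h.h0, c0 := h.c1, c1 := h.c0, s0 := h.s1, s1 := h.s0, l0 := h.l1, l1 := h.l0, n0 := h.n1,
    n1 := h.n0, dj := fun y h1 h2 => h.dj y h2 h1, pL := h.qL, qL := h.pL, ap := h.aq, aq := h.ap, na := fun z h1 h2 => by have := h.na z h1 h2; tauto,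
    t0 := h.t1, t1 := h.t0, br := fun X hX h1 h2 h3 y hy => by have := h.br X hX h1 h3 h2 y hy; tauto, cD := h.cD, sD := h.sD,
    nD := fun y h1 z h2 h3 => by have := h.nD y h1 z h2 h3; tauto, D0 := h.D1, D1 := h.D0, tD0 := h.tD1, tD1 := h.tD0, uD := h.uD, hu := h.hu,
    dD := fun y hy => by have := h.dD y hy; tauto, vn := ⟨h.vn.1, h.vn.2.2, h.vn.2.1⟩ }

structure Sd (G : SimpleGraph V) (U A B : Set V) (v k0 k1 a : V) : Prop where
  AU : A ⊆ U
  BU : B ⊆ U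
  cB : Cn G B
  hA : ∀ y ∈ A, ∀ z ∈ U, G.Adj y z → z ∈ A ∨ z = v ∨ z = k0 ∨ z = k1
  hB : ∀ y ∈ B, ∀ z ∈ U, G.Adj y z → z ∈ B ∨ z = v ∨ z = k0 ∨ z = k1
  vA : v ∉ A
  kA0 : k0 ∉ A
  kA1 : k1 ∉ A
  vB : v ∉ B
  kB0 : k0 ∉ B
  kB1 : k1 ∉ B
  an : Anti G A B
  aA : a ∈ A
  va : G.Adj v a
  tv : Att G v B
  t0 : Att G k0 B
  t1 : Att G k1 B
  kk : G.Adj k0 k1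
  n0 : v ≠ k0
  n1 : v ≠ k1
  mn : ∀ D ⊆ A, Cn G D → Att G v D → Att G k0 D → Att G k1 D → A ⊆ D

lemma Sd.swap (h : Sd G U A B v k0 k1 a) : Sd G U A B v k1 k0 a :=
  { h with hA := fun y h1 z h2 h3 => by have := h.hA y h1 z h2 h3; tauto, hB := fun y h1 z h2 h3 => by have := h.hB y h1 z h2 h3; tauto,
           kA0 := h.kA1, kA1 := h.kA0, kB0 := h.kB1, kB1 := h.kB0, t0 := h.t1, t1 := h.t0, kk := h.kk.symm, n0 := h.n1, n1 := h.n0,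
           mn := fun D h1 h2 h3 h4 h5 => h.mn D h1 h2 h3 h5 h4 }

lemma IPf.pred {p : ℕ → V} {m i : ℕ} (h : IPf G p m) (h1 : 0 < i) (h2 : i ≤ m) : G.Adj (p i) (p (i-1)) := by
  have := h.1 (i-1) (by omega); rw [show i - 1 + 1 = i by omega] at this; exact this.symm

lemma arm {p : ℕ → V} {m c : ℕ} {E : Set V} (hT : Tf G) (hS : Star G) (hp : IPf G p m) (hv : ∀ i ≤ m, p i ≠ v) (hva : G.Adj v (p 0))
    (hE : Cn G E) (hvE : v ∉ E) (hpE : ∀ i ≤ m, p i ∉ E) (haE : Att G (p 0) E) (hmE : Att G (p m) E)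
    (hn : ∀ i, 0 < i → i < m → ∀ e ∈ E, ¬ G.Adj (p i) e) (hc : 0 < c) (hcm : c ≤ m) (hvc : G.Adj v (p c)) : False := by
  have h1 := hT _ _ _ hva hvc
  have hc1 : c ≠ 1 := by rintro rfl; exact h1 (hp.1 0 (by omega))
  refine hS v (p 0) (p c) hva hvc (fun e => by have := hp.inj (by omega) (by omega) e; omega) h1 (p '' Set.Icc 1 (c-1)) (p '' Set.Icc (c+1) m ∪ E)
    (hp.seg (by omega) (by omega)) ?_ ?_ ?_ ?_ ?_ ?_ ?_ ?_ ⟨p 1, ⟨1, by simp; omega, rfl⟩, hp.1 0 (by omega)⟩ (haE.mono subset_union_right)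
    ⟨p (c-1), ⟨c-1, by simp; omega, rfl⟩, hp.pred hc hcm⟩ ?_
  · by_cases e : c = m
    · subst e; simpa using hE
    · obtain ⟨d, hd, h⟩ := hmE
      exact (hp.seg (by omega) le_rfl).union hE ⟨p m, ⟨m, by simp; omega, rfl⟩, d, hd, Or.inr h⟩
  · refine Anti.union' (hp.anti ?_ ?_ ?_) ?_
    all_goals try (simp only [Set.mem_Icc]; intros; omega)
    rintro _ ⟨i, hi, rfl⟩ e he
    simp only [Set.mem_Icc] at hi
    exact ⟨fun h => hpE i (by omega) (h ▸ he), hn i (by omega) (by omega) e he⟩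
  · rintro ⟨l, hl, e⟩; simp at hl; exact hv l (by omega) e
  · rintro (⟨l, hl, e⟩ | h)
    · simp at hl; exact hv l (by omega) e
    · exact hvE h
  · rintro ⟨l, hl, e⟩; simp at hl; have := hp.inj (by omega) (by omega) e; omega
  · rintro (⟨l, hl, e⟩ | h)
    · simp at hl; have := hp.inj (by omega) (by omega) e; omega
    · exact hpE 0 (by omega) h
  · rintro ⟨l, hl, e⟩; simp at hl; have := hp.inj (by omega) (by omega) e; omega
  · rintro (⟨l, hl, e⟩ | h)
    · simp at hl; have := hp.inj (by omega) (by omega) e; omega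
    · exact hpE c (by omega) h
  · by_cases e : c = m
    · subst e; exact hmE.mono subset_union_right
    · exact ⟨p (c+1), Or.inl ⟨c+1, by simp; omega, rfl⟩, hp.1 c (by omega)⟩

lemma Sd.one {p : ℕ → V} {m : ℕ} (hT : Tf G) (hS : Star G) (h : Sd G U A B v k0 k1 a) (hp : IPf G p m) (hpA : ∀ i ≤ m, p i ∈ A) (hp0 : p 0 = a)
    (hpm : G.Adj k0 (p m)) (hpn : ∀ i < m, ¬ G.Adj k0 (p i)) (hk1 : ∃ i ≤ m, G.Adj k1 (p i)) : Lgt G U a := by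
  have hAp : A ⊆ p '' Set.Icc 0 m := by
    obtain ⟨i, hi, hk⟩ := hk1
    refine h.mn _ ?_ (hp.seg (by omega) le_rfl) ⟨p 0, ⟨0, by simp, rfl⟩, hp0 ▸ h.va⟩ ⟨p m, ⟨m, by simp, rfl⟩, hpm⟩ ⟨p i, ⟨i, by simpa using hi, rfl⟩, hk⟩
    rintro _ ⟨i, hi, rfl⟩; exact hpA i hi.2
  by_cases hka : G.Adj k1 a
  · exfalso
    have hm : 0 < m := by
      by_contra hm
      have : m = 0 := by omega
      subst this
      exact hT k1 a k0 hka h.kk.symm (hp0 ▸ hpm.symm)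
    have hvp : ∀ c, 0 < c → c ≤ m → ¬ G.Adj v (p c) := by
      intro c hc hcm hvc
      have hk1p : ∀ i, 0 < i → i ≤ m → ¬ G.Adj k1 (p i) := by
        intro i hi him hk
        have := h.mn (p '' Set.Icc 1 m) ?_ (hp.seg (by omega) le_rfl) ⟨p c, ⟨c, ⟨hc, hcm⟩, rfl⟩, hvc⟩ ⟨p m, ⟨m, ⟨hm, le_rfl⟩, rfl⟩, hpm⟩
          ⟨p i, ⟨i, ⟨hi, him⟩, rfl⟩, hk⟩ h.aA
        · obtain ⟨l, hl, e⟩ := this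
          have := hp.inj hl.2 (by omega) (e.trans hp0.symm); simp at hl; omega
        · rintro _ ⟨i, hi, rfl⟩; exact hpA i hi.2
      refine arm hT hS hp (E := {k0, k1}) (fun i hi (e : p i = v) => h.vA (e ▸ hpA i hi)) (hp0 ▸ h.va) ((Cn_single (x := k1)).insert rfl h.kk) ?_ ?_
        ⟨k1, by simp, hp0 ▸ hka.symm⟩ ⟨k0, by simp, hpm.symm⟩ ?_ hc hcm hvc
      · rintro (e | e)
        · exact h.n0 e
        · exact h.n1 e
      · rintro i hi (e | e)
        · exact h.kA0 (e ▸ hpA i hi)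
        · exact h.kA1 (e ▸ hpA i hi)
      · rintro i hi him e (rfl | rfl)
        · exact fun h => hpn i him h.symm
        · exact fun h => hk1p i hi (by omega) h.symm
    have hLA : p '' Set.Icc 1 m ⊆ A := by rintro _ ⟨i, hi, rfl⟩; exact hpA i hi.2
    obtain ⟨d, hd, hvd⟩ := h.tv
    refine hS k1 a k0 hka h.kk.symm (fun e => h.kA0 (e ▸ h.aA)) (hT k1 a k0 hka h.kk.symm) (p '' Set.Icc 1 m) (insert v B) (hp.seg (by omega) le_rfl)
      (h.cB.insert hd hvd) ?_ (fun e => h.kA1 (hLA e)) ?_ ?_ ?_ (fun e => h.kA0 (hLA e)) ?_ ⟨p 1, ⟨1, by simp; omega, rfl⟩, hp0 ▸ hp.1 0 hm⟩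
      ⟨v, Or.inl rfl, h.va.symm⟩ ⟨p m, ⟨m, by simp; omega, rfl⟩, hpm⟩ (h.t0.mono (Set.subset_insert _ _))
    · refine Anti.symm (Anti.insert (h.an.symm.mono subset_rfl hLA) ?_)
      rintro _ ⟨i, hi, rfl⟩
      exact ⟨fun e => h.vA (e ▸ hpA i hi.2), hvp i hi.1 hi.2⟩
    · rintro (e | e)
      · exact h.n1 e.symm
      · exact h.kB1 e
    · rintro ⟨l, hl, e⟩
      have := hp.inj hl.2 (by omega) (e.trans hp0.symm); simp at hl; omega
    · rintro (e | e)
      · exact h.va.ne e.symm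
      · exact (h.an a h.aA a e).1 rfl
    · rintro (e | e)
      · exact h.n0 e.symm
      · exact h.kB0 e
  · refine ⟨v, if m = 0 then k0 else p 1, fun z hz haz => ?_⟩
    rcases h.hA a h.aA z hz haz with h1 | h1 | h1 | h1
    · obtain ⟨i, hi, rfl⟩ := hAp h1
      right
      have := hp.adj (by omega) hi.2 (hp0.symm ▸ haz)
      simp at hi
      rw [if_neg (by omega), show i = 1 by omega]
    · exact Or.inl h1
    · right
      split_ifs with hm
      · exact h1
      · exact absurd (by rw [hp0, ← h1]; exact haz.symm) (hpn 0 (by omega))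
    · exact absurd (h1 ▸ haz.symm) hka

lemma Sd.nt {p q : ℕ → V} {m n i j : ℕ} (h : Sd G U A B v k0 k1 a) (hp : IPf G p m) (hq : IPf G q n) (hpA : ∀ i ≤ m, p i ∈ A) (hqA : ∀ i ≤ n, q i ∈ A)
    (hp0 : p 0 = a) (hq0 : q 0 = a) (hpm : G.Adj k0 (p m)) (hqn : G.Adj k1 (q n)) (hpq : p 1 ≠ q 1) (hi' : i ≤ m) (hj : 0 < j)
    (hj' : j ≤ n) (ht : p i = q j ∨ G.Adj (p i) (q j)) : j = 1 := by
  by_contra hj1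
  have := h.mn (p '' Set.Icc 0 m ∪ q '' Set.Icc j n) ?_ ((hp.seg (by omega) le_rfl).union (hq.seg hj' le_rfl)
    ⟨p i, ⟨i, by simpa using hi', rfl⟩, q j, ⟨j, by simpa using hj', rfl⟩, ht⟩) ⟨p 0, Or.inl ⟨0, by simp, rfl⟩, hp0 ▸ h.va⟩
    ⟨p m, Or.inl ⟨m, by simp, rfl⟩, hpm⟩ ⟨q n, Or.inr ⟨n, by simpa using hj', rfl⟩, hqn⟩ (hqA 1 (by omega))
  · rcases this with ⟨l, hl, e⟩ | ⟨l, hl, e⟩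
    · have h1 : G.Adj (p 0) (p l) := by rw [e, hp0, ← hq0]; exact hq.1 0 (by omega)
      have := hp.adj (by omega) hl.2 h1
      rw [show l = 1 by omega] at e; exact hpq e
    · have := hq.inj hl.2 (by omega) e; simp at hl; omega
  · rintro _ (⟨l, hl, rfl⟩ | ⟨l, hl, rfl⟩)
    · exact hpA l hl.2
    · exact hqA l hl.2
end Paper

namespace Paper
variable {V : Type} {G G' : SimpleGraph V} {A B C D P S X Z U K L E : Set V} {x y z v w w' a u k0 k1 : V} {𝓑 : Set (Set V)} {k : ℕ}

lemma nlgt {p q r : V} (hp : p ∈ U) (hq : q ∈ U) (hr : r ∈ U) (h1 : G.Adj y p) (h2 : G.Adj y q) (h3 : G.Adj y r) (hpq : p ≠ q) (hpr : p ≠ r) (hqr : q ≠ r) :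
    ¬ Lgt G U y := by
  rintro ⟨b, c, h⟩
  rcases h p hp h1 with rfl | rfl <;> rcases h q hq h2 with e | e <;> rcases h r hr h3 with e' | e' <;> subst_vars <;> simp_all

lemma Sd.half {p q : ℕ → V} {m n : ℕ} (hT : Tf G) (hS : Star G) (h : Sd G U A B v k0 k1 a) (hp : IPf G p m) (hq : IPf G q n) (hpA : ∀ i ≤ m, p i ∈ A) (hqA : ∀ i ≤ n, q i ∈ A)
    (hp0 : p 0 = a) (hq0 : q 0 = a) (hpm : G.Adj k0 (p m)) (hqn : G.Adj k1 (q n)) (hpk : ∀ i < m, ¬ G.Adj k0 (p i)) (hn : 0 < n)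
    (hk1 : ∀ i ≤ m, ¬ G.Adj k1 (p i)) (hnt : ∀ i j, 0 < i → i ≤ m → 0 < j → j ≤ n → ¬ (p i = q j ∨ G.Adj (p i) (q j)))
    (hAA : A ⊆ p '' Set.Icc 0 m ∪ q '' Set.Icc 0 n) : ∀ i, 0 < i → i ≤ m → Lgt G U (p i) ∧ ∀ z ∈ U, G.Adj (p i) z → z ∈ p '' Set.Icc 1 m ∨ z = a ∨ z = k0 := by
  intro i hi him
  have hvp : ¬ G.Adj v (p i) := by
    refine fun hvc => arm hT hS hp (E := insert k0 (insert k1 (q '' Set.Icc 1 n))) (fun i hi (e : p i = v) => h.vA (e ▸ hpA i hi)) (hp0 ▸ h.va)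
      (((hq.seg hn le_rfl).insert (x := k1) ⟨n, by simp; omega, rfl⟩ hqn).insert (Or.inl rfl) h.kk) ?_ ?_ ⟨q 1, Or.inr (Or.inr ⟨1, by simp; omega, rfl⟩), ?_⟩ 
      ⟨k0, Or.inl rfl, hpm.symm⟩ ?_ hi him hvc
    · rintro (e | e | ⟨j, hj, e⟩)
      · exact h.n0 e
      · exact h.n1 e
      · exact h.vA (e ▸ hqA j hj.2)
    · rintro i hi (e | e | ⟨j, hj, e⟩)
      · exact h.kA0 (e ▸ hpA i hi)
      · exact h.kA1 (e ▸ hpA i hi)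
      · rcases Nat.eq_zero_or_pos i with rfl | h0
        · have := hq.inj hj.2 (by omega) (e.trans (hp0.trans hq0.symm)); simp at hj; omega
        · exact hnt i j h0 hi hj.1 hj.2 (Or.inl e.symm)
    · have := hq.1 0 hn; rw [hq0] at this; rw [hp0]; exact this
    · rintro i hi him e (rfl | rfl | ⟨j, hj, rfl⟩) h'
      · exact hpk i him h'.symm
      · exact hk1 i him.le h'.symm
      · exact hnt i j hi him.le hj.1 hj.2 (Or.inr h')
  have key : ∀ z ∈ U, G.Adj (p i) z → z = p (i-1) ∨ (i = m ∧ z = k0) ∨ (i < m ∧ z = p (i+1)) := by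
    intro z hz hiz
    rcases h.hA _ (hpA i him) z hz hiz with h1 | rfl | rfl | rfl
    · have : ∀ l ≤ m, p l = z → _ := fun l hl e => hp.adj him hl (e.symm ▸ hiz)
      rcases hAA h1 with ⟨l, hl, e⟩ | ⟨l, hl, e⟩
      · rcases this l hl.2 e with h | h
        · right; right; rw [← h, e]; simp at hl; exact ⟨by omega, rfl⟩
        · left; rw [← e, show i - 1 = l by omega]
      · rcases Nat.eq_zero_or_pos l with rfl | h0
        · rw [hq0, ← hp0] at e
          have := this 0 (by omega) e
          left; rw [← e, show i - 1 = 0 by omega]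
        · exact absurd (Or.inr (e.symm ▸ hiz)) (hnt i l hi him h0 hl.2)
    · exact absurd hiz.symm hvp
    · refine Or.inr (Or.inl ⟨?_, rfl⟩)
      by_contra hne
      exact hpk i (by omega) hiz.symm
    · exact absurd hiz.symm (hk1 i him)
  refine ⟨⟨p (i-1), if i = m then k0 else p (i+1), fun z hz hiz => ?_⟩, fun z hz hiz => ?_⟩
  · rcases key z hz hiz with h | h | h
    · exact Or.inl h
    · rw [if_pos h.1]; exact Or.inr h.2
    · rw [if_neg (by omega)]; exact Or.inr h.2
  · rcases key z hz hiz with rfl | h | ⟨h, rfl⟩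
    · by_cases h1 : i = 1
      · subst h1; exact Or.inr (Or.inl hp0)
      · exact Or.inl ⟨i-1, by simp; omega, rfl⟩
    · exact Or.inr (Or.inr h.2)
    · exact Or.inl ⟨i+1, by simp; omega, rfl⟩

lemma Sd.ap {X0 : Set V} (hT : Tf G) (hS : Star G) (hB : Bm G U k 𝓑) (h : Sd G U A B v k0 k1 a) (hA : Cn G A) (hU0 : k0 ∈ U) (hU1 : k1 ∈ U)
    (hX0 : X0 ∈ 𝓑) (h0 : Anti G A X0) (ht0 : Att G k0 A) (ht1 : Att G k1 A) (hu : u ∈ B) (hul : ¬ Lgt G U u) (hal : ¬ Lgt G U a) : Nonempty (ApD G U 𝓑 a) := by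
  obtain ⟨y0, hy0, hky0⟩ := ht0
  obtain ⟨y1, hy1, hky1⟩ := ht1
  obtain ⟨p, m, hp, hpA, hp0, hpm, hpk, -⟩ := ipath (R := fun x => x = a) (Q := fun x => G.Adj k0 x) hA h.aA rfl hy0 hky0
  obtain ⟨q, n, hq, hqA, hq0, hqn, hqk, -⟩ := ipath (R := fun x => x = a) (Q := fun x => G.Adj k1 x) hA h.aA rfl hy1 hky1
  have hk1 : ∀ i ≤ m, ¬ G.Adj k1 (p i) := fun i hi h' => hal (h.one hT hS hp hpA hp0 hpm hpk ⟨i, hi, h'⟩)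
  have hk0 : ∀ i ≤ n, ¬ G.Adj k0 (q i) := fun i hi h' => hal (h.swap.one hT hS hq hqA hq0 hqn hqk ⟨i, hi, h'⟩)
  have hm : 0 < m := by
    by_contra hm
    exact hk0 0 (by omega) (by rw [hq0, ← hp0]; rwa [show m = 0 by omega] at hpm)
  have hn : 0 < n := by
    by_contra hn
    exact hk1 0 (by omega) (by rw [hp0, ← hq0]; rwa [show n = 0 by omega] at hqn)
  have hAA : A ⊆ p '' Set.Icc 0 m ∪ q '' Set.Icc 0 n := by
    refine h.mn _ ?_ ((hp.seg (by omega) le_rfl).union (hq.seg (by omega) le_rfl) ⟨p 0, ⟨0, by simp, rfl⟩, q 0, ⟨0, by simp, rfl⟩, Or.inl (hp0.trans hq0.symm)⟩)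
      ⟨p 0, Or.inl ⟨0, by simp, rfl⟩, hp0 ▸ h.va⟩ ⟨p m, Or.inl ⟨m, by simp, rfl⟩, hpm⟩ ⟨q n, Or.inr ⟨n, by simp, rfl⟩, hqn⟩
    rintro _ (⟨l, hl, rfl⟩ | ⟨l, hl, rfl⟩)
    · exact hpA l hl.2
    · exact hqA l hl.2
  have hap : G.Adj a (p 1) := hp0 ▸ hp.1 0 hm
  have haq : G.Adj a (q 1) := hq0 ▸ hq.1 0 hn
  have hna : ∀ z ∈ U, G.Adj a z → z = v ∨ z = p 1 ∨ z = q 1 := by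
    intro z hz haz
    rcases h.hA a h.aA z hz haz with h1 | h1 | rfl | rfl
    · rcases hAA h1 with ⟨l, hl, e⟩ | ⟨l, hl, e⟩
      · have := hp.adj (i := 0) (by omega) hl.2 (by rw [e, hp0]; exact haz)
        rw [show l = 1 by omega] at e; exact Or.inr (Or.inl e.symm)
      · have := hq.adj (i := 0) (by omega) hl.2 (by rw [e, hq0]; exact haz)
        rw [show l = 1 by omega] at e; exact Or.inr (Or.inr e.symm)
    · exact Or.inl h1
    · exact absurd (hq0 ▸ haz.symm) (hk0 0 (by omega))
    · exact absurd (hp0 ▸ haz.symm) (hk1 0 (by omega))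
  have hpq : p 1 ≠ q 1 := fun e => hal ⟨v, p 1, fun z hz haz => by have := hna z hz haz; rw [← e] at this; tauto⟩
  have hnt : ∀ i j, 0 < i → i ≤ m → 0 < j → j ≤ n → ¬ (p i = q j ∨ G.Adj (p i) (q j)) := by
    intro i j hi him hj hjn ht
    have e1 := h.nt hp hq hpA hqA hp0 hq0 hpm hqn hpq him hj hjn ht
    have e2 := h.swap.nt hq hp hqA hpA hq0 hp0 hqn hpm hpq.symm hjn hi him (ht.imp Eq.symm (fun h => h.symm))
    subst e1 e2
    exact ht.elim hpq (hT a _ _ hap haq)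
  have g0 := h.half hT hS hp hq hpA hqA hp0 hq0 hpm hqn hpk hn hk1 hnt hAA
  have g1 := h.swap.half hT hS hq hp hqA hpA hq0 hp0 hqn hpm hqk hm hk0 (fun i j h1 h2 h3 h4 h5 => hnt j i h3 h4 h1 h2 (h5.imp Eq.symm (fun h => h.symm)))
    (by rw [Set.union_comm]; exact hAA)
  have hLA : ∀ y ∈ p '' Set.Icc 1 m, y ∈ A := by rintro _ ⟨i, hi, rfl⟩; exact hpA i hi.2
  have hLA' : ∀ y ∈ q '' Set.Icc 1 n, y ∈ A := by rintro _ ⟨i, hi, rfl⟩; exact hqA i hi.2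
  have hAB : ∀ {x y}, x ∈ A → y ∈ B → y ≠ x := fun hx hy e => (h.an _ hx _ hy).1 e.symm
  obtain ⟨d0, hd0, hkd0⟩ := h.t0
  obtain ⟨d1, hd1, hkd1⟩ := h.t1
  refine ⟨{ v := v, k0 := k0, k1 := k1, p := p 1, q := q 1, u := u, L0 := p '' Set.Icc 1 m, L1 := q '' Set.Icc 1 n, D := B, aU := h.AU h.aA, kU0 := hU0, kU1 := hU1, kk := h.kk, ha := hal, c0 := hp.seg hm le_rfl, c1 := hq.seg hn le_rfl, s0 := fun y hy => h.AU (hLA y hy), s1 := fun y hy => h.AU (hLA' y hy), pL := ⟨1, by simp; omega, rfl⟩, qL := ⟨1, by simp; omega, rfl⟩, ap := hap, aq := haq, na := hna, t0 := ⟨p m, ⟨m, by simp; omega, rfl⟩, hpm⟩, t1 := ⟨q n, ⟨n, by simp; omega, rfl⟩, hqn⟩, cD := h.cB, sD := h.BU, nD := h.hB, D0 := h.kB0, D1 := h.kB1, tD0 := h.t0, tD1 := h.t1, uD := hu, hu := hul, dD := fun y hy => ⟨hAB h.aA hy, fun h' => hAB (hLA _ h') hy rfl, fun h' => hAB (hLA'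 _ h') hy rfl⟩, vn := ⟨h.vB, fun h' => h.vA (hLA _ h'), fun h' => h.vA (hLA' _ h')⟩, h0 := ?_, h1 := ?_, l0 := ?_, l1 := ?_, n0 := ?_, n1 := ?_, dj := ?_, br := ?_ }⟩
  · exact nlgt (h.AU (hpA m le_rfl)) hU1 (h.BU hd0) hpm h.kk hkd0 (fun e => h.kA1 (e ▸ hpA m le_rfl)) (hAB (hpA m le_rfl) hd0).symm (fun e => h.kB1 (e ▸ hd0))
  · exact nlgt (h.AU (hqA n le_rfl)) hU0 (h.BU hd1) hqn h.kk.symm hkd1 (fun e => h.kA0 (e ▸ hqA n le_rfl)) (hAB (hqA n le_rfl) hd1).symm (fun e => h.kB0 (e ▸ hd1))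
  · rintro _ ⟨i, hi, rfl⟩; exact (g0 i hi.1 hi.2).1
  · rintro _ ⟨i, hi, rfl⟩; exact (g1 i hi.1 hi.2).1
  · rintro _ ⟨i, hi, rfl⟩; exact (g0 i hi.1 hi.2).2
  · rintro _ ⟨i, hi, rfl⟩; exact (g1 i hi.1 hi.2).2
  · rintro _ ⟨i, hi, rfl⟩ ⟨j, hj, e⟩; exact hnt i j hi.1 hi.2 hj.1 hj.2 (Or.inl e.symm)
  · intro X hX h1 h2 h3 y hy
    have hyA : y ∉ A := fun hyA => by
      obtain ⟨c, hc, hc'⟩ := hB.miss (C := {v, k0, k1}) (fun y hy z hz hyz => by simpa using h.hA y hy z hz hyz) hX0 h0 hX hy hyA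
      rcases hc' with rfl | rfl | rfl <;> contradiction
    exact ⟨fun e => hyA (e ▸ h.aA), fun h' => hyA (hLA y h'), fun h' => hyA (hLA' y h')⟩

lemma side1 [Finite V] {X0 : Set V} (hc : Crit G U k 𝓑) (hA : Cn G A) (hAU : A ⊆ U) (hN : ∀ y ∈ A, ∀ z ∈ U, G.Adj y z → z ∈ A ∨ z = v ∨ z = k0) (hv : v ∉ A)
    (hk : k0 ∉ A) (ha : a ∈ A) (hva : G.Adj v a) (hka : Att G k0 A) (hX0 : X0 ∈ 𝓑) (h0 : Anti G A X0) : Lgt G U a := by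
  obtain ⟨y0, hy0, hky0⟩ := hka
  obtain ⟨p, m, hp, hpA, hp0, hpm, hpk, -⟩ := ipath (R := fun x => x = a) (Q := fun x => G.Adj k0 x) hA ha rfl hy0 hky0
  have hAA := hc.red (D := p '' Set.Icc 0 m) (v := v) (k0 := k0) (k1 := k0) hAU (fun y hy z hz h => by simpa using hN y hy z hz h) (by simp [hv, hk]) hX0 h0
    (by rintro _ ⟨i, hi, rfl⟩; exact hpA i hi.2) (Or.inr ⟨hp.seg (by omega) le_rfl, ⟨p 0, ⟨0, by simp, rfl⟩, hp0 ▸ hva⟩⟩) (Or.inr (Or.inr ⟨p m, ⟨m, by simp, rfl⟩, hpm⟩))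
    (Or.inr (Or.inr ⟨p m, ⟨m, by simp, rfl⟩, hpm⟩)) (Or.inl rfl)
  refine ⟨v, if m = 0 then k0 else p 1, fun z hz haz => ?_⟩
  rcases hN a ha z hz haz with h1 | h1 | h1
  · obtain ⟨i, hi, rfl⟩ := hAA h1
    right
    have := hp.adj (i := 0) (by omega) hi.2 (by rw [hp0]; exact haz)
    simp at hi
    rw [if_neg (by omega), show i = 1 by omega]
  · exact Or.inl h1
  · right
    split_ifs with hm
    · exact h1
    · exact absurd (by rw [hp0, ← h1]; exact haz.symm) (hpk 0 (by omega))

lemma leave (ha : a ∈ D) (hak : a ≠ w) (h : Rch G D a u) (hn : ¬ Rch G (D \ {w}) a u) : w ∈ D ∧ Att G w (cmp G (D \ {w}) a) := by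
  by_contra hc
  refine hn (h.ind (P := cmp G (D \ {w}) a) mem_cmp (fun y hy _ z hz hyz => ?_))
  by_cases e : z = w
  · subst e; exact absurd ⟨hz, y, hy, hyz.symm⟩ hc
  · exact cmp_step ⟨ha, hak⟩ hy ⟨hz, e⟩ hyz

lemma cmp_anti (ha : a ∈ E) (hu : u ∈ E) (hn : ¬ Rch G E a u) : Anti G (cmp G E a) (cmp G E u) :=
  fun _ hx _ hy => ⟨fun e => hn (Rch.trans hx (e ▸ Rch.symm hy)), fun h => hn (Rch.trans (cmp_step ha hx (cmp_sub hu hy) h) (Rch.symm hy))⟩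

lemma anti_or (ha : a ∈ E) (hu : u ∈ E) (hn : ¬ Rch G E a u) (hX : Cn G X) (hXE : X ⊆ E) : Anti G (cmp G E a) X ∨ Anti G (cmp G E u) X := by
  by_contra hc
  obtain ⟨x, hx⟩ := hX.1
  have hs := hX.sub_cmp hXE hx
  have : ∀ a ∈ E, ¬ Anti G (cmp G E a) X → Rch G E a x := fun a ha h => by
    by_contra h'; exact h ((cmp_anti ha (hXE hx) h').mono subset_rfl hs)
  rw [not_or] at hc
  exact hn ((this a ha hc.1).trans (this u hu hc.2).symm)

lemma cmp_bd (ha : a ∈ (U \ {v}) \ K) : ∀ y ∈ cmp G ((U \ {v}) \ K) a, ∀ z ∈ U, G.Adj y z → z ∈ cmp G ((U \ {v}) \ K) a ∨ z = v ∨ z ∈ K := by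
  intro y hy z hz hyz
  by_contra h
  push Not at h
  exact h.1 (cmp_step ha hy ⟨⟨hz, h.2.1⟩, h.2.2⟩ hyz)

lemma seagull [Finite V] (hk : 4 ≤ k) (hc : Crit G U k 𝓑) (hT : Tf G) (hS : Star G) (ha : a ∈ U) (hu : u ∈ U) (hau : a ≠ u) (hva : G.Adj v a)
    (hvu : G.Adj v u) (hal : ¬ Lgt G U a) (hul : ¬ Lgt G U u) : Nonempty (ApD G U 𝓑 a) ∨ Nonempty (ApD G U 𝓑 u) := by
  have hR : Rch G (U \ {v}) a u := hc.nocc (by omega) {v} ck1 a ha hva.ne' u hu hvu.ne'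
  have single : ∀ w, w ≠ a → w ≠ u → Rch G ((U \ {v}) \ {w}) a u := by
    intro w hwa hwu
    by_contra hn
    obtain ⟨E, hE⟩ : ∃ E, E = (U \ {v}) \ {w} := ⟨_, rfl⟩
    have hlt : ({v, w} : Set V).ncard < k := by have := ncard_insert_le v {w}; rw [ncard_singleton] at this; omega
    obtain ⟨X0, hX0, hd⟩ := hc.1.2.2 {v, w} hlt
    have hXE : X0 ⊆ (U \ {v}) \ {w} := fun x hx => by
      have h1 := Set.disjoint_left.1 hd hx
      simp at h1
      exact ⟨⟨(hc.1.1 X0 hX0).1 hx, h1.1⟩, h1.2⟩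
    have main : ∀ a u, a ∈ U → u ∈ U → G.Adj v a → G.Adj v u → w ≠ a → Rch G (U \ {v}) a u → ¬ Rch G ((U \ {v}) \ {w}) a u →
        Anti G (cmp G ((U \ {v}) \ {w}) a) X0 → Lgt G U a := by
      intro a u ha hu hva hvu hwa hR hn h0
      have haE : a ∈ (U \ {v}) \ {w} := ⟨⟨ha, hva.ne'⟩, hwa.symm⟩
      have hl := leave (D := U \ {v}) ⟨ha, hva.ne'⟩ hwa.symm hR hn
      have hs := cmp_sub (G := G) haE
      exact side1 hc (Cn_cmp haE) (fun y hy => (hs hy).1.1) (cmp_bd haE) (fun h => (hs h).1.2 rfl) (fun h => (hs h).2 rfl) mem_cmp hva hl.2 hX0 h0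
    rcases anti_or (E := (U \ {v}) \ {w}) ⟨⟨ha, hva.ne'⟩, hwa.symm⟩ ⟨⟨hu, hvu.ne'⟩, hwu.symm⟩ hn (hc.1.1 X0 hX0).2 hXE with h | h
    · exact hal (main a u ha hu hva hvu hwa hR hn h)
    · exact hul (main u a hu ha hvu hva hwu hR.symm (fun h => hn h.symm) h)
  obtain ⟨K, hK, haK, huK, hn⟩ := sep_ex hT hS ha hu hau hva hvu
  rcases hK with rfl | ⟨k0, k1, rfl, hkk⟩
  · simp only [sdiff_empty] at hn; exact absurd hR hn
  rcases hkk with rfl | hkk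
  · simp at hn haK huK
    exact absurd (single k0 (Ne.symm haK) (Ne.symm huK)) hn
  have hlt : ({v, k0, k1} : Set V).ncard < k := by
    have h1 := ncard_insert_le v {k0, k1}; have := ncard_insert_le k0 {k1}; rw [ncard_singleton] at this; omega
  obtain ⟨X0, hX0, hd⟩ := hc.1.2.2 _ hlt
  obtain ⟨E, hE⟩ : ∃ E, E = (U \ {v}) \ {k0, k1} := ⟨_, rfl⟩
  have hXE : X0 ⊆ (U \ {v}) \ {k0, k1} := fun x hx => by
    have h1 := Set.disjoint_left.1 hd hx
    simp at h1
    refine ⟨⟨(hc.1.1 X0 hX0).1 hx, h1.1⟩, by simp; tauto⟩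
  simp only [Set.mem_insert_iff, Set.mem_singleton_iff, not_or] at haK huK
  have e1 : ((U \ {v}) \ {k0}) \ {k1} = (U \ {v}) \ {k0, k1} := by ext; simp; tauto
  have e2 : ((U \ {v}) \ {k1}) \ {k0} = (U \ {v}) \ {k0, k1} := by ext; simp; tauto
  have lv : ∀ a u, a ∈ U → G.Adj v a → a ≠ k0 → a ≠ k1 → (∀ w, w ≠ a → w ≠ u → Rch G ((U \ {v}) \ {w}) a u) → u ≠ k0 → u ≠ k1 → ¬ Rch G ((U \ {v}) \ {k0, k1}) a u →
      (k0 ∈ U \ {v} ∧ k1 ∈ U \ {v}) ∧ Att G k0 (cmp G ((U \ {v}) \ {k0, k1}) a) ∧ Att G k1 (cmp G ((U \ {v}) \ {k0, k1}) a) := by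
    intro a u ha hva h0 h1 hs h2 h3 hn
    have g1 := leave (D := (U \ {v}) \ {k0}) (w := k1) ⟨⟨ha, hva.ne'⟩, h0⟩ h1 (hs k0 h0.symm h2.symm) (by rw [e1]; exact hn)
    have g2 := leave (D := (U \ {v}) \ {k1}) (w := k0) ⟨⟨ha, hva.ne'⟩, h1⟩ h0 (hs k1 h1.symm h3.symm) (by rw [e2]; exact hn)
    rw [e1] at g1
    rw [e2] at g2
    exact ⟨⟨g2.1.1, g1.1.1⟩, g2.2, g1.2⟩
  have main : ∀ a u, a ∈ U → u ∈ U → G.Adj v a → G.Adj v u → a ≠ k0 → a ≠ k1 → u ≠ k0 → u ≠ k1 → (∀ w, w ≠ a → w ≠ u → Rch G ((U \ {v}) \ {w}) a u) →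
      ¬ Lgt G U a → ¬ Lgt G U u → ¬ Rch G ((U \ {v}) \ {k0, k1}) a u → Anti G (cmp G ((U \ {v}) \ {k0, k1}) a) X0 → Nonempty (ApD G U 𝓑 a) := by
    intro a u ha hu hva hvu h0 h1 h2 h3 hs hal hul hn hX
    obtain ⟨⟨hk0, hk1⟩, ta0, ta1⟩ := lv a u ha hva h0 h1 hs h2 h3 hn
    obtain ⟨-, tu0, tu1⟩ := lv u a hu hvu h2 h3 (fun w g1 g2 => (hs w g2 g1).symm) h0 h1 (fun h => hn h.symm)
    have haE : a ∈ (U \ {v}) \ {k0, k1} := ⟨⟨ha, hva.ne'⟩, by simp [h0, h1]⟩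
    have huE : u ∈ (U \ {v}) \ {k0, k1} := ⟨⟨hu, hvu.ne'⟩, by simp [h2, h3]⟩
    have hsA := cmp_sub (G := G) haE
    have hsB := cmp_sub (G := G) huE
    have hbA := cmp_bd (G := G) haE
    have hbB := cmp_bd (G := G) huE
    obtain ⟨A, hA⟩ : ∃ A, A = cmp G ((U \ {v}) \ {k0, k1}) a := ⟨_, rfl⟩
    obtain ⟨B, hB⟩ : ∃ B, B = cmp G ((U \ {v}) \ {k0, k1}) u := ⟨_, rfl⟩
    have cA : Cn G A := hA ▸ Cn_cmp haE
    have aA : a ∈ A := hA ▸ mem_cmp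
    have cB : Cn G B := hB ▸ Cn_cmp huE
    have uB : u ∈ B := hB ▸ mem_cmp
    have an : Anti G A B := by rw [hA, hB]; exact cmp_anti haE huE hn
    rw [← hA] at hsA hbA ta0 ta1 hX
    rw [← hB] at hsB hbB tu0 tu1
    have hvA : v ∉ A := fun h => (hsA h).1.2 rfl
    have hkA0 : k0 ∉ A := fun h => (hsA h).2 (by simp)
    have hkA1 : k1 ∉ A := fun h => (hsA h).2 (by simp)
    have hAU : A ⊆ U := fun y hy => (hsA hy).1.1
    refine Sd.ap hT hS hc.1 (A := A) (B := B) (v := v) (k0 := k0) (k1 := k1) (X0 := X0) (u := u)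
      { AU := hAU, BU := fun y hy => (hsB hy).1.1, cB := cB, hA := hbA, hB := hbB, vA := hvA, kA0 := hkA0, kA1 := hkA1,
        vB := fun h => (hsB h).1.2 rfl, kB0 := fun h => (hsB h).2 (by simp), kB1 := fun h => (hsB h).2 (by simp), an := an, aA := aA, va := hva, tv := ⟨u, uB, hvu⟩,
        t0 := tu0, t1 := tu1, kk := hkk, n0 := fun e => hk0.2 e.symm, n1 := fun e => hk1.2 e.symm, mn := ?_ } cA hk0.1 hk1.1 hX0 hX ta0 ta1 uB hul hal
    intro D hD h4 h5 h6 h7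
    exact hc.red (v := v) (k0 := k0) (k1 := k1) hAU (fun y hy z hz h => by simpa using hbA y hy z hz h) (by simp [hvA, hkA0, hkA1]) hX0 hX hD (Or.inr ⟨h4, h5⟩)
      (Or.inr (Or.inr h6)) (Or.inr (Or.inr h7)) (Or.inr hkk)
  rcases anti_or (E := (U \ {v}) \ {k0, k1}) ⟨⟨ha, hva.ne'⟩, by simp [haK]⟩ ⟨⟨hu, hvu.ne'⟩, by simp [huK]⟩ hn (hc.1.1 X0 hX0).2 hXE with h | h
  · exact Or.inl (main a u ha hu hva hvu haK.1 haK.2 huK.1 huK.2 single hal hul hn h)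
  · exact Or.inr (main u a hu ha hvu hva huK.1 huK.2 haK.1 haK.2 (fun w g1 g2 => (single w g2 g1).symm) hul hal (fun h => hn h.symm) h)
end Paper

namespace Paper
variable {V : Type} {G G' : SimpleGraph V} {A B C D P S X Z U K L E : Set V} {x y z v w w' a a' u k0 k1 : V} {𝓑 : Set (Set V)} {k : ℕ}

lemma ApD.sub (h : ApD G U 𝓑 a) (h' : ApD G U 𝓑 a') (hx : x ∈ h.L0) (hx' : x ∈ h'.L0) : h.L0 ⊆ h'.L0 := fun y hy =>
  (h.c0.2 x hx y hy).ind hx' (fun b hb _ c hc hbc => by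
    rcases h'.n0 b hb c (h.s0 hc) hbc with h1 | rfl | rfl
    · exact h1
    · exact absurd (h.l0 _ hc) h'.ha
    · exact absurd (h.l0 _ hc) h'.h0)

lemma ApD.vk (h : ApD G U 𝓑 a) (hw : w ∈ U) (hl : ¬ Lgt G U w) (haw : G.Adj a w) : w = h.v := by
  rcases h.na w hw haw with e | e | e
  · exact e
  · exact absurd (h.l0 w (e ▸ h.pL)) hl
  · exact absurd (h.l1 w (e ▸ h.qL)) hl

lemma ApD.ak (h : ApD G U 𝓑 a) : a ≠ h.k0 := by
  intro e
  obtain ⟨d, hd, hkd⟩ := h.tD0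
  have e1 := h.vk h.kU1 h.h1 ((congrArg (fun t => G.Adj t h.k1) e).mpr h.kk)
  have := h.dD d hd
  rcases h.na d (h.sD hd) ((congrArg (fun t => G.Adj t d) e).mpr hkd) with e2 | e2 | e2
  · exact h.vn.1 (e2 ▸ hd)
  · exact this.2.1 (e2 ▸ h.pL)
  · exact this.2.2 (e2 ▸ h.qL)

lemma ApD.k0na (h : ApD G U 𝓑 a) (h' : ApD G U 𝓑 h.k0) : False := by
  obtain ⟨l, hl, hkl⟩ := h.t0
  obtain ⟨d, hd, hkd⟩ := h.tD0
  have hv' := h'.vk h.kU1 h.h1 h.kk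
  have main : ∀ h' : ApD G U 𝓑 h.k0, h.k1 = h'.v → l = h'.p → False := by
    intro h' hv' hlp
    have hdq : d = h'.q := by
      rcases h'.na d (h.sD hd) hkd with e | e | e
      · exact absurd hd (by rw [e, ← hv']; exact h.D1)
      · exact absurd hl (by rw [hlp, ← e]; exact (h.dD d hd).2.1)
      · exact e
    have hs := h.sub h' hl (hlp ▸ h'.pL)
    have ha' : a = h'.k0 := by
      rcases h'.n0 _ (hs h.pL) a h.aU h.ap.symm with e | e | e
      · exact absurd (h'.l0 a e) h.ha
      · exact absurd e h.ak
      · exact e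
    have hk1' := h.vk h'.kU1 h'.h1 ((congrArg (fun t => G.Adj t h'.k1) ha').mpr h'.kk)
    have : h.u ∈ h'.L1 := (h.cD.2 d hd _ h.uD).ind (hdq ▸ h'.qL) (fun b hb _ c hc hbc => by
      rcases h'.n1 b hb c (h.sD hc) hbc with h1 | e | e
      · exact h1
      · exact absurd (e ▸ hc) h.D0
      · exact absurd (hk1' ▸ e ▸ hc) h.vn.1)
    exact h.hu (h'.l1 _ this)
  rcases h'.na l (h.s0 hl) hkl with e | e | e
  · exact h.h1 (h.l0 _ (by rw [hv', ← e]; exact hl))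
  · exact main h' hv' e
  · exact main h'.swap hv' e

lemma ApD.uq0 (h : ApD G U 𝓑 a) (h' : ApD G U 𝓑 a') (hx : x ∈ h.L0) (hx' : x ∈ h'.L0) : a = a' := by
  rcases h'.n0 _ (h.sub h' hx hx' h.pL) a h.aU h.ap.symm with e | e | e
  · exact absurd (h'.l0 a e) h.ha
  · exact e
  · subst e; exact (h'.k0na h).elim

lemma ApD.uq (h : ApD G U 𝓑 a) (h' : ApD G U 𝓑 a') (hx : x ∈ h.L0 ∨ x ∈ h.L1) (hx' : x ∈ h'.L0 ∨ x ∈ h'.L1) : a = a' := by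
  rcases hx with hx | hx <;> rcases hx' with hx' | hx'
  · exact h.uq0 h' hx hx'
  · exact h.uq0 h'.swap hx hx'
  · exact h.swap.uq0 h' hx hx'
  · exact h.swap.uq0 h'.swap hx hx'

def Qt {W : Type} (G : SimpleGraph V) (U : Set V) (r : V → W) : SimpleGraph W where
  Adj α β := α ≠ β ∧ ∃ x ∈ U, ∃ y ∈ U, r x = α ∧ r y = β ∧ G.Adj x y
  symm := ⟨fun _ _ ⟨h, x, hx, y, hy, e1, e2, h'⟩ => ⟨h.symm, y, hy, x, hx, e2, e1, h'.symm⟩⟩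
  loopless := ⟨fun _ h => h.1 rfl⟩

def Ltt {W : Type} (G : SimpleGraph V) (U : Set V) (r : V → W) (x : V) : Prop := (∀ z ∈ U, r z = r x → z = x) ∧ Lgt G U x

lemma quot [Finite V] (hk : 4 ≤ 2 * k) (hc : Crit G U (2 * k) 𝓑) (hT : Tf G) (hS : Star G) : ∃ (U' : Set V) (r : V → Set V),
    (∀ x ∈ U', Cn G {y | y ∈ U' ∧ r y = r x}) ∧ (∀ x ∈ U', ∀ y ∈ U', G.Adj x y → r x ≠ r y → Ltt G U' r x ∨ Ltt G U' r y) ∧ Br (Qt G U' r) Set.univ k := by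
  classical
  obtain ⟨Ap, hAp⟩ : ∃ Ap : V → Prop, Ap = fun a => Nonempty (ApD G U 𝓑 a) := ⟨_, rfl⟩
  obtain ⟨dt, -⟩ : ∃ dt : ∀ a, Ap a → ApD G U 𝓑 a, True := ⟨fun a h => by rw [hAp] at h; exact h.some, trivial⟩
  obtain ⟨Y, hY⟩ : ∃ Y : Set V, Y = {y | y ∈ U ∧ ¬ Lgt G U y ∧ ¬ Ap y} := ⟨_, rfl⟩
  have sg : ∀ {v a u}, a ∈ Y → u ∈ Y → G.Adj v a → G.Adj v u → a = u := by
    intro v a u ha hu h1 h2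
    rw [hY] at ha hu
    by_contra hau
    rcases seagull hk hc hT hS ha.1 hu.1 hau h1 h2 ha.2.1 hu.2.1 with h | h
    · exact ha.2.2 (by rw [hAp]; exact h)
    · exact hu.2.2 (by rw [hAp]; exact h)
  have kY0 : ∀ a h, (dt a h).k0 ∈ Y := fun a h => by rw [hY, hAp]; exact ⟨(dt a h).kU0, (dt a h).h0, fun ⟨h'⟩ => (dt a h).k0na h'⟩
  have kY1 : ∀ a h, (dt a h).k1 ∈ Y := fun a h => by rw [hY, hAp]; exact ⟨(dt a h).kU1, (dt a h).h1, fun ⟨h'⟩ => (dt a h).swap.k0na h'⟩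
  obtain ⟨core, hcore⟩ : ∃ core : V → Set V, ∀ y, core y = {z | z = y ∨ G.Adj y z ∧ z ∈ Y} := ⟨_, fun _ => rfl⟩
  have coreS : ∀ y, y ∈ core y := fun y => by rw [hcore]; exact Or.inl rfl
  have core1 : ∀ {y y'}, y ∈ Y → y' ∈ Y → G.Adj y y' → core y = core y' := by
    have : ∀ {y y'}, y ∈ Y → y' ∈ Y → G.Adj y y' → core y ⊆ core y' := by
      intro y y' h1 h2 h3 z hz
      rw [hcore] at hz ⊢
      rcases hz with rfl | ⟨h4, h5⟩
      · exact Or.inr ⟨h3.symm, h1⟩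
      · exact Or.inl (sg h5 h2 h4 h3)
    intro y y' h1 h2 h3; exact Set.Subset.antisymm (this h1 h2 h3) (this h2 h1 h3.symm)
  have core2 : ∀ {y y'}, core y = core y' → y = y' ∨ G.Adj y' y := by
    intro y y' h
    have := coreS y
    rw [h, hcore] at this
    exact this.imp_right (fun h => h.1)
  have coreN : ∀ {y}, (core y).ncard ≤ 2 := by
    intro y
    by_cases h : ∃ z ∈ Y, G.Adj y z
    · obtain ⟨z, hz, hyz⟩ := h
      refine (ncard_le_ncard (t := {y, z}) ?_).trans (ncard_insert_le y {z} |>.trans (by rw [ncard_singleton]))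
      rw [hcore]
      rintro x (rfl | ⟨h1, h2⟩)
      · simp
      · rw [sg h2 hz h1 hyz]; simp
    · refine (ncard_le_ncard (t := {y}) ?_).trans (by rw [ncard_singleton]; omega)
      rw [hcore]
      rintro x (rfl | ⟨h1, h2⟩)
      · simp
      · exact absurd ⟨x, h2, h1⟩ h
  obtain ⟨r, r0, r1, r2⟩ : ∃ r : V → Set V, (∀ a h, ∀ x ∈ (dt a h).L0, r x = core (dt a h).k0) ∧ (∀ x ∈ Y, r x = core x) ∧
      ∀ x, x ∉ Y → (∀ a h, x ∉ (dt a h).L0) → r x = {x} := by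
    refine ⟨fun x => if h : ∃ a, ∃ h, x ∈ (dt a h).L0 then core (dt h.choose h.choose_spec.choose).k0 else if x ∈ Y then core x else {x}, ?_, ?_, ?_⟩
    · intro a h x hx
      have h' : ∃ a, ∃ h, x ∈ (dt a h).L0 := ⟨a, h, hx⟩
      simp only [dif_pos h']
      have e : a = h'.choose := (dt a h).uq0 (dt _ h'.choose_spec.choose) hx h'.choose_spec.choose_spec
      have : ∀ b, ∀ hb : Ap b, a = b → (dt b hb).k0 = (dt a h).k0 := by rintro b hb rfl; rfl
      rw [this _ _ e]
    · intro x hx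
      have : ¬ ∃ a, ∃ h, x ∈ (dt a h).L0 := by
        rintro ⟨a, h, h'⟩; rw [hY] at hx; exact hx.2.1 ((dt a h).l0 x h')
      simp only [dif_neg this, if_pos hx]
    · intro x hx h
      have : ¬ ∃ a, ∃ h, x ∈ (dt a h).L0 := by push Not; exact h
      simp only [dif_neg this, if_neg hx]
  obtain ⟨Lg, hLg⟩ : ∃ Lg : V → V → Prop, ∀ x a, Lg x a ↔ ∃ h, x ∈ (dt a h).L0 ∨ x ∈ (dt a h).L1 := ⟨_, fun _ _ => Iff.rfl⟩
  have lgL : ∀ {x a}, Lg x a → Lgt G U x := fun {x a} h => by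
    obtain ⟨h, h' | h'⟩ := (hLg x a).1 h
    · exact (dt a h).l0 x h'
    · exact (dt a h).l1 x h'
  have lgU : ∀ {x a}, Lg x a → x ∈ U := fun {x a} h => by
    obtain ⟨h, h' | h'⟩ := (hLg x a).1 h
    · exact (dt a h).s0 h'
    · exact (dt a h).s1 h'
  have lgY : ∀ {x a}, x ∈ Y → ¬ Lg x a := fun hx h => by rw [hY] at hx; exact hx.2.1 (lgL h)
  have lgA : ∀ {a' a}, Ap a' → ¬ Lg a' a := fun hx h => (dt _ hx).ha (lgL h)
  have apY : ∀ {a}, Ap a → a ∉ Y := fun h h' => by rw [hY] at h'; exact h'.2.2 h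
  have lgq : ∀ {x a a'}, Lg x a → Lg x a' → a = a' := fun {x a a'} h h' => by
    obtain ⟨h, hx⟩ := (hLg x a).1 h
    obtain ⟨h', hx'⟩ := (hLg x a').1 h'
    exact (dt a h).uq (dt a' h') hx hx'
  obtain ⟨U', hU'⟩ : ∃ U' : Set V, U' = {x | x ∈ U ∧ ∀ a h, x ∉ (dt a h).L1} := ⟨_, rfl⟩
  have U'1 : ∀ {x}, x ∈ U → (∀ a, ¬ Lg x a) → x ∈ U' := fun {x} h h' => by
    rw [hU']; exact ⟨h, fun a ha hx => h' a ((hLg _ _).2 ⟨ha, Or.inr hx⟩)⟩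
  have U'Y : Y ⊆ U' := fun y hy => U'1 (by rw [hY] at hy; exact hy.1) (fun a => lgY hy)
  have U'L : ∀ {a h x}, x ∈ (dt a h).L0 → x ∈ U' := fun {a h x} hx => by
    rw [hU']
    refine ⟨(dt a h).s0 hx, fun a' h' hx' => ?_⟩
    obtain rfl := (dt a h).uq (dt a' h') (Or.inl hx) (Or.inr hx')
    exact (dt a h).dj x hx hx'
  have rS : ∀ {x}, (∀ a, ¬ Lg x a) → x ∈ r x := by
    intro x hx
    by_cases hy : x ∈ Y
    · rw [r1 x hy]; exact coreS x
    · rw [r2 x hy (fun a h h' => hx a ((hLg _ _).2 ⟨h, Or.inl h'⟩))]; rfl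
  have rA : ∀ {a}, Ap a → r a = {a} := fun h => r2 _ (apY h) (fun a' h' hx => lgA h ((hLg _ a').2 ⟨h', Or.inl hx⟩))
  have fib : ∀ {x}, x ∉ Y → (∀ a h, x ∉ (dt a h).L0) → ∀ z ∈ U', r z = r x → z = x := by
    intro x h1 h2 z hz e
    rw [r2 x h1 h2] at e
    have kk : ∀ y ∈ Y, core y ≠ {x} := fun y hy h => by
      have := coreS y
      rw [h] at this
      exact h1 (this ▸ hy)
    by_cases hy : z ∈ Y
    · exact absurd (r1 z hy ▸ e) (kk z hy)
    by_cases hl : ∃ a h, z ∈ (dt a h).L0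
    · obtain ⟨a, h, hl⟩ := hl
      exact absurd (r0 a h z hl ▸ e) (kk _ (kY0 a h))
    · push Not at hl
      rw [r2 z hy hl] at e
      exact Set.singleton_injective e
  refine ⟨U', r, ?_, ?_, ?_⟩
  · intro x hx
    have main : ∀ y ∈ Y, Cn G {z | z ∈ U' ∧ r z = core y} := by
      intro y hy
      have hyF : y ∈ {z | z ∈ U' ∧ r z = core y} := ⟨U'Y hy, r1 y hy⟩
      have h1 : ∀ z ∈ Y, core z = core y → Rch G {z | z ∈ U' ∧ r z = core y} y z := by
        intro z hz e
        rcases core2 e with rfl | h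
        · exact .refl
        · exact Rch.adj h hyF ⟨U'Y hz, (r1 z hz).trans e⟩
      refine Cn_of hyF ?_
      rintro z ⟨hzU, hz⟩
      by_cases hzY : z ∈ Y
      · exact h1 z hzY (r1 z hzY ▸ hz)
      by_cases hl : ∃ a h, z ∈ (dt a h).L0
      · obtain ⟨a, h, hl⟩ := hl
        have e := (r0 a h z hl).symm.trans hz
        obtain ⟨d, hd, hkd⟩ := (dt a h).t0
        have hs : (dt a h).L0 ⊆ {z | z ∈ U' ∧ r z = core y} := fun w hw => ⟨U'L hw, (r0 a h w hw).trans e⟩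
        exact (h1 _ (kY0 a h) e).trans ((Rch.adj (D := {z | z ∈ U' ∧ r z = core y}) hkd ⟨U'Y (kY0 a h), (r1 _ (kY0 a h)).trans e⟩ (hs hd)).trans (((dt a h).c0.2 d hd z hl).mono hs))
      · push Not at hl
        have := fib hzY hl y (U'Y hy) ((r1 y hy).trans hz.symm)
        exact absurd (this ▸ hy) hzY
    by_cases hy : x ∈ Y
    · rw [r1 x hy]; exact main x hy
    by_cases hl : ∃ a h, x ∈ (dt a h).L0
    · obtain ⟨a, h, hl⟩ := hl
      rw [r0 a h x hl]; exact main _ (kY0 a h)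
    · push Not at hl
      have : {y | y ∈ U' ∧ r y = r x} = {x} := by
        ext z; exact ⟨fun h => fib hy hl z h.1 h.2, fun h => by rw [Set.mem_singleton_iff] at h; rw [h]; exact ⟨hx, rfl⟩⟩
      rw [this]; exact Cn_single
  · have main : ∀ x ∈ U', ¬ Ltt G U' r x → x ∈ Y ∨ ∃ a h, x ∈ (dt a h).L0 := by
      intro x hx hl
      by_contra hcon
      push Not at hcon
      refine hl ⟨fib hcon.1 hcon.2, ?_⟩
      have hxU : x ∈ U := by rw [hU'] at hx; exact hx.1
      by_cases hLx : Lgt G U x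
      · obtain ⟨b, c, h⟩ := hLx
        exact ⟨b, c, fun z hz => h z (by rw [hU'] at hz; exact hz.1)⟩
      · have hA : Ap x := by
          by_contra hA; exact hcon.1 (by rw [hY]; exact ⟨hxU, hLx, hA⟩)
        refine ⟨(dt x hA).v, (dt x hA).p, fun z hz hxz => ?_⟩
        rw [hU'] at hz
        rcases (dt x hA).na z hz.1 hxz with h | h | h
        · exact Or.inl h
        · exact Or.inr h
        · exact absurd (h ▸ (dt x hA).qL) (hz.2 x hA)
    have cl : ∀ a h x y, x ∈ (dt a h).L0 → (y ∈ Y ∨ ∃ a h, y ∈ (dt a h).L0) → y ∈ U' → G.Adj x y → r x = r y := by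
      intro a h x y hx hy hyU hxy
      rw [r0 a h x hx]
      have hyl : ¬ Ap y := fun hA => by
        rcases hy with hy | ⟨a', h', hy⟩
        · exact apY hA hy
        · exact lgA hA ((hLg y a').2 ⟨h', Or.inl hy⟩)
      rcases (dt a h).n0 x hx y (by rw [hU'] at hyU; exact hyU.1) hxy with h1 | h1 | h1
      · exact (r0 a h y h1).symm
      · exact absurd (h1 ▸ h) hyl
      · rw [h1]; exact (r1 _ (kY0 a h)).symm
    intro x hx y hy hxy hr
    by_contra hcon
    rw [not_or] at hcon
    have hx' := main x hx hcon.1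
    have hy' := main y hy hcon.2
    rcases hx' with hx1 | ⟨a, h, hx1⟩
    · rcases hy' with hy1 | ⟨a, h, hy1⟩
      · exact hr (by rw [r1 x hx1, r1 y hy1]; exact core1 hx1 hy1 hxy)
      · exact hr (cl a h y x hy1 (Or.inl hx1) hx hxy.symm).symm
    · exact hr (cl a h x y hx1 hy' hy hxy)
  · have ak : ∀ a h, (Qt G U' r).Adj {a} (core (dt a h).k0) := by
      refine fun a h => ⟨fun e => ?_, a, U'1 (dt a h).aU (fun _ => lgA h), (dt a h).p, U'L (dt a h).pL, rA h, r0 a h _ (dt a h).pL, (dt a h).ap⟩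
      have := coreS (dt a h).k0
      rw [← e] at this
      exact (dt a h).ak (Set.mem_singleton_iff.1 this).symm
    obtain ⟨sh, hsh⟩ : ∃ sh : V → Set V → Prop, ∀ x β, sh x β ↔ ((∀ a, ¬ Lg x a) ∧ β = r x) ∨ ∃ a h, Lg x a ∧ (β = {a} ∨ β = core (dt a h).k0) := ⟨_, fun _ _ => Iff.rfl⟩
    have kr0 : ∀ a h, r (dt a h).k0 = core (dt a h).k0 := fun a h => r1 _ (kY0 a h)
    have kr1 : ∀ a h, r (dt a h).k1 = core (dt a h).k0 := fun a h => (r1 _ (kY1 a h)).trans (core1 (kY0 a h) (kY1 a h) (dt a h).kk).symm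
    have nb : ∀ {x y a h}, Lg x a → y ∈ U → G.Adj x y → Lg y a ∨ (∀ a, ¬ Lg y a) ∧ (r y = {a} ∨ r y = core (dt a h).k0) := by
      intro x y a h hx hy hxy
      obtain ⟨h', hx⟩ := (hLg x a).1 hx
      have : Lg y a ∨ y = a ∨ y = (dt a h).k0 ∨ y = (dt a h).k1 := by
        rcases hx with hx | hx
        · rcases (dt a h).n0 x hx y hy hxy with h1 | h1 | h1
          · exact Or.inl ((hLg y a).2 ⟨h, Or.inl h1⟩)
          · exact Or.inr (Or.inl h1)
          · exact Or.inr (Or.inr (Or.inl h1))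
        · rcases (dt a h).n1 x hx y hy hxy with h1 | h1 | h1
          · exact Or.inl ((hLg y a).2 ⟨h, Or.inr h1⟩)
          · exact Or.inr (Or.inl h1)
          · exact Or.inr (Or.inr (Or.inr h1))
      rcases this with h1 | h1 | h1 | h1
      · exact Or.inl h1
      · exact Or.inr ⟨fun _ => by rw [h1]; exact lgA h, Or.inl (by rw [h1]; exact rA h)⟩
      · exact Or.inr ⟨fun _ => by rw [h1]; exact lgY (kY0 a h), Or.inr (by rw [h1]; exact kr0 a h)⟩
      · exact Or.inr ⟨fun _ => by rw [h1]; exact lgY (kY1 a h), Or.inr (by rw [h1]; exact kr1 a h)⟩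
    have c1 : ∀ X ∈ 𝓑, ∀ x ∈ X, ∃ y ∈ X, (∀ a, ¬ Lg y a) ∧ sh x (r y) := by
      intro X hX x hx
      by_cases hl : ∃ a, Lg x a
      · obtain ⟨a, hl⟩ := hl
        obtain ⟨h, hl'⟩ := (hLg x a).1 hl
        obtain ⟨w, hw, hwl⟩ : ∃ w ∈ X, ¬ Lg w a := by
          by_contra hcon
          push Not at hcon
          have := (dt a h).br X hX (fun hv => by
            obtain ⟨_, h1⟩ := (hLg _ a).1 (hcon _ hv)
            exact h1.elim (dt a h).vn.2.1 (dt a h).vn.2.2) (fun hv => lgY (kY0 a h) (hcon _ hv)) (fun hv => lgY (kY1 a h) (hcon _ hv)) x hx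
          exact hl'.elim this.2.1 this.2.2
        obtain ⟨b, hb, c, hcX, hbl, hcl, hbc⟩ := (hc.1.1 X hX).2.cut (P := {w | Lg w a}) hx hl hw hwl
        have := (nb (h := h) hbl ((hc.1.1 X hX).1 hcX) hbc).resolve_left hcl
        exact ⟨c, hcX, this.1, (hsh _ _).2 (Or.inr ⟨a, h, hl, this.2⟩)⟩
      · push Not at hl
        exact ⟨x, hx, hl, (hsh _ _).2 (Or.inl ⟨hl, rfl⟩)⟩
    have pr : ∀ {a h} {α β : Set V}, (α = {a} ∨ α = core (dt a h).k0) → (β = {a} ∨ β = core (dt a h).k0) → α = β ∨ (Qt G U' r).Adj α β := by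
      rintro a h α β (rfl | rfl) (rfl | rfl)
      · exact Or.inl rfl
      · exact Or.inr (ak a h)
      · exact Or.inr (ak a h).symm
      · exact Or.inl rfl
    have c2' : ∀ {x y α β a h}, y ∈ U → (x = y ∨ G.Adj x y) → Lg x a → (α = {a} ∨ α = core (dt a h).k0) → sh y β → α = β ∨ (Qt G U' r).Adj α β := by
      intro x y α β a h hy hxy hx hα hβ
      have : Lg y a ∨ (∀ a, ¬ Lg y a) ∧ (r y = {a} ∨ r y = core (dt a h).k0) := by
        rcases hxy with rfl | hxy
        · exact Or.inl hx
        · exact nb hx hy hxy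
      rcases (hsh y β).1 hβ with ⟨h1, rfl⟩ | ⟨a', h', h1, h2⟩
      · exact pr hα (this.resolve_left (h1 a)).2
      · rcases this with h3 | h3
        · obtain rfl := lgq h3 h1
          exact pr hα h2
        · exact absurd h1 (h3.1 a')
    have c2 : ∀ {x y α β}, x ∈ U → y ∈ U → (x = y ∨ G.Adj x y) → sh x α → sh y β → α = β ∨ (Qt G U' r).Adj α β := by
      intro x y α β hx hy hxy hα hβ
      rcases (hsh x α).1 hα with ⟨h1, rfl⟩ | ⟨a, h, h1, h2⟩
      · rcases (hsh y β).1 hβ with ⟨h3, rfl⟩ | ⟨a, h, h3, h4⟩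
        · rcases hxy with rfl | hxy
          · exact Or.inl rfl
          · by_cases e : r x = r y
            · exact Or.inl e
            · exact Or.inr ⟨e, x, U'1 hx h1, y, U'1 hy h3, rfl, rfl, hxy⟩
        · exact (c2' hx (hxy.imp Eq.symm (fun h => h.symm)) h3 h4 hα).imp Eq.symm (fun h => h.symm)
      · exact c2' hy hxy h1 h2 hβ
    refine ⟨(fun X => r '' {x | x ∈ X ∧ ∀ a, ¬ Lg x a}) '' 𝓑, ?_, ?_, ?_⟩
    · rintro _ ⟨X, hX, rfl⟩
      refine ⟨subset_univ _, ?_⟩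
      obtain ⟨x, hx⟩ := (hc.1.1 X hX).2.1
      obtain ⟨x, hx, hxl, -⟩ := c1 X hX x hx
      have main : ∀ y, Rch G X x y → y ∈ X ∧ ∀ β ∈ r '' {x | x ∈ X ∧ ∀ a, ¬ Lg x a}, sh y β → Rch (Qt G U' r) (r '' {x | x ∈ X ∧ ∀ a, ¬ Lg x a}) (r x) β := by
        intro y hy
        induction hy with
        | refl =>
          refine ⟨hx, fun β hβ hs => ?_⟩
          rcases (hsh x β).1 hs with ⟨_, rfl⟩ | ⟨a, _, h, _⟩
          · exact .refl
          · exact absurd h (hxl a)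
        | @tail b c _ h ih =>
          refine ⟨h.2.2, fun β hβ hs => ?_⟩
          obtain ⟨y, hy, hyl, hys⟩ := c1 X hX b h.2.1
          have hyX : r y ∈ r '' {x | x ∈ X ∧ ∀ a, ¬ Lg x a} := ⟨y, ⟨hy, hyl⟩, rfl⟩
          have g := ih.2 (r y) hyX hys
          rcases c2 ((hc.1.1 X hX).1 h.2.1) ((hc.1.1 X hX).1 h.2.2) (Or.inr h.1) hys hs with e | e
          · exact e ▸ g
          · exact g.trans (Rch.adj e hyX hβ)
      refine Cn_of ⟨x, ⟨hx, hxl⟩, rfl⟩ ?_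
      rintro _ ⟨y, ⟨hy, hyl⟩, rfl⟩
      exact (main y ((hc.1.1 X hX).2.2 x hx y hy)).2 _ ⟨y, ⟨hy, hyl⟩, rfl⟩ ((hsh _ _).2 (Or.inl ⟨hyl, rfl⟩))
    · rintro _ ⟨X, hX, rfl⟩ _ ⟨X', hX', rfl⟩
      obtain ⟨x, hx, y, hy, h⟩ := hc.1.2.1 X hX X' hX'
      obtain ⟨x', g1, g2, g3⟩ := c1 X hX x hx
      obtain ⟨y', g4, g5, g6⟩ := c1 X' hX' y hy
      exact ⟨r x', ⟨x', ⟨g1, g2⟩, rfl⟩, r y', ⟨y', ⟨g4, g5⟩, rfl⟩, c2 ((hc.1.1 X hX).1 hx) ((hc.1.1 X' hX').1 hy) h g3 g6⟩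
    · intro S hS
      have rN : ∀ x, (r x).ncard ≤ 2 := by
        intro x
        by_cases hy : x ∈ Y
        · rw [r1 x hy]; exact coreN
        by_cases hl : ∃ a h, x ∈ (dt a h).L0
        · obtain ⟨a, h, hl⟩ := hl
          rw [r0 a h x hl]; exact coreN
        · push Not at hl
          rw [r2 x hy hl, ncard_singleton]; omega
      have cnt : ∀ F : Finset (Set V), (⋃ α ∈ F.filter (fun α => ∃ x, r x = α), α).ncard ≤ 2 * F.card := by
        intro F
        induction F using Finset.induction_on with
        | empty => simp
        | @insert α F hα ih =>
          rw [Finset.card_insert_of_notMem hα, Finset.filter_insert]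
          split_ifs with h
          · obtain ⟨x, rfl⟩ := h
            rw [Finset.set_biUnion_insert]
            have := ncard_union_le (r x) (⋃ α ∈ F.filter (fun α => ∃ x, r x = α), α)
            have := rN x
            omega
          · omega
      have := cnt (toFinite S).toFinset
      rw [← ncard_eq_toFinset_card] at this
      obtain ⟨X, hX, hd⟩ := hc.1.2.2 _ (show _ < 2 * k by omega : (⋃ α ∈ (toFinite S).toFinset.filter (fun α => ∃ x, r x = α), α).ncard < 2 * k)
      refine ⟨_, ⟨X, hX, rfl⟩, Set.disjoint_left.2 ?_⟩
      rintro _ ⟨x, ⟨hx, hxl⟩, rfl⟩ hxS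
      refine Set.disjoint_left.1 hd hx ?_
      simp only [Set.mem_iUnion, Finset.mem_filter, Set.Finite.mem_toFinset]
      exact ⟨r x, ⟨hxS, x, rfl⟩, rS hxl⟩
end Paper

namespace Paper
variable {V : Type} {G G' : SimpleGraph V} {A B C D P S X Z U K L E : Set V} {x y z v w w' a a' u k0 k1 : V} {𝓑 : Set (Set V)} {k : ℕ}

lemma four {β : Type} {b c d p q r s : β} (hp : p = b ∨ p = c ∨ p = d) (hq : q = b ∨ q = c ∨ q = d) (hr : r = b ∨ r = c ∨ r = d) (hs : s = b ∨ s = c ∨ s = d)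
    (h1 : p ≠ q) (h2 : p ≠ r) (h3 : p ≠ s) (h4 : q ≠ r) (h5 : q ≠ s) (h6 : r ≠ s) : False := by
  grind

def Lf (G : SimpleGraph V) (D : Set V) (x : V) : Prop := ∃ y ∈ D, G.Adj x y ∧ ∀ z ∈ D, G.Adj x z → z = y

lemma Lf.cn (hD : Cn G D) (h : Lf G D x) : Cn G (D \ {x}) := by
  obtain ⟨y, hy, hxy, h⟩ := h
  have hyx : y ∈ D \ {x} := ⟨hy, hxy.ne'⟩
  refine Cn_of hyx ?_
  have : ∀ w, Rch G D y w → w ≠ x → Rch G (D \ {x}) y w := by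
    intro w hw
    induction hw with
    | refl => exact fun _ => .refl
    | @tail b c _ hbc ih =>
      intro hc
      by_cases hb : b = x
      · subst hb; rw [h c hbc.2.2 hbc.1]; exact .refl
      · exact (ih hb).trans (Rch.adj hbc.1 ⟨hbc.2.1, hb⟩ ⟨hbc.2.2, hc⟩)
  exact fun z hz => this z (hD.2 y hy z hz.1) hz.2

lemma IPf.lf {p : ℕ → V} {m : ℕ} (hp : IPf G p m) (hm : 0 < m) (hD : p 1 ∈ D) (h : ∀ z ∈ D, G.Adj (p 0) z → z ∈ p '' Set.Icc 0 m) : Lf G D (p 0) := by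
  refine ⟨p 1, hD, hp.1 0 hm, fun z hz haz => ?_⟩
  obtain ⟨i, hi, rfl⟩ := h z hz haz
  have := hp.adj (by omega) hi.2 haz
  rw [show i = 1 by omega]

lemma leaf {β : Type} {con : V → β → Prop} {b c d : β} (hT : Tf G) (hD : Cn G D) (hu : ∀ x x' g, con x g → con x' g → x = x')
    (h3 : ∀ x g, con x g → g = b ∨ g = c ∨ g = d) (hcD : ∀ x g, con x g → x ∈ D) (hmin : ∀ D' ⊆ D, Cn G D' → (∀ x g, con x g → x ∈ D') → D ⊆ D')
    (hx : x ∈ D) (hy : y ∈ D) (hxy : x ≠ y) : ∃ x g, con x g ∧ (∀ g', con x g' → g' = g) ∧ Lf G D x := by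
  have no1 : ∀ z ∈ D, ¬ ∀ x g, con x g → x ∈ ({z} : Set V) := fun z hz h => by
    have := hmin {z} (by simpa using hz) Cn_single h
    exact hxy ((this hx).trans (this hy).symm)
  obtain ⟨x1, g1, c1⟩ : ∃ x1 g1, con x1 g1 := by
    by_contra hcon; push Not at hcon
    exact no1 x hx (fun x g h => absurd h (hcon x g))
  have d1 := hcD _ _ c1
  obtain ⟨x2, g2, c2, h12⟩ : ∃ x2 g2, con x2 g2 ∧ x2 ≠ x1 := by
    by_contra hcon; push Not at hcon
    exact no1 x1 d1 hcon
  have d2 := hcD _ _ c2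
  obtain ⟨p, m, hp, hpD, hp0, hpm, -, -⟩ := ipath (R := fun x => x = x1) (Q := fun x => x = x2) hD d1 rfl d2 rfl
  have hm : 0 < m := Nat.pos_of_ne_zero (fun e => h12 (by rw [← hpm, ← hp0, e]))
  have hg : ∀ {x x' g g'}, con x g → con x' g' → x ≠ x' → g ≠ g' := fun h h' hne e => hne (hu _ _ _ h (e ▸ h'))
  have l1 : (∀ z ∈ D, G.Adj x1 z → z ∈ p '' Set.Icc 0 m) → Lf G D x1 := fun h => hp0 ▸ hp.lf hm (hpD 1 hm) (hp0.symm ▸ h)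
  have l2 : (∀ z ∈ D, G.Adj x2 z → z ∈ p '' Set.Icc 0 m) → Lf G D x2 := fun h => by
    have := hp.rev.lf hm (hpD (m-1) (by omega)) (fun z hz hz' => by
      simp only [Nat.sub_zero, hpm] at hz'
      obtain ⟨i, hi, rfl⟩ := h z hz hz'
      exact ⟨m - i, by simp, by simp only [Set.mem_Icc] at hi; change p (m - (m - i)) = p i; rw [show m - (m - i) = i by omega]⟩)
    simpa only [Nat.sub_zero, hpm] using this
  have hps : p '' Set.Icc 0 m ⊆ D := by rintro _ ⟨i, hi, rfl⟩; exact hpD i hi.2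
  have m1 : x1 ∈ p '' Set.Icc 0 m := ⟨0, by simp, hp0⟩
  have m2 : x2 ∈ p '' Set.Icc 0 m := ⟨m, by simp, hpm⟩
  by_cases hA : ∃ x3 g3, con x3 g3 ∧ x3 ≠ x1 ∧ x3 ≠ x2
  · obtain ⟨x3, g3, c3, h13, h23⟩ := hA
    have uq : ∀ {x g g'}, x = x1 ∨ x = x2 ∨ x = x3 → con x g → con x g' → g' = g := by
      intro x g g' hx h h'
      by_contra hne
      rcases hx with rfl | rfl | rfl
      · exact four (h3 _ _ h) (h3 _ _ h') (h3 _ _ c2) (h3 _ _ c3) (Ne.symm hne) (hg h c2 h12.symm) (hg h c3 h13.symm) (hg h' c2 h12.symm) (hg h' c3 h13.symm) (hg c2 c3 h23.symm)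
      · exact four (h3 _ _ h) (h3 _ _ h') (h3 _ _ c1) (h3 _ _ c3) (Ne.symm hne) (hg h c1 h12) (hg h c3 h23.symm) (hg h' c1 h12) (hg h' c3 h23.symm) (hg c1 c3 h13.symm)
      · exact four (h3 _ _ h) (h3 _ _ h') (h3 _ _ c1) (h3 _ _ c2) (Ne.symm hne) (hg h c1 h13) (hg h c2 h23) (hg h' c1 h13) (hg h' c2 h23) (hg c1 c2 h12.symm)
    have al : ∀ x g, con x g → x = x1 ∨ x = x2 ∨ x = x3 := by
      intro x g h
      by_contra hne
      push Not at hne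
      exact four (h3 _ _ h) (h3 _ _ c1) (h3 _ _ c2) (h3 _ _ c3) (hg h c1 hne.1) (hg h c2 hne.2.1) (hg h c3 hne.2.2) (hg c1 c2 h12.symm) (hg c1 c3 h13.symm) (hg c2 c3 h23.symm)
    have f1 : Lf G D x1 → _ := fun h => (⟨x1, g1, c1, fun g' h' => uq (Or.inl rfl) c1 h', h⟩ : ∃ x g, con x g ∧ (∀ g', con x g' → g' = g) ∧ Lf G D x)
    have f2 : Lf G D x2 → _ := fun h => (⟨x2, g2, c2, fun g' h' => uq (Or.inr (Or.inl rfl)) c2 h', h⟩ : ∃ x g, con x g ∧ (∀ g', con x g' → g' = g) ∧ Lf G D x)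
    have f3 : Lf G D x3 → _ := fun h => (⟨x3, g3, c3, fun g' h' => uq (Or.inr (Or.inr rfl)) c3 h', h⟩ : ∃ x g, con x g ∧ (∀ g', con x g' → g' = g) ∧ Lf G D x)
    have d3 := hcD _ _ c3
    by_cases hxp : x3 ∈ p '' Set.Icc 0 m
    · have hs := hmin _ hps (hp.seg (by omega) le_rfl) (fun x g h => by rcases al x g h with rfl | rfl | rfl <;> assumption)
      exact f1 (l1 (fun z hz _ => hs hz))
    obtain ⟨a0, ha0, b0, hb0, ha1, hb1, hab⟩ := hD.cut (P := p '' Set.Icc 0 m) d1 m1 d3 hxp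
    obtain ⟨E, hE⟩ : ∃ E, E = cmp G (D \ p '' Set.Icc 0 m) x3 := ⟨_, rfl⟩
    have hx3 : x3 ∈ D \ p '' Set.Icc 0 m := ⟨d3, hxp⟩
    obtain ⟨e0, he0, a1, ha1, hea⟩ : ∃ e ∈ E, ∃ a ∈ p '' Set.Icc 0 m, G.Adj e a := by
      by_contra hcon; push Not at hcon
      have : x1 ∈ E := (hD.2 x3 d3 x1 d1).ind (hE ▸ mem_cmp) (fun y hy _ z hz hyz => by
        by_cases h : z ∈ p '' Set.Icc 0 m
        · exact absurd hyz (hcon y hy z h)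
        · rw [hE] at hy ⊢; exact cmp_step hx3 hy ⟨hz, h⟩ hyz)
      rw [hE] at this
      exact (cmp_sub hx3 this).2 m1
    have hEs : E ⊆ D \ p '' Set.Icc 0 m := hE ▸ cmp_sub hx3
    obtain ⟨q, n, hq, hqE, hq0, ⟨a, ha, hqa⟩, hqn, -⟩ := ipath (G := G) (D := E) (R := fun x => x = x3) (Q := fun x => ∃ a ∈ p '' Set.Icc 0 m, G.Adj x a) (hE ▸ Cn_cmp hx3)
      (hE ▸ mem_cmp) rfl he0 ⟨a1, ha1, hea⟩
    have hs := hmin (p '' Set.Icc 0 m ∪ q '' Set.Icc 0 n) (Set.union_subset hps (by rintro _ ⟨i, hi, rfl⟩; exact (hEs (hqE i hi.2)).1))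
      ((hp.seg (by omega) le_rfl).union (hq.seg (by omega) le_rfl) ⟨a, ha, q n, ⟨n, by simp, rfl⟩, Or.inr hqa.symm⟩) (fun x g h => by
        rcases al x g h with rfl | rfl | rfl
        · exact Or.inl m1
        · exact Or.inl m2
        · exact Or.inr ⟨0, by simp, hq0⟩)
    by_cases hn : 0 < n
    · refine f3 (hq0 ▸ hq.lf hn (hEs (hqE 1 hn)).1 (fun z hz h => (hs hz).resolve_left (fun h' => hqn 0 hn ⟨z, h', h⟩)))
    have hn : n = 0 := by omega
    subst hn
    have hs' : ∀ z ∈ D, z ∈ p '' Set.Icc 0 m ∨ z = x3 := fun z hz => by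
      rcases hs hz with h | ⟨i, hi, rfl⟩
      · exact Or.inl h
      · simp only [Set.mem_Icc] at hi; rw [show i = 0 by omega]; exact Or.inr hq0
    by_cases e1 : G.Adj x1 x3
    · by_cases e2 : G.Adj x2 x3
      · exfalso
        have hm1 : m ≠ 1 := fun e => hT x3 x1 x2 e1.symm e2.symm (by rw [← hp0, ← hpm, e]; exact hp.1 0 hm)
        have hcn : Cn G (insert x1 (insert x3 (p '' Set.Icc 2 m))) :=
          ((hp.seg (by omega) le_rfl).insert ⟨m, by simp; omega, hpm⟩ e2.symm).insert (Or.inl rfl) e1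
        have := hmin _ (by
          rintro z (rfl | rfl | ⟨i, hi, rfl⟩)
          · exact d1
          · exact d3
          · exact hpD i hi.2) hcn (fun x g h => by
            rcases al x g h with rfl | rfl | rfl
            · exact Or.inl rfl
            · exact Or.inr (Or.inr ⟨m, by simp; omega, hpm⟩)
            · exact Or.inr (Or.inl rfl)) (hpD 1 hm)
        rcases this with h | h | ⟨i, hi, h⟩
        · have := hp.inj (i := 1) (j := 0) (by omega) (by omega) (h.trans hp0.symm); omega
        · exact hxp (h ▸ ⟨1, by simp; omega, rfl⟩)
        · have := hp.inj hi.2 (by omega) h; simp at hi; omega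
      · exact f2 (l2 (fun z hz h => (hs' z hz).resolve_right (fun e => e2 (e ▸ h))))
    · exact f1 (l1 (fun z hz h => (hs' z hz).resolve_right (fun e => e1 (e ▸ h))))
  · push Not at hA
    have hs := hmin _ hps (hp.seg (by omega) le_rfl) (fun x g h => by
      by_cases e : x = x1
      · rw [e]; exact m1
      · rw [hA x g h e]; exact m2)
    by_cases h : ∀ g', con x1 g' → g' = g1
    · exact ⟨x1, g1, c1, h, l1 (fun z hz _ => hs hz)⟩
    · push Not at h
      obtain ⟨g', c1', hne⟩ := h
      refine ⟨x2, g2, c2, fun g'' c2' => ?_, l2 (fun z hz _ => hs hz)⟩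
      by_contra hne'
      exact four (h3 _ _ c1) (h3 _ _ c1') (h3 _ _ c2) (h3 _ _ c2') hne.symm (hg c1 c2 h12.symm) (hg c1 c2' h12.symm) (hg c1' c2 h12.symm) (hg c1' c2' h12.symm) (Ne.symm hne')
end Paper

namespace Paper
variable {V : Type} {G G' : SimpleGraph V} {A B C D P S X Z U K L E : Set V} {x y z v w w' a a' u k0 k1 : V} {𝓑 : Set (Set V)} {k : ℕ}

def X1 {β : Type} (G : SimpleGraph V) (H : SimpleGraph β) (N : β → Set V) : Prop := ∀ i j x y, i ≠ j → x ∈ N i → y ∈ N j → G.Adj x y → H.Adj i j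
def X2 {β : Type} (G : SimpleGraph V) (N : β → Set V) : Prop := ∀ i j x x' y y', i ≠ j → x ∈ N i → x' ∈ N i → y ∈ N j → y' ∈ N j → G.Adj x y → G.Adj x' y' → x = x'
def D3 {β : Type} (H : SimpleGraph β) : Prop := ∀ h, ∃ b c d, ∀ z, H.Adj h z → z = b ∨ z = c ∨ z = d

lemma sd_ss {β : Type} {H : SimpleGraph β} {u v i j : β} : (subdivideEdge H u v).Adj (some i) (some j) ↔ H.Adj i j ∧ ¬(i = u ∧ j = v) ∧ ¬(i = v ∧ j = u) := by
  simp only [subdivideEdge, SimpleGraph.fromRel_adj]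
  constructor
  · rintro ⟨-, (⟨a, b, ha, hb, h1, h2, h3⟩ | ⟨h, -⟩) | (⟨a, b, ha, hb, h1, h2, h3⟩ | ⟨h, -⟩)⟩
    · cases ha; cases hb; exact ⟨h1, h2, h3⟩
    · cases h
    · cases ha; cases hb; exact ⟨h1.symm, fun h => h3 h.symm, fun h => h2 h.symm⟩
    · cases h
  · rintro ⟨h1, h2, h3⟩
    exact ⟨fun h => h1.ne (Option.some.inj h), Or.inl (Or.inl ⟨i, j, rfl, rfl, h1, h2, h3⟩)⟩
lemma sd_ns {β : Type} {H : SimpleGraph β} {u v i : β} : (subdivideEdge H u v).Adj none (some i) ↔ i = u ∨ i = v := by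
  simp [subdivideEdge, SimpleGraph.fromRel_adj]

lemma extract [Finite V] (hT : Tf G) : ∀ (n : ℕ) (β : Type) [Fintype β] (H : SimpleGraph β) (N : β → Set V), ∑ h, ((N h).ncard - 1) < n →
    Mdl G H N → X1 G H N → X2 G N → D3 H → ∃ (α : Type) (S : SimpleGraph α), IsSubdivision S H ∧ ContainsInduced G S := by
  classical
  intro n
  induction n with
  | zero => intro β _ H N h; omega
  | succ n ih =>
  intro β _ H N hn hM h1 h2 h3
  by_cases ha : ∃ h D', D' ⊂ N h ∧ Cn G D' ∧ ∀ x ∈ N h, ∀ g, g ≠ h → ∀ y ∈ N g, G.Adj x y → x ∈ D'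
  · obtain ⟨h, D', hD, hc, hx⟩ := ha
    have e1 : {z | z ∈ N h ∧ (h = h → z ∈ D')} = D' := by ext z; exact ⟨fun hz => hz.2 rfl, fun hz => ⟨hD.1 hz, fun _ => hz⟩⟩
    have e2 : ∀ i, i ≠ h → {z | z ∈ N i ∧ (i = h → z ∈ D')} = N i := fun i hi => by ext z; exact ⟨fun hz => hz.1, fun hz => ⟨hz, fun e => absurd e hi⟩⟩
    refine ih β H (fun i => {z | z ∈ N i ∧ (i = h → z ∈ D')}) ?_ ⟨fun i => ?_, fun i j hij => (hM.2.1 i j hij).mono (fun _ hz => hz.1) (fun _ hz => hz.1), fun i j hij => ?_⟩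
      (fun i j x y hij hx hy => h1 i j x y hij hx.1 hy.1) (fun i j x x' y y' hij hx hx' hy hy' => h2 i j x x' y y' hij hx.1 hx'.1 hy.1 hy'.1) h3
    · refine lt_of_lt_of_le (Finset.sum_lt_sum (fun i _ => Nat.sub_le_sub_right (ncard_le_ncard (fun _ hz => hz.1)) 1) ⟨h, Finset.mem_univ _, ?_⟩) (Nat.lt_succ_iff.mp hn)
      rw [e1]
      have := ncard_lt_ncard hD (toFinite _)
      have := (ncard_pos (toFinite _)).2 hc.1
      omega
    · by_cases hi : i = h
      · subst hi; exact (congrArg (Cn G) e1).mpr hc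
      · exact (congrArg (Cn G) (e2 i hi)).mpr (hM.1 i)
    · obtain ⟨a, haN, b, hbN, hab⟩ := hM.2.2 i j hij
      exact ⟨a, ⟨haN, fun e => by subst e; exact hx a haN j hij.ne' b hbN hab⟩, b, ⟨hbN, fun e => by subst e; exact hx b hbN i hij.ne a haN hab.symm⟩, hab⟩
  by_cases hb : ∀ h, ∀ x ∈ N h, ∀ y ∈ N h, x = y
  · choose f hf using fun h => (hM.1 h).1
    have hinj : Function.Injective f := fun i j hij => by
      by_contra hne
      exact Set.disjoint_left.1 (hM.2.1 i j hne) (hf i) (hij ▸ hf j)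
    refine ⟨β, H, .base ⟨Iso.refl⟩, Set.range f, ⟨⟨Equiv.ofInjective f hinj, fun {i j} => ?_⟩⟩⟩
    change G.Adj (f i) (f j) ↔ _
    constructor
    · intro h
      exact h1 i j _ _ (fun e => h.ne (e ▸ rfl)) (hf i) (hf j) h
    · intro h
      obtain ⟨a, ha, b, hb', hab⟩ := hM.2.2 i j h
      rwa [hb i _ ha _ (hf i), hb j _ hb' _ (hf j)] at hab
  push Not at hb
  obtain ⟨h, x0, hx0, y0, hy0, hxy0⟩ := hb
  obtain ⟨b, c, d, hbcd⟩ := h3 h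
  obtain ⟨x, g, ⟨hxN, hgh, y, hy, hxy⟩, huq, hlf⟩ := leaf (con := fun x g => x ∈ N h ∧ g ≠ h ∧ ∃ y ∈ N g, G.Adj x y) (D := N h) (b := b) (c := c) (d := d) hT (hM.1 h)
    (fun x x' g ⟨hx, hg, y, hy, hxy⟩ ⟨hx', _, y', hy', hxy'⟩ => h2 h g x x' y y' hg.symm hx hx' hy hy' hxy hxy')
    (fun x g ⟨hx, hg, y, hy, hxy⟩ => hbcd g (h1 h g x y hg.symm hx hy hxy)) (fun x g hx => hx.1)
    (fun D' hD' hc hx => by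
      by_contra hne
      exact ha ⟨h, D', ⟨hD', hne⟩, hc, fun x hxN g hg y hy hxy => hx x g ⟨hxN, hg, y, hy, hxy⟩⟩) hx0 hy0 hxy0
  have hHg : H.Adj h g := h1 h g x y hgh.symm hxN hy hxy
  have hxi : ∀ i, x ∈ N i → i = h := fun i hi => by
    by_contra hne
    exact Set.disjoint_left.1 (hM.2.1 i h hne) hi hxN
  have key : ∀ i j a b, i ≠ j → a ∈ N i → b ∈ N j → G.Adj a b → ¬(i = h ∧ j = g) → a ≠ x := by
    rintro i j a b hij ha hb hab hne rfl
    obtain rfl := hxi i ha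
    exact hne ⟨rfl, huq j ⟨ha, hij.symm, b, hb, hab⟩⟩
  have hxn : ∀ i a, a ∈ N i → a ≠ x → G.Adj x a → i = h ∨ i = g := fun i a ha _ hxa => by
    by_cases hi : i = h
    · exact Or.inl hi
    · exact Or.inr (huq i ⟨hxN, hi, a, ha, hxa⟩)
  suffices ∃ (α : Type) (S : SimpleGraph α), IsSubdivision S (subdivideEdge H h g) ∧ ContainsInduced G S by
    obtain ⟨α, S, hS, hc⟩ := this
    exact ⟨α, S, .step h g hHg hS, hc⟩
  refine ih (Option β) (subdivideEdge H h g) (fun o => o.elim {x} (fun i => N i \ {x})) ?_ ⟨?_, ?_, ?_⟩ ?_ ?_ ?_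
  · rw [Fintype.sum_option]
    simp only [Option.elim, ncard_singleton, Nat.sub_self, zero_add]
    refine lt_of_lt_of_le (Finset.sum_lt_sum (fun i _ => Nat.sub_le_sub_right (ncard_le_ncard (fun _ hz => hz.1)) 1) ⟨h, Finset.mem_univ _, ?_⟩) (Nat.lt_succ_iff.mp hn)
    have := ncard_sdiff_singleton_of_mem hxN
    have := (one_lt_ncard (toFinite (N h))).2 ⟨x0, hx0, y0, hy0, hxy0⟩
    omega
  · rintro (_ | i)
    · exact Cn_single
    · by_cases hi : i = h
      · subst hi; exact hlf.cn (hM.1 i)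
      · change Cn G (N i \ {x})
        rw [sdiff_singleton_eq_self (fun hh => hi (hxi i hh))]; exact hM.1 i
  · rintro (_ | i) (_ | j) hij
    · exact absurd rfl hij
    · exact Set.disjoint_left.2 (fun z hz hz' => hz'.2 hz)
    · exact Set.disjoint_left.2 (fun z hz hz' => hz.2 hz')
    · exact (hM.2.1 i j (fun e => hij (e ▸ rfl))).mono (fun _ hz => hz.1) (fun _ hz => hz.1)
  · have hns : ∀ i, i = h ∨ i = g → AdjS G {x} (N i \ {x}) := by
      rintro i (rfl | rfl)
      · obtain ⟨z, hz, hxz, -⟩ := hlf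
        exact ⟨x, rfl, z, ⟨hz, hxz.ne'⟩, hxz⟩
      · exact ⟨x, rfl, y, ⟨hy, hxy.ne'⟩, hxy⟩
    rintro (_ | i) (_ | j) hij
    · exact absurd rfl hij.ne
    · exact hns j (sd_ns.1 hij)
    · exact (hns i (sd_ns.1 hij.symm)).symm
    · obtain ⟨e1, e2, e3⟩ := sd_ss.1 hij
      obtain ⟨a, ha, b, hb, hab⟩ := hM.2.2 i j e1
      exact ⟨a, ⟨ha, key i j a b e1.ne ha hb hab e2⟩, b, ⟨hb, key j i b a e1.ne' hb ha hab.symm (fun e => e3 ⟨e.2, e.1⟩)⟩, hab⟩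
  · rintro (_ | i) (_ | j) a b hij ha hb hab
    · exact absurd rfl hij
    · obtain rfl : a = x := ha
      exact sd_ns.2 (hxn j b hb.1 hb.2 hab)
    · obtain rfl : b = x := hb
      exact (sd_ns.2 (hxn i a ha.1 ha.2 hab.symm)).symm
    · have hij : i ≠ j := fun e => hij (e ▸ rfl)
      refine sd_ss.2 ⟨h1 i j a b hij ha.1 hb.1 hab, ?_, ?_⟩
      · rintro ⟨rfl, rfl⟩
        exact ha.2 (h2 i j a x b y hij ha.1 hxN hb.1 hy hab hxy)
      · rintro ⟨rfl, rfl⟩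
        exact hb.2 (h2 j i b x a y hij.symm hb.1 hxN ha.1 hy hab.symm hxy)
  · rintro (_ | i) (_ | j) a a' b b' hij ha ha' hb hb' hab hab'
    · exact absurd rfl hij
    · exact Eq.trans ha (Eq.symm ha')
    · obtain rfl : b = x := hb
      obtain rfl : b' = b := hb'
      by_cases hi : i = h
      · subst hi
        obtain ⟨z, -, -, hz⟩ := hlf
        rw [hz a ha.1 hab.symm, hz a' ha'.1 hab'.symm]
      · exact h2 i h a a' b' b' hi ha.1 ha'.1 hxN hxN hab hab'
    · exact h2 i j a a' b b' (fun e => hij (e ▸ rfl)) ha.1 ha'.1 hb.1 hb'.1 hab hab'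
  · rintro (_ | i)
    · refine ⟨some h, some g, some g, ?_⟩
      rintro (_ | i) hi
      · exact absurd rfl hi.ne
      · rcases sd_ns.1 hi with rfl | rfl <;> simp
    · obtain ⟨b, c, d, hh⟩ := h3 i
      obtain ⟨f, hf⟩ : ∃ f : β → Option β, f = fun z => if (i = h ∧ z = g) ∨ (i = g ∧ z = h) then none else some z := ⟨_, rfl⟩
      refine ⟨f b, f c, f d, fun o ho => ?_⟩
      suffices ∃ z, H.Adj i z ∧ o = f z by
        obtain ⟨z, hz, rfl⟩ := this
        rcases hh z hz with rfl | rfl | rfl <;> simp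
      rcases o with _ | j
      · rcases sd_ns.1 ho.symm with rfl | rfl
        · exact ⟨g, hHg, by simp [hf]⟩
        · exact ⟨h, hHg.symm, by simp [hf]⟩
      · obtain ⟨e1, e2, e3⟩ := sd_ss.1 ho
        exact ⟨j, e1, by rw [hf]; simp only; rw [if_neg (by tauto)]⟩
end Paper

namespace Paper
variable {V : Type} {G G' : SimpleGraph V} {A B C D P S X Z U K L E : Set V} {x y z v w w' a a' u k0 k1 : V} {𝓑 : Set (Set V)} {k : ℕ}

def Two {β : Type} (H : SimpleGraph β) (h : β) : Prop := ∃ p q, p ≠ q ∧ H.Adj h p ∧ H.Adj h q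

lemma mini [Finite V] {β : Type} [Finite β] {H : SimpleGraph β} {M : β → Set V} (hM : Mdl G H M) (hU : ∀ h, M h ⊆ U)
    (hL : ∀ h h' x y, h ≠ h' → x ∈ M h → y ∈ M h' → G.Adj x y → Lgt G U x ∨ Lgt G U y) :
    ∃ N, Mdl G H N ∧ ∀ h h' x y, Two H h → Two H h' → h ≠ h' → x ∈ N h → y ∈ N h' → G.Adj x y →
      H.Adj h h' ∧ ∀ x' ∈ N h, ∀ y' ∈ N h', G.Adj x' y' → x' = x ∧ y' = y := by
  classical
  obtain ⟨N, ⟨hNM, hN⟩, hmin⟩ := (toFinite {N : β → Set V | N ≤ M ∧ Mdl G H N}).exists_minimal ⟨M, le_rfl, hM⟩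
  have dj : ∀ {i j w}, w ∈ N i → w ∈ N j → i = j := fun {i j w} h1 h2 => by
    by_contra hne
    exact Set.disjoint_left.1 (hN.2.1 i j hne) h1 h2
  have cl : ∀ h h' x y, Two H h → h ≠ h' → x ∈ N h → y ∈ N h' → G.Adj x y → Lgt G U x →
      H.Adj h h' ∧ ∀ x' ∈ N h, ∀ y' ∈ N h', G.Adj x' y' → x' = x ∧ y' = y := by
    intro h h' x y ⟨p, q, hpq, hp, hq⟩ hne hx hy hxy ⟨b, c, hbc⟩
    have hbc' : ∀ {i w}, w ∈ N i → G.Adj x w → w = b ∨ w = c := fun {i w} hw hxw => hbc w (hU i (hNM i hw)) hxw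
    by_cases hs : ∀ z ∈ N h, z = x
    · obtain ⟨x1, hx1, wp, hwp, h1⟩ := hN.2.2 h p hp
      obtain ⟨x2, hx2, wq, hwq, h2⟩ := hN.2.2 h q hq
      rw [hs _ hx1] at h1; rw [hs _ hx2] at h2
      have hw : wp ≠ wq := fun e => hpq (dj hwp (e ▸ hwq))
      have e1 := hbc' hwp h1
      have e2 := hbc' hwq h2
      have al : ∀ {i w}, w ∈ N i → G.Adj x w → w = wp ∨ w = wq := fun {i w} hi h => by
        have := hbc' hi h; clear * - this e1 e2 hw; grind
      constructor
      · rcases al hy hxy with rfl | rfl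
        · rw [dj hy hwp]; exact hp
        · rw [dj hy hwq]; exact hq
      · intro x' hx' y' hy' hxy'
        rw [hs _ hx'] at hxy'
        refine ⟨hs _ hx', ?_⟩
        rcases al hy hxy with rfl | rfl <;> rcases al hy' hxy' with rfl | rfl
        · rfl
        · exact absurd ((dj hwp hy).trans (dj hy' hwq)) hpq
        · exact absurd ((dj hwp hy').trans (dj hy hwq)) hpq
        · rfl
    · push Not at hs
      obtain ⟨z0, hz0, hzx⟩ := hs
      obtain ⟨x1, hx1, z, hz, hx2, hz2, hxz⟩ := (hN.1 h).cut (P := {x}) hx rfl hz0 hzx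
      obtain rfl : x1 = x := by assumption
      replace hz : z ∈ N h := by assumption
      have hzy : z ≠ y := fun e => hne (dj hz (e ▸ hy))
      have al : ∀ {i w}, w ∈ N i → G.Adj x1 w → w = y ∨ w = z := fun {i w} hi h => by
        have := hbc' hi h
        have e1 := hbc' hz hxz
        have e2 := hbc' hy hxy
        clear * - this e1 e2 hzy; grind
      have al2 : ∀ {i w}, w ∈ N i → G.Adj x1 w → i ≠ h → w = y := fun {i w} hi h hih => (al hi h).resolve_right (fun e => hih (dj hi (e ▸ hz)))
      have hlf : Lf G (N h) x1 := ⟨z, hz, hxz, fun w hw h => (al hw h).resolve_left (fun e => hne (dj hw (e ▸ hy)))⟩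
      by_contra hcon
      have ex : H.Adj h h' → ∃ x' ∈ N h, ∃ y' ∈ N h', G.Adj x' y' ∧ x' ≠ x1 ∧ y' ≠ x1 := by
        intro hH
        by_contra hc2
        refine hcon ⟨hH, fun x' hx' y' hy' h => ?_⟩
        have : x' = x1 := by
          by_contra hne'
          exact hc2 ⟨x', hx', y', hy', h, hne', fun e => hne (dj hx (e ▸ hy'))⟩
        subst this
        exact ⟨rfl, al2 hy' h hne.symm⟩
      have rem : Mdl G H (fun i => N i \ {x1}) := by
        refine ⟨fun i => ?_, fun i j hij => (hN.2.1 i j hij).mono (fun _ hz => hz.1) (fun _ hz => hz.1), fun i j hij => ?_⟩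
        · by_cases hi : i = h
          · subst hi; exact hlf.cn (hN.1 i)
          · have := hN.1 i
            rwa [← sdiff_singleton_eq_self (fun hh => hi (dj hh hx) : x1 ∉ N i)] at this
        · have st : ∀ i j a b, H.Adj i j → a ∈ N i → b ∈ N j → G.Adj a b → a = x1 → AdjS G (N i \ {x1}) (N j \ {x1}) := by
            rintro i j a b hij ha hb hab rfl
            obtain rfl := dj ha hx
            obtain rfl := al2 hb hab hij.ne'
            obtain rfl := dj hb hy
            obtain ⟨x', hx', y', hy', h1, h2, h3⟩ := ex hij
            exact ⟨x', ⟨hx', h2⟩, y', ⟨hy', h3⟩, h1⟩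
          obtain ⟨a, ha, b, hb, hab⟩ := hN.2.2 i j hij
          by_cases e1 : a = x1
          · exact st i j a b hij ha hb hab e1
          by_cases e2 : b = x1
          · exact (st j i b a hij.symm hb ha hab.symm e2).symm
          exact ⟨a, ⟨ha, e1⟩, b, ⟨hb, e2⟩, hab⟩
      exact (hmin (y := fun i => N i \ {x1}) ⟨fun i => fun w hw => hNM i hw.1, rem⟩ (fun i w hw => hw.1) h hx).2 rfl
  refine ⟨N, hN, fun h h' x y t1 t2 hne hx hy hxy => ?_⟩
  rcases hL h h' x y hne (hNM h hx) (hNM h' hy) hxy with hl | hl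
  · exact cl h h' x y t1 hne hx hy hxy hl
  · obtain ⟨h1, h2⟩ := cl h' h y x t2 hne.symm hy hx hxy.symm hl
    exact ⟨h1.symm, fun x' hx' y' hy' h => (h2 y' hy' x' hx' h.symm).symm⟩

lemma lift {W β : Type} {r : V → W} {H : SimpleGraph β} {N : β → Set W} (hf : ∀ x ∈ U, Cn G {y | y ∈ U ∧ r y = r x})
    (hN : Mdl (Qt G U r) H N) (hH : ∀ h, ∃ h', H.Adj h h') : Mdl G H (fun h => {x | x ∈ U ∧ r x ∈ N h}) := by
  have hadj : ∀ h h', H.Adj h h' → AdjS G {x | x ∈ U ∧ r x ∈ N h} {x | x ∈ U ∧ r x ∈ N h'} := by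
    intro h h' hh
    obtain ⟨α, hα, β, hβ, -, x, hx, y, hy, rfl, rfl, hxy⟩ := hN.2.2 h h' hh
    exact ⟨x, ⟨hx, hα⟩, y, ⟨hy, hβ⟩, hxy⟩
  refine ⟨fun h => ?_, fun h h' hne => Set.disjoint_left.2 (fun x hx hx' => Set.disjoint_left.1 (hN.2.1 h h' hne) hx.2 hx'.2), hadj⟩
  obtain ⟨h', hh⟩ := hH h
  obtain ⟨x0, hx0, -⟩ := hadj h h' hh
  have fib : ∀ x ∈ U, ∀ y ∈ U, r y = r x → r x ∈ N h → Rch G {x | x ∈ U ∧ r x ∈ N h} x y := fun x hx y hy e hxN =>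
    ((hf x hx).2 x ⟨hx, rfl⟩ y ⟨hy, e⟩).mono (fun z hz => ⟨hz.1, hz.2.symm ▸ hxN⟩)
  have : ∀ α, Rch (Qt G U r) (N h) (r x0) α → ∀ y ∈ U, r y = α → Rch G {x | x ∈ U ∧ r x ∈ N h} x0 y := by
    intro α hα
    induction hα with
    | refl => exact fun y hy e => fib x0 hx0.1 y hy e hx0.2
    | tail _ hs ih =>
      intro y hy e
      obtain ⟨⟨-, u, hu, w, hw, rfl, rfl, huw⟩, h1, h2⟩ := hs
      exact ((ih u hu rfl).trans (Rch.adj huw ⟨hu, h1⟩ ⟨hw, h2⟩)).trans (fib w hw y hy e h2)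
  exact Cn_of hx0 (fun y hy => this (r y) ((hN.1 h).2 _ hx0.2 _ hy.2) y hy.1 rfl)

lemma wall_adj {n : ℕ} {a b : Fin n × Fin (2*n)} : (Wall n).Adj a b ↔ (a.1.val = b.1.val ∧ (a.2.val + 1 = b.2.val ∨ b.2.val + 1 = a.2.val)) ∨
    (a.2.val = b.2.val ∧ ((a.1.val + 1 = b.1.val ∧ (a.1.val + a.2.val) % 2 = 0) ∨ (b.1.val + 1 = a.1.val ∧ (b.1.val + b.2.val) % 2 = 0))) := by
  simp only [Wall, SimpleGraph.fromRel_adj, ne_eq, Prod.ext_iff, Fin.ext_iff]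
  omega

lemma wall_D3 {n : ℕ} : D3 (Wall n) := by
  classical
  intro a
  obtain ⟨f, hf⟩ : ∃ f : ℕ → ℕ → Fin n × Fin (2*n), ∀ z : Fin n × Fin (2*n), ∀ p q, z.1.val = p → z.2.val = q → z = f p q :=
    ⟨fun p q => if h : p < n ∧ q < 2*n then (⟨p, h.1⟩, ⟨q, h.2⟩) else a, by
      rintro ⟨z1, z2⟩ p q rfl rfl
      simp⟩
  refine ⟨f a.1 (a.2+1), f a.1 (a.2-1), f (if (a.1.val + a.2.val) % 2 = 0 then a.1+1 else a.1-1) a.2, fun z hz => ?_⟩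
  rcases wall_adj.1 hz with ⟨e, h | h⟩ | ⟨e, h | h⟩
  · exact Or.inl (hf _ _ _ e.symm h.symm)
  · exact Or.inr (Or.inl (hf _ _ _ e.symm (by omega)))
  · exact Or.inr (Or.inr (hf _ _ _ (by rw [if_pos h.2]; omega) e.symm))
  · exact Or.inr (Or.inr (hf _ _ _ (by rw [if_neg (by omega)]; omega) e.symm))

lemma wall_nb {n : ℕ} (h : Fin n × Fin (2*n)) : ∃ h', (Wall n).Adj h h' := by
  by_cases h2 : h.2.val + 1 < 2*n
  · exact ⟨(h.1, ⟨h.2.val+1, h2⟩), wall_adj.2 (by simp)⟩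
  · exact ⟨(h.1, ⟨h.2.val-1, by omega⟩), wall_adj.2 (by have := h.1.2; simp; omega)⟩

lemma tw_complete [Fintype V] {t : ℕ} (h : ∀ x y : V, x ≠ y → G.Adj x y) (hc : ∀ s : Set V, G.IsClique s → s.ncard ≤ t) : HasTreewidthAtMost G t := by
  have h1 := hc Set.univ (fun x _ y _ hxy => h x y hxy)
  rw [ncard_univ, Nat.card_eq_fintype_card] at h1
  refine ⟨Unit, ⊥, fun _ => Finset.univ, ⟨⟨fun _ _ => by rfl⟩, isAcyclic_bot⟩, by simp, by simp, fun v => ?_, fun _ => by rw [Finset.card_univ]; omega⟩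
  haveI : Nonempty ↑{t : Unit | v ∈ (Finset.univ : Finset V)} := ⟨⟨(), by simp⟩⟩
  exact ⟨fun a b => by rw [Subsingleton.elim a b]⟩

lemma final (t : ℕ) (ht : 0 < t) : ∃ c, ∀ (V : Type) [Fintype V] (G : SimpleGraph V), MemF t G → ¬HasStarCutset G → ¬HasTreewidthAtMost G c → ContainsWallSubdiv G t := by
  obtain ⟨k', hk'⟩ := gridthm (t+1) (by omega)
  obtain ⟨k, hk, h2⟩ : ∃ k, k' ≤ k ∧ 2 ≤ k := ⟨max k' 2, le_max_left _ _, le_max_right _ _⟩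
  refine ⟨max (3*(2*k)) t, fun V _ G hF hsc htw => ?_⟩
  have mono : ∀ c, c ≤ max (3*(2*k)) t → ¬HasTreewidthAtMost G c := by
    rintro c hc ⟨ι, T, χ, h1, h2, h3, h4, h5⟩
    exact htw ⟨ι, T, χ, h1, h2, h3, h4, fun i => (h5 i).trans (by omega)⟩
  by_cases hnc : ∃ x y, x ≠ y ∧ ¬G.Adj x y
  swap
  · push Not at hnc
    exact absurd (tw_complete hnc hF.2) (mono t (le_max_right _ _))
  have hT : Tf G := fun a b c h1 h2 h3 => tri_free hF.1 hsc hnc h1 h2 h3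
  obtain ⟨U0, 𝓑, hC⟩ := exists_crit (tw_br (k := 2*k) (by omega) (mono _ (le_max_left _ _)))
  obtain ⟨U, r, hf, hl, ⟨𝓒, b1, b2, b3⟩⟩ := quot (by omega) hC hT (star_of_sparse hF.1.1)
  obtain ⟨M, hM⟩ := hk' (Qt G U r) ⟨𝓒, b1, b2, fun S hS => b3 S (by omega)⟩
  obtain ⟨N, hN, hx⟩ := mini (U := U) (lift hf hM wall_nb) (fun h x hx => hx.1) (fun h h' x y hne hx hy hxy =>
    (hl x hx.1 y hy.1 hxy (fun e => Set.disjoint_left.1 (hM.2.1 h h' hne) hx.2 (e ▸ hy.2))).imp (fun h => h.2) (fun h => h.2))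
  obtain ⟨f, hfa⟩ : ∃ f : Fin t × Fin (2*t) → Fin (t+1) × Fin (2*(t+1)), ∀ a, (f a).1.val = a.1.val + 1 ∧ (f a).2.val = a.2.val + 1 :=
    ⟨fun a => (⟨a.1 + 1, by omega⟩, ⟨a.2 + 1, by omega⟩), fun a => ⟨rfl, rfl⟩⟩
  have hadj : ∀ a b, (Wall (t+1)).Adj (f a) (f b) ↔ (Wall t).Adj a b := fun a b => by
    rw [wall_adj, wall_adj]; have := hfa a; have := hfa b; omega
  have hinj : ∀ a b, a ≠ b → f a ≠ f b := fun a b hne e => hne (by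
    have h1 := hfa a
    have h2 := hfa b
    rw [e] at h1
    exact Prod.ext (Fin.ext (by omega)) (Fin.ext (by omega)))
  have htwo : ∀ a, Two (Wall (t+1)) (f a) := fun a => by
    have := hfa a
    have := a.2.2
    refine ⟨((f a).1, ⟨a.2, by omega⟩), ((f a).1, ⟨a.2 + 2, by omega⟩), by simp, wall_adj.2 ?_, wall_adj.2 ?_⟩
    · simp; omega
    · simp; omega
  exact extract hT _ _ (Wall t) (fun a => N (f a)) (Nat.lt_succ_self _)
    ⟨fun a => hN.1 _, fun a b hab => hN.2.1 _ _ (hinj a b hab), fun a b hab => hN.2.2 _ _ ((hadj a b).2 hab)⟩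
    (fun i j x y hij h1 h2 h => (hadj i j).1 (hx _ _ x y (htwo i) (htwo j) (hinj i j hij) h1 h2 h).1)
    (fun i j x x' y y' hij h1 h1' h2 h2' h h' => ((hx _ _ x y (htwo i) (htwo j) (hinj i j hij) h1 h2 h).2 x' h1' y' h2' h').1.symm) wall_D3
end Paper

namespace Paper

/-- every graph in `𝓕_t` with no star cutset and big enough treewidth
contains a subdivision of the `t`-by-`t` wall as an induced subgraph. -/
theorem statement4 (t : ℕ) (ht : 0 < t) :
    ∃ c : ℕ, ∀ (V : Type) [Fintype V] (G : SimpleGraph V),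
      MemF t G → ¬HasStarCutset G → ¬HasTreewidthAtMost G c →
        ContainsWallSubdiv G t := by
  exact final t ht

end Paper
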